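/- Let p be an odd prime. If p ≡ 1 (mod 4), write p = x^2 + 4y^2 with integers x, y; then Σ_{n=0}^{p−1} n^2·V_n/32^n ≡ 2x^2 − p − p^2/(4x^2) (mod p^3) and Σ_{n=0}^{p−1} n^3·V_n/32^n ≡ 6x^2 − 3p − 3p^2/(4x^2) (mod p^3). If p ≡ 3 (mod 4), then Σ_{n=0}^{p−1} n^2·V_n/32^n ≡ (1/2)R_1(p) (mod p^2) and Σ_{n=0}^{p−1} n^3·V_n/32^n ≡ (3/2)R_1(p) (mod p^2). -/

import Mathlib

/-- `a ≡ b (mod p^r)` for rationals: the numerator of `a - b` in lowest terms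
is divisible by `p^r`. -/
def ratCongr (p r : ℕ) (a b : ℚ) : Prop := (p : ℤ)^r ∣ (a - b).num
/-- `R_1(p) = (2p + 2 - 2^(p-1)) * C((p-1)/2, ⌊p/4⌋)^2`. -/
def R1 (p : ℕ) : ℚ :=
  (2*(p:ℚ) + 2 - 2^(p-1)) * (((p-1)/2).choose (p/4) : ℚ)^2

/-- `V_n = Σ_{k=0}^{n} C(2k,k)^2·C(2n-2k, n-k)^2`. -/
def seqV (n : ℕ) : ℚ :=
  ∑ k ∈ Finset.range (n+1), ((2*k).choose k : ℚ)^2 * ((2*n-2*k).choose (n-k) : ℚ)^2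

namespace S18
open PowerSeries

/-- the Euler operator -/
noncomputable def th (f : ℚ⟦X⟧) : ℚ⟦X⟧ := X * PowerSeries.derivative ℚ f

lemma coeff_th (f : ℚ⟦X⟧) (n : ℕ) : coeff n (th f) = n * coeff n f := by
  unfold th
  cases n with
  | zero => simp
  | succ n => rw [PowerSeries.coeff_succ_X_mul, PowerSeries.coeff_derivative]; push_cast; ring

lemma th_add (f g : ℚ⟦X⟧) : th (f + g) = th f + th g := by
  ext n; simp [coeff_th]; ring
lemma th_sub (f g : ℚ⟦X⟧) : th (f - g) = th f - th g := by
  ext n; simp [coeff_th]; ring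
lemma th_mul (f g : ℚ⟦X⟧) : th (f * g) = f * th g + g * th f := by
  unfold th; rw [Derivation.leibniz]; simp only [smul_eq_mul]; ring
lemma th_X : th X = X := by
  unfold th; simp
lemma th_C (c : ℚ) : th (C c) = 0 := by
  ext n; rw [coeff_th, PowerSeries.coeff_C]; split_ifs with h <;> simp [h]
lemma th_nat (c : ℕ) : th (c : ℚ⟦X⟧) = 0 := by
  have := th_C c; simpa using this
lemma th_ofNat (c : ℕ) [c.AtLeastTwo] : th (OfNat.ofNat c : ℚ⟦X⟧) = 0 := th_nat c
lemma th_zero : th (0 : ℚ⟦X⟧) = 0 := by simpa using th_nat 0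
lemma th_one : th (1 : ℚ⟦X⟧) = 0 := by simpa using th_nat 1
lemma th_sum {ι : Type*} (s : Finset ι) (f : ι → ℚ⟦X⟧) :
    th (∑ i ∈ s, f i) = ∑ i ∈ s, th (f i) := by
  ext n; simp [coeff_th, Finset.mul_sum]

/-- third order operator -/
noncomputable def LL (f : ℚ⟦X⟧) : ℚ⟦X⟧ :=
  th (th (th f)) - 8 * X * (4 * th (th (th f)) + 6 * th (th f) + 4 * th f + f)
   + 256 * X^2 * (th (th (th f)) + 3 * th (th f) + 3 * th f + f)

lemma LL_add (f g) : LL (f + g) = LL f + LL g := by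
  unfold LL; simp only [th_add]; ring

lemma LL_sub (f g) : LL (f - g) = LL f - LL g := by
  unfold LL; simp only [th_sub]; ring

lemma LL_C_mul (c : ℚ) (f) : LL (C c * f) = C c * LL f := by
  unfold LL; simp only [th_mul, th_C, mul_zero, add_zero]; ring

lemma coeff_LL (f : ℚ⟦X⟧) (n : ℕ) : coeff (n+2) (LL f) =
    ((n:ℚ)+2)^3 * coeff (n+2) f
    - 8 * (4*((n:ℚ)+1)^3+6*((n:ℚ)+1)^2+4*((n:ℚ)+1)+1) * coeff (n+1) f
    + 256 * ((n:ℚ)+1)^3 * coeff n f := by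
  have e : LL f = th (th (th f)) - X * (C 8 * (C 4 * th (th (th f)) + C 6 * th (th f) + C 4 * th f + f))
   + X * (X * (C 256 * (th (th (th f)) + C 3 * th (th f) + C 3 * th f + f))) := by
    unfold LL
    have : ∀ k : ℕ, C (k:ℚ) = (k : ℚ⟦X⟧) := fun k => by simp
    have h8 := this 8; have h4 := this 4; have h6 := this 6; have h3 := this 3; have h256 := this 256
    push_cast at h8 h4 h6 h3 h256
    rw [h8, h4, h6, h3, h256]; ring
  rw [e]
  simp only [map_add, map_sub, PowerSeries.coeff_succ_X_mul, PowerSeries.coeff_C_mul, coeff_th]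
  push_cast; ring

lemma coeff_one_LL (f : ℚ⟦X⟧) : coeff 1 (LL f) = coeff 1 f - 8 * coeff 0 f := by
  have e : LL f = th (th (th f)) - X * (C 8 * (C 4 * th (th (th f)) + C 6 * th (th f) + C 4 * th f + f))
   + X * (X * (C 256 * (th (th (th f)) + C 3 * th (th f) + C 3 * th f + f))) := by
    unfold LL
    have : ∀ k : ℕ, C (k:ℚ) = (k : ℚ⟦X⟧) := fun k => by simp
    have h8 := this 8; have h4 := this 4; have h6 := this 6; have h3 := this 3; have h256 := this 256
    push_cast at h8 h4 h6 h3 h256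
    rw [h8, h4, h6, h3, h256]; ring
  rw [e]
  rw [map_add, map_sub, PowerSeries.coeff_succ_X_mul, PowerSeries.coeff_succ_X_mul]
  have h0 : ∀ g : ℚ⟦X⟧, constantCoeff (th g) = 0 := fun g => by
    have := coeff_th g 0; simpa using this
  simp [coeff_th, h0]

noncomputable def BB : ℚ⟦X⟧ := PowerSeries.mk fun n => ((n.centralBinom : ℚ))^2

lemma cb_succ (n : ℕ) : ((n:ℚ)+1) * ((n+1).centralBinom : ℚ) = 2 * (2*n+1) * n.centralBinom := by
  exact_mod_cast Nat.succ_mul_centralBinom_succ n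

lemma BB_ode : th (th BB) = 4 * X * (4 * th (th BB) + 4 * th BB + BB) := by
  have e : 4 * X * (4 * th (th BB) + 4 * th BB + BB)
     = X * (C 4 * (C 4 * th (th BB) + C 4 * th BB + BB)) := by
    have : C (4:ℚ) = (4 : ℚ⟦X⟧) := by
      have h : C ((4:ℕ):ℚ) = ((4:ℕ) : ℚ⟦X⟧) := map_natCast _ _
      exact_mod_cast h
    rw [this]; ring
  rw [e]
  ext n
  cases n with
  | zero => simp [coeff_th]
  | succ n =>
    rw [PowerSeries.coeff_succ_X_mul]
    simp only [map_add, PowerSeries.coeff_C_mul, coeff_th, BB, PowerSeries.coeff_mk]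
    push_cast
    linear_combination (((n:ℚ)+1) * ((n+1).centralBinom : ℚ) + 2 * (2*n+1) * n.centralBinom) * cb_succ n

lemma LL_BB : LL (BB * BB) = 0 := by
  have h := BB_ode
  have h3 := congrArg th h
  have h4 : th (4 : ℚ⟦X⟧) = 0 := th_ofNat 4
  simp only [th_mul, th_add, th_X, h4] at h3
  unfold LL
  simp only [th_mul, th_add]
  linear_combination ((1 - 16 * X) * 2 * BB) * h3 + ((1 - 16 * X) * 6 * th BB - 32 * X * BB) * h

noncomputable def yy : ℚ⟦X⟧ := X - 16 * X^2

lemma th_yy : th yy = X - 32 * X^2 := by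
  unfold yy; rw [th_sub, th_mul, pow_two, th_mul, th_X, th_ofNat]; ring

lemma th_ypow (k : ℕ) : yy * th (yy ^ k) = k * yy ^ k * th yy := by
  induction k with
  | zero => simp [th_one]
  | succ k ih => rw [pow_succ, th_mul]; push_cast; linear_combination yy * ih

lemma yy_ne : yy ≠ 0 := by
  intro h
  have := congrArg (coeff 1) h
  unfold yy at this
  rw [map_sub, pow_two, ← mul_assoc, PowerSeries.coeff_one_X, mul_assoc] at this
  have e : (16 : ℚ⟦X⟧) * (X * X) = X * (16 * X) := by ring
  rw [e, PowerSeries.coeff_succ_X_mul] at this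
  simp at this

lemma LL_ypow (k : ℕ) : yy * LL (yy ^ k) =
    X * (1 - 32 * X) * ((k:ℚ⟦X⟧)^3 - 8 * (2*(k:ℚ⟦X⟧)+1)^3 * yy) * yy ^ k := by
  have h1 := th_ypow k
  have hy := th_yy
  have hy2 : th (th yy) = X - 64 * X^2 := by
    have h32 : th (32 : ℚ⟦X⟧) = 0 := th_ofNat 32
    rw [hy, th_sub, th_mul, pow_two, th_mul, th_X, h32]; ring
  have hy3 : th (th (th yy)) = X - 128 * X^2 := by
    have h32 : th (64 : ℚ⟦X⟧) = 0 := th_ofNat 64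
    rw [hy2, th_sub, th_mul, pow_two, th_mul, th_X, h32]; ring
  have h2 := congrArg th h1
  simp only [th_mul, th_nat] at h2
  have h3 := congrArg th h2
  simp only [th_mul, th_add, th_nat, th_zero] at h3
  rw [hy3, hy2, hy] at h3
  rw [hy2, hy] at h2
  rw [hy] at h1
  have hy' : yy = X - 16 * X^2 := rfl
  apply mul_left_cancel₀ (pow_ne_zero 2 yy_ne)
  unfold LL
  generalize th (th (th (yy ^ k))) = d at *
  generalize th (th (yy ^ k)) = c at *
  generalize th (yy ^ k) = b at *
  generalize yy ^ k = a at *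
  generalize (k : ℚ⟦X⟧) = κ at *
  rw [hy'] at *
  clear hy hy' hy2 hy3
  have hc : (X - 16 * X^2)^2 * c = κ * a * (X - 16 * X^2) * (X - 64 * X^2)
      + (κ - 1) * κ * a * (X - 32 * X^2)^2 := by
    linear_combination (X - 16 * X^2) * h2 + (κ-1) * (X - 32 * X^2) * h1
  have hd : (X - 16 * X^2)^3 * d = κ * a * (X - 16 * X^2)^2 * (X - 128 * X^2)
      + (2*κ-1)*κ*(X - 16 * X^2)*(X - 32 * X^2)*(X - 64 * X^2)*a
      + (κ-2) * (X - 32 * X^2) * (κ * a * (X - 16 * X^2) * (X - 64 * X^2)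
      + (κ - 1) * κ * a * (X - 32 * X^2)^2) := by
    linear_combination (X - 16 * X^2)^2 * h3 + (κ-2) * (X - 32 * X^2) * hc
      + (2*κ-1) * (X - 16 * X^2) * (X - 64 * X^2) * h1
  linear_combination (1-16*X)^2 * hd + (-48*X+768*X^2) * (X - 16 * X^2) * hc
    + (-32*X+768*X^2) * (X - 16 * X^2)^2 * h1

noncomputable def aa (k : ℕ) : ℚ := (k.centralBinom : ℚ)^3

noncomputable def GG (N : ℕ) : ℚ⟦X⟧ := ∑ k ∈ Finset.range N, C (aa k) * yy ^ k

lemma aa_succ (k : ℕ) : ((k:ℚ)+1)^3 * aa (k+1) = 8 * (2*k+1)^3 * aa k := by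
  unfold aa
  have h := cb_succ k
  have := congrArg (fun t => t^3) h
  linear_combination this

lemma LL_zero : LL 0 = 0 := by
  have := LL_C_mul 0 0
  simpa using this

lemma LL_GG (N : ℕ) : yy * LL (GG N) = - (X * (1 - 32 * X) * C ((N:ℚ)^3 * aa N) * yy ^ N) := by
  induction N with
  | zero => simp [GG, LL_zero]
  | succ N ih =>
    have e : GG (N+1) = GG N + C (aa N) * yy ^ N := by
      unfold GG; rw [Finset.sum_range_succ]
    rw [e, LL_add, LL_C_mul, mul_add, ih]
    have h := LL_ypow N
    have hs : C (((N+1:ℕ):ℚ)^3 * aa (N+1)) = 8 * (2*(N:ℚ⟦X⟧)+1)^3 * C (aa N) := by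
      push_cast
      rw [aa_succ, map_mul, map_mul, map_pow, map_add, map_mul]
      have h8 : C ((8:ℕ):ℚ) = ((8:ℕ) : ℚ⟦X⟧) := map_natCast _ _
      have h2 : C ((2:ℕ):ℚ) = ((2:ℕ) : ℚ⟦X⟧) := map_natCast _ _
      have hN : C (N:ℚ) = (N : ℚ⟦X⟧) := by simp
      push_cast at h8 h2
      rw [h8, h2, hN, map_one]
    rw [hs]
    have hN : C ((N:ℚ)^3 * aa N) = (N:ℚ⟦X⟧)^3 * C (aa N) := by
      rw [map_mul, map_pow]; simp
    rw [hN]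
    linear_combination C (aa N) * h

lemma yy_eq : yy = X * (1 - 16 * X) := by unfold yy; ring

lemma LL_GG' (N : ℕ) : LL (GG (N+1)) =
    X ^ (N+1) * (-(1 - 32 * X) * C (((N+1:ℕ):ℚ)^3 * aa (N+1)) * (1 - 16 * X)^N) := by
  apply mul_left_cancel₀ yy_ne
  rw [LL_GG, pow_succ yy, yy_eq, mul_pow]
  ring

lemma coeff_LL_GG (N n : ℕ) (h : n < N + 1) : coeff n (LL (GG (N+1))) = 0 := by
  rw [LL_GG', PowerSeries.coeff_X_pow_mul']
  rw [if_neg (by omega)]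

lemma coeff_ypow (n k : ℕ) : coeff n (yy ^ k) =
    if k ≤ n then ((-16:ℚ))^(n-k) * (k.choose (n-k) : ℚ) else 0 := by
  rw [yy_eq, mul_pow, PowerSeries.coeff_X_pow_mul']
  split_ifs with h
  · have e : (1 - 16 * X : ℚ⟦X⟧) = ((1 + Polynomial.C (-16:ℚ) * Polynomial.X : Polynomial ℚ) : ℚ⟦X⟧) := by
      have h16 : C ((16:ℕ):ℚ) = ((16:ℕ) : ℚ⟦X⟧) := map_natCast _ _
      push_cast at h16
      simp [h16, sub_eq_add_neg]
    rw [e, ← Polynomial.coe_pow, Polynomial.coeff_coe]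
    have e2 : (1 + Polynomial.C (-16:ℚ) * Polynomial.X : Polynomial ℚ)^k
       = ((1 + Polynomial.X)^k).comp (Polynomial.C (-16:ℚ) * Polynomial.X) := by simp
    rw [e2, Polynomial.comp_C_mul_X_coeff, Polynomial.coeff_one_add_X_pow]
    ring
  · rfl

lemma BB_GG (N n : ℕ) (h : n < N + 1) : coeff n (BB * BB) = coeff n (GG (N+1)) := by
  have hL : ∀ j, j < N + 1 → coeff j (LL (BB * BB - GG (N+1))) = 0 := by
    intro j hj
    rw [LL_sub, LL_BB, map_sub, coeff_LL_GG N j hj]; simp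
  have h0 : coeff 0 (BB * BB - GG (N+1)) = 0 := by
    rw [map_sub]
    have : coeff 0 (GG (N+1)) = 1 := by
      unfold GG
      rw [map_sum, Finset.sum_eq_single 0]
      · simp [aa]
      · intro b _ hb
        rw [PowerSeries.coeff_C_mul, coeff_ypow, if_neg (by omega), mul_zero]
      · simp
    rw [this]
    simp [BB]
  suffices H : ∀ n, n < N + 1 → coeff n (BB * BB - GG (N+1)) = 0 by
    have := H n h
    rw [map_sub] at this; linarith
  intro n
  induction n using Nat.strong_induction_on with
  | _ n ih =>
    intro hn
    match n, ih, hn with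
    | 0, _, _ => exact h0
    | 1, _, hn =>
      have := hL 1 hn
      rw [coeff_one_LL, h0] at this
      linarith
    | n+2, ih, hn =>
      have := hL (n+2) hn
      rw [coeff_LL, ih (n+1) (by omega) (by omega), ih n (by omega) (by omega)] at this
      have hp : ((n:ℚ)+2)^3 ≠ 0 := by positivity
      simp at this
      rcases this with h | h
      · exact absurd h (by positivity)
      · rw [map_sub]; exact h

theorem V_identity (n : ℕ) :
    ∑ k ∈ Finset.range (n+1), ((2*k).choose k : ℚ)^2 * ((2*n-2*k).choose (n-k) : ℚ)^2
    = ∑ k ∈ Finset.range (n+1), (k.centralBinom : ℚ)^3 * ((-16:ℚ)^(n-k) * (k.choose (n-k) : ℚ)) := by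
  have h := BB_GG n n (by omega)
  rw [PowerSeries.coeff_mul, Finset.Nat.sum_antidiagonal_eq_sum_range_succ_mk] at h
  unfold GG at h
  rw [map_sum] at h
  convert h using 1
  · apply Finset.sum_congr rfl
    intro k hk
    have : 2 * n - 2 * k = 2 * (n - k) := by omega
    simp only [BB, PowerSeries.coeff_mk, Nat.centralBinom, this]
  · apply Finset.sum_congr rfl
    intro k hk
    rw [PowerSeries.coeff_C_mul, coeff_ypow, if_pos (by simp at hk; omega)]
    rfl
end S18

namespace S18

/-- the `p`-integral rationals -/
def Ip (p : ℕ) [Fact p.Prime] : Subring ℚ where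
  carrier := {x | padicNorm p x ≤ 1}
  mul_mem' := by
    intro a b ha hb
    simp only [Set.mem_ofPred_eq] at *
    rw [padicNorm.mul]
    exact mul_le_one₀ ha (padicNorm.nonneg _) hb
  one_mem' := by simp
  add_mem' := by
    intro a b ha hb
    exact le_trans padicNorm.nonarchimedean (max_le ha hb)
  zero_mem' := by simp
  neg_mem' := by
    intro a ha
    simpa using ha

section
variable {p : ℕ} [hp : Fact p.Prime]

lemma inv_mem {k : ℤ} (h : ¬ (p:ℤ) ∣ k) : (k:ℚ)⁻¹ ∈ Ip p := by
  change padicNorm p _ ≤ 1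
  have : padicNorm p (k:ℚ) = 1 := by
    apply le_antisymm (padicNorm.of_int k)
    by_contra hlt
    exact h ((padicNorm.int_lt_one_iff k).1 (not_le.1 hlt))
  have h2 : padicNorm p ((k:ℚ)⁻¹) * padicNorm p (k:ℚ) = 1 := by
    rw [← padicNorm.mul, inv_mul_cancel₀]
    · simp
    · intro h0; rw [h0] at this; simp at this
  rw [this, mul_one] at h2
  exact h2.le

lemma inv_mem_nat {k : ℕ} (h : ¬ p ∣ k) : (k:ℚ)⁻¹ ∈ Ip p := by
  have := inv_mem (p := p) (k := (k:ℤ)) (by exact_mod_cast h)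
  simpa using this

lemma inv_mem_lt {k : ℕ} (h0 : 0 < k) (h : k < p) : (k:ℚ)⁻¹ ∈ Ip p :=
  inv_mem_nat (Nat.not_dvd_of_pos_of_lt h0 h)

lemma nat_mem (k : ℕ) : (k:ℚ) ∈ Ip p := natCast_mem _ k
lemma int_mem (k : ℤ) : (k:ℚ) ∈ Ip p := intCast_mem _ k

/-- congruence modulo `p^r` -/
def Cg (p : ℕ) [Fact p.Prime] (r : ℕ) (a b : ℚ) : Prop := ∃ c ∈ Ip p, a - b = (p:ℚ)^r * c

variable {r : ℕ} {a b c d : ℚ}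

lemma Cg.refl (r : ℕ) (a : ℚ) : Cg p r a a := ⟨0, zero_mem _, by ring⟩
lemma Cg.of_eq (h : a = b) : Cg p r a b := h ▸ Cg.refl r a
lemma Cg.symm (h : Cg p r a b) : Cg p r b a := by
  obtain ⟨x, hx, e⟩ := h
  exact ⟨-x, neg_mem hx, by linear_combination -e⟩
lemma Cg.trans (h : Cg p r a b) (h' : Cg p r b c) : Cg p r a c := by
  obtain ⟨x, hx, e⟩ := h
  obtain ⟨y, hy, e'⟩ := h'
  exact ⟨x + y, add_mem hx hy, by linear_combination e + e'⟩
lemma Cg.add (h : Cg p r a b) (h' : Cg p r c d) : Cg p r (a + c) (b + d) := by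
  obtain ⟨x, hx, e⟩ := h
  obtain ⟨y, hy, e'⟩ := h'
  exact ⟨x + y, add_mem hx hy, by linear_combination e + e'⟩
lemma Cg.sub (h : Cg p r a b) (h' : Cg p r c d) : Cg p r (a - c) (b - d) := by
  obtain ⟨x, hx, e⟩ := h
  obtain ⟨y, hy, e'⟩ := h'
  exact ⟨x - y, sub_mem hx hy, by linear_combination e - e'⟩
lemma Cg.neg (h : Cg p r a b) : Cg p r (-a) (-b) := by
  obtain ⟨x, hx, e⟩ := h
  exact ⟨-x, neg_mem hx, by linear_combination -e⟩
lemma Cg.mul_left (hc : c ∈ Ip p) (h : Cg p r a b) : Cg p r (c * a) (c * b) := by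
  obtain ⟨x, hx, e⟩ := h
  exact ⟨c * x, mul_mem hc hx, by linear_combination c * e⟩
lemma Cg.mul_right (hc : c ∈ Ip p) (h : Cg p r a b) : Cg p r (a * c) (b * c) := by
  obtain ⟨x, hx, e⟩ := h
  exact ⟨c * x, mul_mem hc hx, by linear_combination c * e⟩
lemma Cg.mul (ha : a ∈ Ip p) (hd : d ∈ Ip p) (h : Cg p r a b) (h' : Cg p r c d) :
    Cg p r (a * c) (b * d) :=
  (h'.mul_left ha).trans (h.mul_right hd)
lemma p_mem : (p:ℚ) ∈ Ip p := nat_mem p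
lemma Cg.mem (h : Cg p r a b) (hb : b ∈ Ip p) : a ∈ Ip p := by
  obtain ⟨x, hx, e⟩ := h
  have : a = b + (p:ℚ)^r * x := by linear_combination e
  rw [this]
  exact add_mem hb (mul_mem (pow_mem p_mem _) hx)
lemma Cg.mono {s : ℕ} (hs : s ≤ r) (h : Cg p r a b) : Cg p s a b := by
  obtain ⟨x, hx, e⟩ := h
  refine ⟨(p:ℚ)^(r-s) * x, mul_mem (pow_mem p_mem _) hx, ?_⟩
  rw [e, ← mul_assoc, ← pow_add]; congr 2; omega
lemma Cg.mul_p (s : ℕ) (h : Cg p r a b) : Cg p (r + s) ((p:ℚ)^s * a) ((p:ℚ)^s * b) := by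
  obtain ⟨x, hx, e⟩ := h
  exact ⟨x, hx, by rw [pow_add]; linear_combination (p:ℚ)^s * e⟩
lemma Cg.sum {ι : Type*} (s : Finset ι) (f g : ι → ℚ) (h : ∀ i ∈ s, Cg p r (f i) (g i)) :
    Cg p r (∑ i ∈ s, f i) (∑ i ∈ s, g i) := by
  classical
  induction s using Finset.induction_on with
  | empty => simp; exact Cg.refl _ _
  | insert a s ha ih =>
    rw [Finset.sum_insert ha, Finset.sum_insert ha]
    exact (h a (by simp)).add (ih fun i hi => h i (by simp [hi]))
lemma Cg.inv (ha : a⁻¹ ∈ Ip p) (hb : b⁻¹ ∈ Ip p) (ha0 : a ≠ 0) (hb0 : b ≠ 0) (h : Cg p r a b) :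
    Cg p r a⁻¹ b⁻¹ := by
  obtain ⟨x, hx, e⟩ := h
  refine ⟨-(x * a⁻¹ * b⁻¹), neg_mem (mul_mem (mul_mem hx ha) hb), ?_⟩
  field_simp
  linear_combination -e
lemma Cg.zero_iff : Cg p r a 0 ↔ ∃ c ∈ Ip p, a = (p:ℚ)^r * c := by
  unfold Cg; simp

lemma num_dvd_of_Cg (h : Cg p r a b) : (p:ℤ)^r ∣ (a - b).num := by
  obtain ⟨x, hx, e⟩ := h
  rw [e]
  have hd : ¬ p ∣ x.den := by
    intro hd
    have h1 : padicNorm p x ≤ 1 := hx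
    have hn : ¬ (p:ℤ) ∣ x.num := by
      intro hn
      have hc := x.reduced
      have h2 : p ∣ x.num.natAbs := Int.natCast_dvd.1 hn
      exact Nat.not_coprime_of_dvd_of_dvd hp.out.one_lt h2 hd hc
    have hxe : x * x.den = x.num := Rat.mul_den_eq_num x
    have h3 : padicNorm p x * padicNorm p (x.den:ℚ) = padicNorm p (x.num:ℚ) := by
      rw [← padicNorm.mul, hxe]
    have h4 : padicNorm p (x.den : ℚ) < 1 := by
      have := (padicNorm.int_lt_one_iff (p := p) (x.den:ℤ)).2 (by exact_mod_cast hd)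
      exact_mod_cast this
    have h5 : ¬ padicNorm p (x.num:ℚ) < 1 := fun h => hn ((padicNorm.int_lt_one_iff _).1 h)
    apply h5
    rw [← h3]
    calc _ ≤ 1 * padicNorm p (x.den:ℚ) := by
            apply mul_le_mul_of_nonneg_right h1 (padicNorm.nonneg _)
      _ < 1 := by simpa using h4
  set y := (p:ℚ)^r * x with hy
  have e1 : y.num * x.den = (p:ℤ)^r * x.num * y.den := by
    have h1 : y * y.den = y.num := Rat.mul_den_eq_num y
    have h2 : x * x.den = x.num := Rat.mul_den_eq_num x
    have : (y.num : ℚ) * x.den = (p:ℚ)^r * x.num * y.den := by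
      rw [← h1, ← h2, hy]; ring
    exact_mod_cast this
  have hcop : IsCoprime ((p:ℤ)^r) (x.den:ℤ) := by
    apply IsCoprime.pow_left
    rw [Nat.isCoprime_iff_coprime]
    exact (Nat.Prime.coprime_iff_not_dvd hp.out).2 hd
  apply hcop.dvd_of_dvd_mul_right
  rw [e1, mul_assoc]
  exact dvd_mul_right _ _

lemma Cg_of_dvd {u v : ℤ} (h : (p:ℤ)^r ∣ u - v) : Cg p r u v := by
  obtain ⟨w, hw⟩ := h
  refine ⟨w, int_mem w, ?_⟩
  exact_mod_cast hw

end
end S18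

namespace S18

lemma choose_step (k : ℕ) (t : ℚ) (f : ℕ → ℚ) :
    ∑ i ∈ Finset.range (k+2), ((k+1).choose i : ℚ) * t^i * f i
    = ∑ i ∈ Finset.range (k+1), (k.choose i : ℚ) * t^i * (f i + t * f (i+1)) := by
  rw [Finset.sum_range_succ']
  have h1 : ∑ i ∈ Finset.range (k+1), ((k+1).choose (i+1) : ℚ) * t^(i+1) * f (i+1)
     = ∑ i ∈ Finset.range (k+1), (k.choose i : ℚ) * t^i * (t * f (i+1))
      + ∑ i ∈ Finset.range (k+1), (k.choose (i+1) : ℚ) * t^(i+1) * f (i+1) := by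
    rw [← Finset.sum_add_distrib]
    apply Finset.sum_congr rfl
    intro i _
    rw [Nat.choose_succ_succ]; push_cast; ring
  have h2 : ∑ i ∈ Finset.range (k+1), (k.choose (i+1) : ℚ) * t^(i+1) * f (i+1)
      + ((k+1).choose 0 : ℚ) * t^0 * f 0
      = ∑ i ∈ Finset.range (k+1), (k.choose i : ℚ) * t^i * f i := by
    rw [Finset.sum_range_succ, Nat.choose_succ_self, Finset.sum_range_succ' _ k]
    simp
  rw [h1, add_assoc, h2, ← Finset.sum_add_distrib]
  apply Finset.sum_congr rfl
  intro i _
  ring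

lemma moments (k : ℕ) :
    (∑ i ∈ Finset.range (k+1), (k.choose i : ℚ) * (-1/2)^i * 1 = (1/2)^k) ∧
    (∑ i ∈ Finset.range (k+1), (k.choose i : ℚ) * (-1/2)^i * (i:ℚ) = -k*(1/2)^k) ∧
    (∑ i ∈ Finset.range (k+1), (k.choose i : ℚ) * (-1/2)^i * (i:ℚ)^2 = ((k:ℚ)^2-2*k)*(1/2)^k) ∧
    (∑ i ∈ Finset.range (k+1), (k.choose i : ℚ) * (-1/2)^i * (i:ℚ)^3
      = (-(k:ℚ)^3+6*k^2-6*k)*(1/2)^k) := by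
  induction k with
  | zero => simp
  | succ k ih =>
    obtain ⟨h0, h1, h2, h3⟩ := ih
    have key : ∀ f : ℕ → ℚ, ∀ a b c d : ℚ,
        (∀ i : ℕ, f i + (-1/2) * f (i+1) = a * 1 + b * i + c * (i:ℚ)^2 + d * (i:ℚ)^3) →
        ∑ i ∈ Finset.range (k+1+1), ((k+1).choose i : ℚ) * (-1/2)^i * f i =
        (a - b * k + c * ((k:ℚ)^2-2*k) + d * (-(k:ℚ)^3+6*k^2-6*k)) * (1/2)^k := by
      intro f a b c d hf
      rw [choose_step]
      have : ∀ i ∈ Finset.range (k+1), (k.choose i : ℚ) * (-1/2)^i * (f i + (-1/2) * f (i+1))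
        = a * ((k.choose i : ℚ) * (-1/2)^i * 1) + b * ((k.choose i : ℚ) * (-1/2)^i * (i:ℚ))
         + c * ((k.choose i : ℚ) * (-1/2)^i * (i:ℚ)^2) + d * ((k.choose i : ℚ) * (-1/2)^i * (i:ℚ)^3) := by
        intro i _
        rw [hf]; ring
      rw [Finset.sum_congr rfl this]
      rw [Finset.sum_add_distrib, Finset.sum_add_distrib, Finset.sum_add_distrib,
        ← Finset.mul_sum, ← Finset.mul_sum, ← Finset.mul_sum, ← Finset.mul_sum, h0, h1, h2, h3]
      ring
    refine ⟨?_, ?_, ?_, ?_⟩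
    · rw [key (fun _ => 1) (1/2) 0 0 0 (by intro i; push_cast; ring)]; push_cast; ring
    · rw [key (fun i => (i:ℚ)) (-1/2) (1/2) 0 0 (by intro i; push_cast; ring)]; push_cast; ring
    · rw [key (fun i => (i:ℚ)^2) (-1/2) (-1) (1/2) 0 (by intro i; push_cast; ring)]; push_cast; ring
    · rw [key (fun i => (i:ℚ)^3) (-1/2) (-3/2) (-3/2) (1/2) (by intro i; push_cast; ring)]
      push_cast; ring

lemma moment2 (k : ℕ) :
    ∑ i ∈ Finset.range (k+1), (k.choose i : ℚ) * (-1/2)^i * ((k:ℚ)+i)^2 = (-2:ℚ) * k * (1/2)^k := by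
  obtain ⟨h0, h1, h2, h3⟩ := moments k
  have : ∀ i ∈ Finset.range (k+1), (k.choose i : ℚ) * (-1/2)^i * ((k:ℚ)+i)^2
      = (k:ℚ)^2 * ((k.choose i : ℚ) * (-1/2)^i * 1) + 2 * k * ((k.choose i : ℚ) * (-1/2)^i * (i:ℚ))
       + ((k.choose i : ℚ) * (-1/2)^i * (i:ℚ)^2) := by intro i _; ring
  rw [Finset.sum_congr rfl this, Finset.sum_add_distrib, Finset.sum_add_distrib,
        ← Finset.mul_sum, ← Finset.mul_sum, h0, h1, h2]
  ring

lemma moment3 (k : ℕ) :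
    ∑ i ∈ Finset.range (k+1), (k.choose i : ℚ) * (-1/2)^i * ((k:ℚ)+i)^3 = (-6:ℚ) * k * (1/2)^k := by
  obtain ⟨h0, h1, h2, h3⟩ := moments k
  have : ∀ i ∈ Finset.range (k+1), (k.choose i : ℚ) * (-1/2)^i * ((k:ℚ)+i)^3
      = (k:ℚ)^3 * ((k.choose i : ℚ) * (-1/2)^i * 1) + 3 * k^2 * ((k.choose i : ℚ) * (-1/2)^i * (i:ℚ))
       + 3 * k * ((k.choose i : ℚ) * (-1/2)^i * (i:ℚ)^2)
       + ((k.choose i : ℚ) * (-1/2)^i * (i:ℚ)^3) := by intro i _; ring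
  rw [Finset.sum_congr rfl this, Finset.sum_add_distrib, Finset.sum_add_distrib,
        Finset.sum_add_distrib,
        ← Finset.mul_sum, ← Finset.mul_sum, ← Finset.mul_sum, h0, h1, h2, h3]
  ring

/-- `C(2k,k)^3/64^k` -/
noncomputable def ck (k : ℕ) : ℚ := (k.centralBinom : ℚ)^3 / 64^k

/-- inner sum -/
lemma inner_sum (p k j : ℕ) (h : 2 * k < p) (c : ℚ)
    (hm : ∑ i ∈ Finset.range (k+1), (k.choose i : ℚ) * (-1/2)^i * ((k:ℚ)+i)^j = c * (1/2)^k) :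
    ∑ n ∈ Finset.range p, (if k ≤ n then (n:ℚ)^j * ((-16:ℚ)^(n-k) * (k.choose (n-k) : ℚ)) / 32^n else 0)
     = c / 64^k := by
  have e : ∑ n ∈ Finset.range p, (if k ≤ n then (n:ℚ)^j * ((-16:ℚ)^(n-k) * (k.choose (n-k) : ℚ)) / 32^n else 0)
     = ∑ n ∈ Finset.Ico k (k + (k+1)), (n:ℚ)^j * ((-16:ℚ)^(n-k) * (k.choose (n-k) : ℚ)) / 32^n := by
    symm
    have hs : Finset.Ico k (k + (k+1)) ⊆ Finset.range p := by
      intro x hx; simp at hx ⊢; omega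
    rw [← Finset.sum_subset hs]
    · apply Finset.sum_congr rfl
      intro x hx
      simp at hx
      rw [if_pos hx.1]
    · intro x hx hx2
      simp at hx hx2
      split_ifs with hk
      · rw [Nat.choose_eq_zero_of_lt (by omega)]; simp
      · rfl
  rw [e, Finset.sum_Ico_eq_sum_range]
  have : ∀ i ∈ Finset.range (k + (k+1) - k), ((k+i : ℕ):ℚ)^j * ((-16:ℚ)^(k+i-k) * (k.choose (k+i-k) : ℚ)) / 32^(k+i)
     = (1/32)^k * ((k.choose i : ℚ) * (-1/2)^i * ((k:ℚ)+i)^j) := by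
    intro i _
    rw [Nat.add_sub_cancel_left, pow_add]
    have h16 : (-1/2:ℚ)^i = (-16)^i / 32^i := by rw [← div_pow]; norm_num
    rw [h16]
    push_cast
    rw [div_pow, one_pow]
    field_simp
  rw [Finset.sum_congr rfl this, ← Finset.mul_sum]
  have e3 : k + (k+1) - k = k+1 := by omega
  rw [e3, hm]
  have h64 : (64:ℚ)^k = 32^k * 2^k := by rw [← mul_pow]; norm_num
  rw [h64, div_pow, div_pow]
  field_simp
  simp

section
variable {p : ℕ} [hp : Fact p.Prime]

lemma cb_p (k : ℕ) (h1 : p < 2 * k + 1) (h2 : k < p) : ∃ u : ℕ, k.centralBinom = p * u := by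
  have : p ∣ k.centralBinom := by
    have hp' := hp.out
    rcases Nat.lt_or_ge p (2*k) with h | h
    · rw [Nat.centralBinom_eq_two_mul_choose]
      have hd : p ∣ (2*k).factorial := (hp'.dvd_factorial).2 h.le
      have hn : ¬ p ∣ k.factorial := fun hh => by have := (hp'.dvd_factorial).1 hh; omega
      have e := Nat.choose_mul_factorial_mul_factorial (n := 2*k) (k := k) (by omega)
      have e2 : 2*k - k = k := by omega
      rw [e2] at e
      rw [← e] at hd
      rcases (Nat.Prime.dvd_mul hp').1 hd with hd | hd
      · rcases (Nat.Prime.dvd_mul hp').1 hd with hd | hd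
        · exact hd
        · exact absurd hd hn
      · exact absurd hd hn
    · have : p = 2 * k := by omega
      have hk : k = 1 := by
        rcases (Nat.dvd_prime hp').1 (Dvd.intro_left 2 this.symm) with h | h <;> omega
      subst hk
      rw [this]; decide
  exact this

lemma two_inv_mem (hp2 : p ≠ 2) : ((2:ℚ))⁻¹ ∈ Ip p := by
  have := inv_mem_lt (p := p) (k := 2) (by norm_num) (by
    have := hp.out.two_le; omega)
  simpa using this

lemma two_pow_inv_mem (hp2 : p ≠ 2) (k : ℕ) : ((2:ℚ)^k)⁻¹ ∈ Ip p := by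
  rw [← inv_pow]; exact pow_mem (two_inv_mem hp2) k

lemma reduction (hp2 : p ≠ 2) (j : ℕ) (c : ℚ)
    (hm : ∀ k : ℕ, ∑ i ∈ Finset.range (k+1), (k.choose i : ℚ) * (-1/2)^i * ((k:ℚ)+i)^j = c * k * (1/2)^k) :
    Cg p 3 (∑ n ∈ Finset.range p, (n:ℚ)^j * (∑ k ∈ Finset.range (n+1), ((2*k).choose k : ℚ)^2 * ((2*n-2*k).choose (n-k) : ℚ)^2) / 32^n)
      (c * ∑ k ∈ Finset.range ((p-1)/2+1), (k:ℚ) * ck k) := by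
  have e1 : ∑ n ∈ Finset.range p, (n:ℚ)^j * (∑ k ∈ Finset.range (n+1), ((2*k).choose k : ℚ)^2 * ((2*n-2*k).choose (n-k) : ℚ)^2) / 32^n
     = ∑ k ∈ Finset.range p, (k.centralBinom:ℚ)^3 * ∑ n ∈ Finset.range p, (if k ≤ n then (n:ℚ)^j * ((-16:ℚ)^(n-k) * (k.choose (n-k) : ℚ)) / 32^n else 0) := by
    simp_rw [Finset.mul_sum]
    rw [Finset.sum_comm]
    apply Finset.sum_congr rfl
    intro n hn
    rw [← Finset.mul_sum, V_identity n, Finset.mul_sum, Finset.sum_div]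
    have hs : Finset.range (n+1) ⊆ Finset.range p := by
      intro x hx; simp at hx hn ⊢; omega
    rw [← Finset.sum_subset hs]
    · apply Finset.sum_congr rfl
      intro k hk
      simp at hk
      rw [if_pos (by omega)]; ring
    · intro k _ hk
      simp at hk
      rw [if_neg (by omega)]; ring
  rw [e1, Finset.mul_sum]
  have hpp := hp.out.two_le
  have hodd : p % 2 = 1 := (Nat.Prime.eq_two_or_odd hp.out).resolve_left hp2
  have e2 : p = ((p-1)/2 + 1) + (p-1)/2 := by omega
  have hs : Finset.range p = Finset.range (((p-1)/2 + 1) + (p-1)/2) := by rw [← e2]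
  have key : Cg p 3 (∑ k ∈ Finset.range (((p-1)/2 + 1) + (p-1)/2), (k.centralBinom:ℚ)^3 * ∑ n ∈ Finset.range p, (if k ≤ n then (n:ℚ)^j * ((-16:ℚ)^(n-k) * (k.choose (n-k) : ℚ)) / 32^n else 0))
      (∑ k ∈ Finset.range ((p-1)/2+1), c * ((k:ℚ) * ck k) + ∑ k ∈ Finset.range ((p-1)/2), (0:ℚ)) := by
    rw [Finset.sum_range_add]
    apply Cg.add
    · apply Cg.of_eq
      apply Finset.sum_congr rfl
      intro k hk
      simp at hk
      rw [inner_sum p k j (by omega) (c * k) (hm k)]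
      unfold ck; ring
    · apply Cg.sum
      intro i hi
      simp at hi
      obtain ⟨u, hu⟩ := cb_p (p := p) ((p-1)/2+1+i) (by omega) (by omega)
      rw [hu, Cg.zero_iff]
      refine ⟨(u:ℚ)^3 * _, mul_mem (pow_mem (nat_mem u) 3) ?_, by push_cast; rw [mul_pow, mul_assoc]⟩
      apply sum_mem
      intro n _
      split_ifs
      · rw [div_eq_mul_inv]
        apply mul_mem
        · apply mul_mem (pow_mem (nat_mem n) j)
          apply mul_mem _ (nat_mem _)
          apply pow_mem
          have := int_mem (p := p) (-16)
          simpa using this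
        · have := two_pow_inv_mem (p := p) hp2 (5*n)
          rw [pow_mul] at this; norm_num at this; exact this
      · exact zero_mem _
  simp only [Finset.sum_const_zero, add_zero] at key
  rw [← hs] at key
  exact key
end
end S18

namespace S18

/-- Whipple term -/
noncomputable def tW (ρ : ℚ) (n k : ℕ) : ℚ :=
  ∏ j ∈ Finset.range k, ((j:ℚ)-n)*(n+1+j)*(2*j+1)/(2*(j+1)*((j+1)^2-ρ))
/-- auxiliary product -/
noncomputable def bW (ρ : ℚ) (n k : ℕ) : ℚ :=
  ∏ j ∈ Finset.range k, ((j:ℚ)-n-2)*(n+1+j)*(2*j+1)/(2*(j+1)*((j+1)^2-ρ))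

lemma tW_bW (ρ : ℚ) (n k : ℕ) :
    ((n:ℚ)+1)*(n+2)*tW ρ n k = ((n:ℚ)+2-k)*(n+1-k)*bW ρ n k := by
  induction k with
  | zero => simp [tW, bW]; ring
  | succ k ih =>
    unfold tW bW at *
    rw [Finset.prod_range_succ, Finset.prod_range_succ, ← mul_assoc, ih]
    push_cast
    ring

lemma tW_bW' (ρ : ℚ) (n k : ℕ) :
    ((n:ℚ)+1)*(n+2)*tW ρ (n+2) k = ((n:ℚ)+1+k)*(n+2+k)*bW ρ n k := by
  induction k with
  | zero => simp [tW, bW]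
  | succ k ih =>
    unfold tW bW at *
    rw [Finset.prod_range_succ, Finset.prod_range_succ, ← mul_assoc, ih]
    push_cast
    ring

lemma tW_zero (ρ : ℚ) (n k : ℕ) (h : n < k) : tW ρ n k = 0 := by
  unfold tW
  apply Finset.prod_eq_zero (i := n) (by simpa using h)
  simp

lemma bW_zero (ρ : ℚ) (n : ℕ) : bW ρ n (n+3) = 0 := by
  unfold bW
  apply Finset.prod_eq_zero (i := n+2) (by simp)
  simp

/-- Whipple sum -/
noncomputable def TW (ρ : ℚ) (n : ℕ) : ℚ := ∑ k ∈ Finset.range (n+1), tW ρ n k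

lemma TW_rec (ρ : ℚ) (hρ : ∀ j : ℕ, ((j:ℚ)+1)^2 - ρ ≠ 0) (n : ℕ) :
    (((n:ℚ)+2)^2-ρ) * TW ρ (n+2) = (((n:ℚ)+1)^2-ρ) * TW ρ n := by
  have hn : ((n:ℚ)+1)*(n+2) ≠ 0 := by positivity
  have e : TW ρ n = ∑ k ∈ Finset.range (n+3), tW ρ n k := by
    rw [Finset.sum_range_succ, Finset.sum_range_succ, tW_zero ρ n (n+1) (by omega),
      tW_zero ρ n (n+2) (by omega)]
    simp [TW]
  have tel : ∑ k ∈ Finset.range (n+3),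
      ((((n:ℚ)+2)^2-ρ) * (((n:ℚ)+1)*(n+2)*tW ρ (n+2) k)
        - (((n:ℚ)+1)^2-ρ) * (((n:ℚ)+1)*(n+2)*tW ρ n k)) = 0 := by
    have : ∀ k ∈ Finset.range (n+3), ((((n:ℚ)+2)^2-ρ) * (((n:ℚ)+1)*(n+2)*tW ρ (n+2) k)
        - (((n:ℚ)+1)^2-ρ) * (((n:ℚ)+1)*(n+2)*tW ρ n k))
        = (fun k : ℕ => -2*(2*(n:ℚ)+3)*k*(k^2-ρ)*bW ρ n k) (k+1)
          - (fun k : ℕ => -2*(2*(n:ℚ)+3)*k*(k^2-ρ)*bW ρ n k) k := by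
      intro k _
      rw [tW_bW, tW_bW']
      have e1 : bW ρ n (k+1) = bW ρ n k * (((k:ℚ)-n-2)*(n+1+k)*(2*k+1)/(2*(k+1)*((k+1)^2-ρ))) := by
        unfold bW; rw [Finset.prod_range_succ]
      simp only [e1]
      have := hρ k
      have hk : (k:ℚ)+1 ≠ 0 := by positivity
      push_cast
      field_simp
      ring
    rw [Finset.sum_congr rfl this]
    refine (Finset.sum_range_sub (fun k : ℕ => -2*(2*(n:ℚ)+3)*k*(k^2-ρ)*bW ρ n k) (n+3)).trans ?_
    simp [bW_zero]
  rw [Finset.sum_sub_distrib, ← Finset.mul_sum, ← Finset.mul_sum, ← Finset.mul_sum, ← Finset.mul_sum, ← e] at tel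
  have : ((n:ℚ)+1)*(n+2) * ((((n:ℚ)+2)^2-ρ) * TW ρ (n+2) - (((n:ℚ)+1)^2-ρ) * TW ρ n) = 0 := by
    unfold TW at *
    linear_combination tel
  linear_combination (mul_eq_zero.1 this).resolve_left hn

lemma TW_even (ρ : ℚ) (hρ : ∀ j : ℕ, ((j:ℚ)+1)^2 - ρ ≠ 0) (m : ℕ) :
    TW ρ (2*m) = ∏ i ∈ Finset.range m, (((2*(i:ℚ)+1)^2-ρ)/((2*(i:ℚ)+2)^2-ρ)) := by
  induction m with
  | zero => simp [TW, tW]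
  | succ m ih =>
    rw [Finset.prod_range_succ, ← ih]
    have h := TW_rec ρ hρ (2*m)
    have h2 := hρ (2*m+1)
    push_cast at h h2
    have h3 : (2*(m:ℚ)+2)^2-ρ ≠ 0 := by ring_nf at h2 ⊢; exact h2
    rw [← mul_div_assoc, eq_div_iff h3]
    rw [show 2*(m+1) = 2*m+2 by ring]
    linear_combination h

lemma TW_odd (m : ℕ) : TW 0 (2*m+1) = 0 := by
  induction m with
  | zero => simp [TW, tW, Finset.sum_range_succ]
  | succ m ih =>
    have h := TW_rec 0 (by intro j; simp; positivity) (2*m+1)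
    rw [ih, mul_zero] at h
    rcases mul_eq_zero.1 h with h | h
    · exfalso
      have : (((2*m+1:ℕ):ℚ)+2)^2 - 0 ≠ 0 := by simp; positivity
      exact this h
    · exact h

/-- Dougall term without the factor `4k+1` -/
noncomputable def uD (n k : ℕ) : ℚ :=
  ∏ j ∈ Finset.range k, 2*(2*(j:ℚ)+1)*(j-n)*(n+1+j)/((j+1)*(2*n+3+2*j)*(2*j+1-2*n))
/-- auxiliary -/
noncomputable def bD (n k : ℕ) : ℚ :=
  ∏ j ∈ Finset.range k, 2*(2*(j:ℚ)+1)*(j-n-1)*(n+1+j)/((j+1)*(2*n+5+2*j)*(2*j+1-2*n))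

lemma odd_ne (a b : ℕ) : 2*(a:ℚ)+1-2*b ≠ 0 := by
  intro h
  have : 2*(a:ℤ)+1-2*b = 0 := by exact_mod_cast h
  omega

lemma uD_bD (n k : ℕ) :
    ((n:ℚ)+1)*(2*n+3)*uD n k = ((n:ℚ)+1-k)*(2*n+3+2*k)*bD n k := by
  induction k with
  | zero => simp [uD, bD]
  | succ k ih =>
    unfold uD bD at *
    rw [Finset.prod_range_succ, Finset.prod_range_succ, ← mul_assoc, ih]
    have := odd_ne k n
    have h1 : (2*(n:ℚ)+3+2*k) ≠ 0 := by positivity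
    have h2 : (2*(n:ℚ)+5+2*k) ≠ 0 := by positivity
    have h3 : (k:ℚ)+1 ≠ 0 := by positivity
    push_cast
    field_simp
    ring

lemma uD_bD' (n k : ℕ) :
    ((n:ℚ)+1)*(2*n+1)*uD (n+1) k = ((n:ℚ)+1+k)*(2*n+1-2*k)*bD n k := by
  induction k with
  | zero => simp [uD, bD]
  | succ k ih =>
    unfold uD bD at *
    rw [Finset.prod_range_succ, Finset.prod_range_succ, ← mul_assoc, ih]
    have := odd_ne k n
    have h4 : 2*(k:ℚ)-1-2*n ≠ 0 := by
      have := odd_ne k (n+1); push_cast at this; intro h; apply this; linear_combination h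
    have h5 : 2*(k:ℚ)+1-2*(n+1) ≠ 0 := by
      intro h; apply h4; linear_combination h
    have h1 : (2*((n:ℚ)+1)+3+2*k) ≠ 0 := by positivity
    have h2 : (2*(n:ℚ)+5+2*k) ≠ 0 := by positivity
    have h3 : (k:ℚ)+1 ≠ 0 := by positivity
    push_cast
    generalize (∏ j ∈ Finset.range k, 2*(2*(j:ℚ)+1)*(j-n-1)*(n+1+j)/((j+1)*(2*n+5+2*j)*(2*j+1-2*n))) = P
    have key : ((n:ℚ)+1+k)*(2*n+1-2*k) * (2*(2*(k:ℚ)+1)*(k-(n+1))*(n+1+1+k)/((k+1)*(2*(n+1)+3+2*k)*(2*k+1-2*(n+1))))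
      = ((n:ℚ)+1+(k+1))*(2*n+1-2*(k+1)) * (2*(2*(k:ℚ)+1)*(k-n-1)*(n+1+k)/((k+1)*(2*n+5+2*k)*(2*k+1-2*n))) := by
      rw [mul_div_assoc', mul_div_assoc', div_eq_div_iff (mul_ne_zero (mul_ne_zero h3 h1) h5) (mul_ne_zero (mul_ne_zero h3 h2) this)]
      ring
    linear_combination P * key

lemma uD_zero (n k : ℕ) (h : n < k) : uD n k = 0 := by
  unfold uD
  apply Finset.prod_eq_zero (i := n) (by simpa using h)
  simp

lemma bD_zero (n : ℕ) : bD n (n+2) = 0 := by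
  unfold bD
  apply Finset.prod_eq_zero (i := n+1) (by simp)
  simp

/-- Dougall sum -/
noncomputable def SD (n : ℕ) : ℚ := ∑ k ∈ Finset.range (n+1), (4*(k:ℚ)+1) * uD n k

lemma SD_rec (n : ℕ) :
    (2*(n:ℚ)+1)*(4*n+3) * SD (n+1) = (2*(n:ℚ)+3)*(4*n+5) * SD n := by
  have hn : ((n:ℚ)+1) ≠ 0 := by positivity
  have e : SD n = ∑ k ∈ Finset.range (n+2), (4*(k:ℚ)+1) * uD n k := by
    rw [Finset.sum_range_succ, uD_zero n (n+1) (by omega)]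
    simp [SD]
  have tel : ∑ k ∈ Finset.range (n+2),
      ((4*(n:ℚ)+3) * ((4*(k:ℚ)+1)*(((n:ℚ)+1)*(2*n+1)*uD (n+1) k))
        - (4*(n:ℚ)+5) * ((4*(k:ℚ)+1)*(((n:ℚ)+1)*(2*n+3)*uD n k))) = 0 := by
    have : ∀ k ∈ Finset.range (n+2), ((4*(n:ℚ)+3) * ((4*(k:ℚ)+1)*(((n:ℚ)+1)*(2*n+1)*uD (n+1) k))
        - (4*(n:ℚ)+5) * ((4*(k:ℚ)+1)*(((n:ℚ)+1)*(2*n+3)*uD n k)))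
        = (fun k : ℕ => (k:ℚ)*(2*n+3+2*k)*(2*k-1-2*n)*(8*k-2)*bD n k) (k+1)
          - (fun k : ℕ => (k:ℚ)*(2*n+3+2*k)*(2*k-1-2*n)*(8*k-2)*bD n k) k := by
      intro k _
      rw [uD_bD, uD_bD']
      have := odd_ne k n
      have h2 : (2*(n:ℚ)+5+2*k) ≠ 0 := by positivity
      have hk : (k:ℚ)+1 ≠ 0 := by positivity
      have e1 : bD n (k+1) * ((k+1)*(2*n+5+2*k)*(2*k+1-2*n)) = bD n k * (2*(2*(k:ℚ)+1)*(k-n-1)*(n+1+k)) := by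
        unfold bD; rw [Finset.prod_range_succ, mul_assoc, div_mul_cancel₀ _ (mul_ne_zero (mul_ne_zero hk h2) this)]
      push_cast
      linear_combination -(8*(k:ℚ)+6) * e1
    rw [Finset.sum_congr rfl this]
    refine (Finset.sum_range_sub (fun k : ℕ => (k:ℚ)*(2*n+3+2*k)*(2*k-1-2*n)*(8*k-2)*bD n k) (n+2)).trans ?_
    simp [bD_zero]
  have : ((n:ℚ)+1) * ((2*(n:ℚ)+1)*(4*n+3) * SD (n+1) - (2*(n:ℚ)+3)*(4*n+5) * SD n) = 0 := by
    rw [e, ← tel, SD, Finset.mul_sum, Finset.mul_sum, ← Finset.sum_sub_distrib, Finset.mul_sum]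
    apply Finset.sum_congr rfl
    intro k _
    ring
  linear_combination (mul_eq_zero.1 this).resolve_left hn

lemma SD_eval (n : ℕ) :
    SD n = (2*(n:ℚ)+1) * ∏ j ∈ Finset.range n, ((4*(j:ℚ)+5)/(4*(j:ℚ)+3)) := by
  induction n with
  | zero => simp [SD, uD]
  | succ n ih =>
    have h := SD_rec n
    have h1 : (2*(n:ℚ)+1)*(4*n+3) ≠ 0 := by positivity
    rw [Finset.prod_range_succ]
    apply mul_left_cancel₀ h1
    rw [h, ih]
    have h3 : (4*(n:ℚ)+3) ≠ 0 := by positivity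
    push_cast
    field_simp
    ring

end S18

namespace S18

/-- `Σ_{j<k} 1/(2j+1)^2` -/
def Ak (k : ℕ) : ℚ := ∑ j ∈ Finset.range k, 1/(2*(j:ℚ)+1)^2
/-- `Σ_{j<k} 1/(2j+2)^2` -/
def Bk (k : ℕ) : ℚ := ∑ j ∈ Finset.range k, 1/(2*(j:ℚ)+2)^2

lemma ck_zero : ck 0 = 1 := by simp [ck]

lemma ck_succ (k : ℕ) : ck (k+1) = ck k * ((2*(k:ℚ)+1)/(2*k+2))^3 := by
  have h := cb_succ k
  have h2 : ((k+1).centralBinom : ℚ) = 4 * ((2*(k:ℚ)+1)/(2*k+2)) * k.centralBinom := by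
    have : (k:ℚ)+1 ≠ 0 := by positivity
    have h3 : 2*(k:ℚ)+2 ≠ 0 := by positivity
    rw [mul_div_assoc', div_mul_eq_mul_div, eq_div_iff h3]
    linear_combination 2 * h
  unfold ck
  rw [h2, pow_succ]
  ring

section
variable {p : ℕ} [hp : Fact p.Prime]

lemma ck_mem (hp2 : p ≠ 2) (k : ℕ) : ck k ∈ Ip p := by
  unfold ck
  rw [div_eq_mul_inv]
  apply mul_mem (pow_mem (nat_mem _) 3)
  have := two_pow_inv_mem (p := p) hp2 (6*k)
  rw [pow_mul] at this; norm_num at this; exact this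

lemma prod_p2 (f : ℕ → ℚ) (k : ℕ) (hf : ∀ j < k, f j ∈ Ip p) :
    Cg p 3 (∏ j ∈ Finset.range k, (1 + (p:ℚ)^2 * f j)) (1 + (p:ℚ)^2 * ∑ j ∈ Finset.range k, f j) := by
  induction k with
  | zero => simp; exact Cg.refl _ _
  | succ k ih =>
    rw [Finset.prod_range_succ, Finset.sum_range_succ]
    have h1 := ih (fun j hj => hf j (by omega))
    have hk := hf k (by omega)
    have h2 := h1.mul_right (c := 1 + (p:ℚ)^2 * f k)
      (add_mem (one_mem _) (mul_mem (pow_mem p_mem 2) hk))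
    refine h2.trans ⟨p * (∑ j ∈ Finset.range k, f j) * f k, ?_, by ring⟩
    refine mul_mem (mul_mem p_mem (sum_mem ?_)) hk
    intro j hj
    exact hf j (by simp at hj; omega)

lemma inv_mem_mul {x : ℤ} (hx : ¬ (p:ℤ) ∣ x) : (x:ℚ)⁻¹ ∈ Ip p := inv_mem hx

lemma a_mem {n : ℕ} (hn : p = 2*n+1) {j : ℕ} (hj : j < n) : 1/(2*(j:ℚ)+1)^2 ∈ Ip p := by
  have := inv_mem_lt (p := p) (k := 2*j+1) (by omega) (by omega)
  push_cast at this
  rw [one_div, ← inv_pow]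
  exact pow_mem this 2
lemma b_mem {n : ℕ} (hn : p = 2*n+1) {j : ℕ} (hj : j < n) : 1/(2*(j:ℚ)+2)^2 ∈ Ip p := by
  have := inv_mem_lt (p := p) (k := 2*j+2) (by omega) (by omega)
  push_cast at this
  rw [one_div, ← inv_pow]
  exact pow_mem this 2

lemma Ak_mem {n : ℕ} (hn : p = 2*n+1) {k : ℕ} (hk : k ≤ n) : Ak k ∈ Ip p :=
  sum_mem fun j hj => a_mem hn (by simp at hj; omega)
lemma Bk_mem {n : ℕ} (hn : p = 2*n+1) {k : ℕ} (hk : k ≤ n) : Bk k ∈ Ip p :=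
  sum_mem fun j hj => b_mem hn (by simp at hj; omega)

/-- core: a product of `r^3 (1-p²a)/(1+σp²b)` -/
lemma prod_core {n : ℕ} (hn : p = 2*n+1) (σ : ℤ) (f : ℕ → ℚ) (k : ℕ) (hk : k ≤ n)
    (hf : ∀ j < k, f j * ((2*(j:ℚ)+2)*((2*j+2)^2+σ*(p:ℚ)^2)) = (2*j+1)*((2*j+1)^2-(p:ℚ)^2)) :
    Cg p 3 (∏ j ∈ Finset.range k, f j) (ck k * (1 - (p:ℚ)^2 * (Ak k + σ * Bk k))) := by
  have hp2 : p ≠ 2 := by omega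
  have hden : ∀ j < k, ((((2*(j:ℤ)+2)^2+σ*(p:ℤ)^2 : ℤ)):ℚ)⁻¹ ∈ Ip p := by
    intro j hj
    apply inv_mem
    intro hd
    have h1 : (p:ℤ) ∣ (2*(j:ℤ)+2)^2 := (Int.dvd_add_left (Dvd.intro_left (σ * p) (by ring))).1 hd
    have h2 := Int.Prime.dvd_pow' hp.out h1
    have h3 : p ∣ 2*j+2 := by exact_mod_cast h2
    have := Nat.le_of_dvd (by omega) h3
    omega
  have hden0 : ∀ j < k, ((2*(j:ℚ)+2)^2+σ*(p:ℚ)^2) ≠ 0 := by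
    intro j hj h0
    have h3 : (p:ℤ) ∣ 2*(j:ℤ)+2 := by
      refine Int.Prime.dvd_pow' (k := 2) hp.out ?_
      refine ⟨-σ*p, ?_⟩
      have : (2*(j:ℤ)+2)^2+σ*(p:ℤ)^2 = 0 := by exact_mod_cast h0
      linear_combination this
    have h3 : p ∣ 2*j+2 := by exact_mod_cast h3
    have := Nat.le_of_dvd (by omega) h3
    omega
  set e : ℕ → ℚ := fun j => -(1/(2*(j:ℚ)+1)^2 + σ * (1/(2*(j:ℚ)+2)^2)) * ((2*(j:ℚ)+2)^2 * ((((2*(j:ℤ)+2)^2+σ*(p:ℤ)^2 : ℤ)):ℚ)⁻¹) with he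
  have e0 : ∀ j < k, e j ∈ Ip p := by
    intro j hj
    refine mul_mem (neg_mem (add_mem (a_mem hn (by omega)) (mul_mem (int_mem _) (b_mem hn (by omega))))) ?_
    refine mul_mem ?_ (hden j hj)
    have := nat_mem (p := p) ((2*j+2)^2)
    push_cast at this; exact this
  have h1 : ∏ j ∈ Finset.range k, f j = ck k * ∏ j ∈ Finset.range k, (1 + (p:ℚ)^2 * e j) := by
    have : ∀ K ≤ k, ∏ j ∈ Finset.range K, f j = ck K * ∏ j ∈ Finset.range K, (1 + (p:ℚ)^2 * e j) := by
      intro K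
      induction K with
      | zero => simp [ck_zero]
      | succ K ih =>
        intro hK
        rw [Finset.prod_range_succ, Finset.prod_range_succ, ih (by omega), ck_succ]
        have h0 := hden0 K (by omega)
        have hf' := hf K (by omega)
        have hk2 : 2*(K:ℚ)+2 ≠ 0 := by positivity
        have hk1 : 2*(K:ℚ)+1 ≠ 0 := by positivity
        have : f K = ((2*(K:ℚ)+1)/(2*K+2))^3 * (1 + (p:ℚ)^2 * e K) := by
          rw [he]
          push_cast
          apply mul_right_cancel₀ (mul_ne_zero hk2 h0)
          rw [hf']
          generalize hD : ((2*(K:ℚ)+2)^2+σ*(p:ℚ)^2) = D at *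
          field_simp
          rw [← hD]
          ring
        rw [this]; ring
    exact this k le_rfl
  rw [h1]
  apply Cg.mul_left (ck_mem hp2 k)
  refine (prod_p2 e k e0).trans ?_
  have e1 : Cg p 1 (∑ j ∈ Finset.range k, e j) (- (Ak k + σ * Bk k)) := by
    have : - (Ak k + σ * Bk k) = ∑ j ∈ Finset.range k, -(1/(2*(j:ℚ)+1)^2 + σ * (1/(2*(j:ℚ)+2)^2)) := by
      unfold Ak Bk
      rw [Finset.sum_neg_distrib, Finset.sum_add_distrib, Finset.mul_sum]
    rw [this]
    apply Cg.sum
    intro j hj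
    simp at hj
    have hx : -(1/(2*(j:ℚ)+1)^2 + σ * (1/(2*(j:ℚ)+2)^2)) ∈ Ip p :=
      (neg_mem (add_mem (a_mem hn (by omega)) (mul_mem (int_mem _) (b_mem hn (by omega)))))
    have h0 := hden0 j hj
    simp only [he]
    refine ⟨-(1/(2*(j:ℚ)+1)^2 + σ * (1/(2*(j:ℚ)+2)^2)) * (-σ*p * ((((2*(j:ℤ)+2)^2+σ*(p:ℤ)^2 : ℤ)):ℚ)⁻¹),
      mul_mem hx (mul_mem (mul_mem (neg_mem (int_mem σ)) p_mem) (hden j hj)), ?_⟩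
    generalize -(1/(2*(j:ℚ)+1)^2 + σ * (1/(2*(j:ℚ)+2)^2)) = E
    push_cast
    have h3 := mul_inv_cancel₀ h0
    linear_combination E * h3
  have := e1.mul_p 2
  refine (Cg.add (Cg.refl _ 1) this).trans (Cg.of_eq (by ring))

lemma tW_core {n : ℕ} (hn : p = 2*n+1) (k : ℕ) (hk : k ≤ n) :
    Cg p 3 (tW (-(p:ℚ)^2/4) n k) (ck k * (1 - (p:ℚ)^2 * (Ak k + Bk k))) := by
  have h := prod_core hn 1 (fun j => ((j:ℚ)-n)*(n+1+j)*(2*j+1)/(2*(j+1)*((j+1)^2-(-(p:ℚ)^2/4)))) k hk ?_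
  · simpa [tW] using h
  · intro j _
    have h0 : ((j:ℚ)+1)^2-(-(p:ℚ)^2/4) ≠ 0 := by
      have : (0:ℚ) < ((j:ℚ)+1)^2-(-(p:ℚ)^2/4) := by
        have : (0:ℚ) < ((j:ℚ)+1)^2 := by positivity
        have : (0:ℚ) ≤ (p:ℚ)^2/4 := by positivity
        linarith
      exact this.ne'
    have hD : ((2*(j:ℚ)+2)*((2*j+2)^2+(1:ℤ)*(p:ℚ)^2)) = 4 * (2*(j+1)*((j+1)^2-(-(p:ℚ)^2/4))) := by push_cast; ring
    have h1 : (2*((j:ℚ)+1)*((j+1)^2-(-(p:ℚ)^2/4))) ≠ 0 := mul_ne_zero (by positivity) h0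
    rw [hD, mul_comm (4:ℚ), ← mul_assoc, div_mul_cancel₀ _ h1, hn]
    push_cast; ring

lemma uD_core {n : ℕ} (hn : p = 2*n+1) (k : ℕ) (hk : k ≤ n) :
    Cg p 3 (uD n k) (ck k * (1 - (p:ℚ)^2 * (Ak k - Bk k))) := by
  have h := prod_core hn (-1) (fun j => 2*(2*(j:ℚ)+1)*(j-n)*(n+1+j)/((j+1)*(2*n+3+2*j)*(2*j+1-2*n))) k hk ?_
  · simpa [uD, sub_eq_add_neg] using h
  · intro j _
    have h0 := odd_ne j n
    have h1 : ((j:ℚ)+1)*(2*n+3+2*j)*(2*j+1-2*n) ≠ 0 := mul_ne_zero (by positivity) h0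
    have hD : ((2*(j:ℚ)+2)*((2*j+2)^2+(-1:ℤ)*(p:ℚ)^2)) = 2 * (((j:ℚ)+1)*(2*n+3+2*j)*(2*j+1-2*n)) := by
      rw [hn]; push_cast; ring
    rw [hD, mul_comm (2:ℚ) (_ * _), ← mul_assoc, div_mul_cancel₀ _ h1, hn]
    push_cast; ring

/-- `Σ ck` -/
noncomputable def S0 (n : ℕ) : ℚ := ∑ k ∈ Finset.range (n+1), ck k
/-- `Σ (4k+1) ck` -/
noncomputable def X0 (n : ℕ) : ℚ := ∑ k ∈ Finset.range (n+1), (4*(k:ℚ)+1) * ck k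

lemma S0_core {n : ℕ} (hn : p = 2*n+1) :
    Cg p 3 (TW (-(p:ℚ)^2/4) n) (S0 n - (p:ℚ)^2 * ∑ k ∈ Finset.range (n+1), ck k * (Ak k + Bk k)) := by
  have : S0 n - (p:ℚ)^2 * ∑ k ∈ Finset.range (n+1), ck k * (Ak k + Bk k)
    = ∑ k ∈ Finset.range (n+1), (ck k * (1 - (p:ℚ)^2 * (Ak k + Bk k))) := by
    unfold S0
    rw [Finset.mul_sum, ← Finset.sum_sub_distrib]
    apply Finset.sum_congr rfl; intros; ring
  rw [this]
  exact Cg.sum _ _ _ fun k hk => tW_core hn k (by simp at hk; omega)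

lemma X0_core {n : ℕ} (hn : p = 2*n+1) :
    Cg p 3 (SD n) (X0 n - (p:ℚ)^2 * ∑ k ∈ Finset.range (n+1), (4*(k:ℚ)+1) * ck k * (Ak k - Bk k)) := by
  have : X0 n - (p:ℚ)^2 * ∑ k ∈ Finset.range (n+1), (4*(k:ℚ)+1) * ck k * (Ak k - Bk k)
    = ∑ k ∈ Finset.range (n+1), (4*(k:ℚ)+1) * (ck k * (1 - (p:ℚ)^2 * (Ak k - Bk k))) := by
    unfold X0
    rw [Finset.mul_sum, ← Finset.sum_sub_distrib]
    apply Finset.sum_congr rfl; intros; ring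
  rw [this]
  refine Cg.sum _ _ _ fun k hk => (uD_core hn k (by simp at hk; omega)).mul_left ?_
  have := nat_mem (p := p) (4*k+1)
  push_cast at this; exact this

lemma X0_mod2 {n : ℕ} (hn : p = 2*n+1) : Cg p 2 (X0 n) (SD n) := by
  have h := (X0_core hn).mono (s := 2) (by norm_num)
  refine (h.trans ⟨- ∑ k ∈ Finset.range (n+1), (4*(k:ℚ)+1) * ck k * (Ak k - Bk k), ?_, by ring⟩).symm
  refine neg_mem (sum_mem fun k hk => ?_)
  simp at hk
  refine mul_mem (mul_mem ?_ (ck_mem (by omega) k)) (sub_mem (Ak_mem hn (by omega)) (Bk_mem hn (by omega)))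
  have := nat_mem (p := p) (4*k+1)
  push_cast at this; exact this

end
end S18

namespace S18
section
variable {p : ℕ} [hp : Fact p.Prime]

lemma tW0_core {n : ℕ} (hn : p = 2*n+1) (k : ℕ) (hk : k ≤ n) :
    Cg p 2 (ck k) (tW 0 n k) := by
  have h := prod_core hn 0 (fun j => ((j:ℚ)-n)*(n+1+j)*(2*j+1)/(2*(j+1)*((j+1)^2-0))) k hk ?_
  · have h2 : Cg p 3 (tW 0 n k) (ck k * (1 - (p:ℚ)^2 * Ak k)) := by simpa [tW] using h
    refine ((h2.mono (s := 2) (by norm_num)).trans ⟨-(ck k * Ak k), ?_, by ring⟩).symm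
    exact neg_mem (mul_mem (ck_mem (by omega) k) (Ak_mem hn hk))
  · intro j _
    have h1 : (2*((j:ℚ)+1)*((j+1)^2-0)) ≠ 0 := by simp; positivity
    have hD : ((2*(j:ℚ)+2)*((2*j+2)^2+(0:ℤ)*(p:ℚ)^2)) = 4 * (2*(j+1)*((j+1)^2-0)) := by push_cast; ring
    rw [hD, mul_comm (4:ℚ), ← mul_assoc, div_mul_cancel₀ _ h1, hn]
    push_cast; ring

lemma S0_mod2 {l : ℕ} (hn : p = 2*(2*l+1)+1) : Cg p 2 (S0 (2*l+1)) 0 := by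
  rw [← TW_odd l]
  exact Cg.sum _ _ _ fun k hk => tW0_core hn k (by simp at hk; omega)

/-- `Π (2j+1)/(2j+2)` -/
noncomputable def dk (k : ℕ) : ℚ := ∏ j ∈ Finset.range k, ((2*(j:ℚ)+1)/(2*j+2))

lemma ck_dk (k : ℕ) : ck k = dk k ^ 3 := by
  induction k with
  | zero => simp [ck_zero, dk]
  | succ k ih => rw [ck_succ, ih, dk, dk, Finset.prod_range_succ, mul_pow]

lemma dk_choose {n : ℕ} (hn : p = 2*n+1) (k : ℕ) (hk : k ≤ n) :
    Cg p 1 (dk k) ((-1)^k * (n.choose k : ℚ)) := by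
  induction k with
  | zero => simp [dk]; exact Cg.refl _ _
  | succ k ih =>
    have ih := ih (by omega)
    rw [dk, Finset.prod_range_succ, ← dk]
    have hinv := inv_mem_lt (p := p) (k := 2*k+2) (by omega) (by omega)
    push_cast at hinv
    have hr : (2*(k:ℚ)+1)/(2*k+2) ∈ Ip p := by
      rw [div_eq_mul_inv]
      refine mul_mem ?_ hinv
      have := nat_mem (p := p) (2*k+1); push_cast at this; exact this
    refine (ih.mul_right hr).trans ?_
    have hc : (n.choose (k+1) : ℚ) * (k+1) = n.choose k * ((n:ℚ) - k) := by
      have := Nat.choose_succ_right_eq n k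
      have h2 : ((n - k : ℕ):ℚ) = (n:ℚ) - k := by push_cast [show k ≤ n by omega]; ring
      rw [← h2]; exact_mod_cast this
    refine ⟨(-1)^k * (n.choose k : ℚ) * (2*(k:ℚ)+2)⁻¹, mul_mem (mul_mem (pow_mem (neg_mem (one_mem _)) _) (nat_mem _)) hinv, ?_⟩
    have h0 : (k:ℚ)+1 ≠ 0 := by positivity
    have hc2 : (n.choose (k+1) : ℚ) = n.choose k * ((n:ℚ) - k) / (k+1) := by
      rw [eq_div_iff h0, hc]
    rw [hc2, hn, pow_succ]
    push_cast
    field_simp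
    ring

lemma ck_symm {n : ℕ} (hn : p = 2*n+1) (he : Even n) (k : ℕ) (hk : k ≤ n) :
    Cg p 1 (ck k) (ck (n-k)) := by
  have key : ∀ k ≤ n, Cg p 1 (ck k) (((-1)^k * (n.choose k : ℚ))^3) := by
    intro k hk
    rw [ck_dk]
    have h := dk_choose hn k hk
    have hm : ((-1)^k * (n.choose k : ℚ)) ∈ Ip p := mul_mem (pow_mem (neg_mem (one_mem _)) _) (nat_mem _)
    have hd := h.mem hm
    have h2 := Cg.mul hd hm h h
    have h3 := Cg.mul (mul_mem hd hd) hm h2 h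
    exact (Cg.of_eq (by ring)).trans (h3.trans (Cg.of_eq (by ring)))
  refine (key k hk).trans ((key (n-k) (by omega)).trans (Cg.of_eq ?_)).symm
  rw [Nat.choose_symm hk]
  congr 2
  obtain ⟨m, rfl⟩ := he
  rcases Nat.even_or_odd k with h | h
  · rw [h.neg_one_pow, Even.neg_one_pow]
    exact (Nat.even_sub hk).2 (by simp [h])
  · rw [h.neg_one_pow, Odd.neg_one_pow]
    exact (Nat.odd_sub hk).2 (by
      rw [← Nat.not_even_iff_odd, ← Nat.not_odd_iff_even]; simp [h])

lemma ab_congr {n : ℕ} (hn : p = 2*n+1) (j : ℕ) (hj : j < n) :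
    Cg p 1 (1/(2*(j:ℚ)+1)^2) (1/(2*((n-1-j:ℕ):ℚ)+2)^2) := by
  have ha := a_mem hn hj
  have hb := b_mem hn (show n-1-j < n by omega)
  have h0 : (2*(j:ℚ)+1) ≠ 0 := by positivity
  have h1 : (2*((n-1-j:ℕ):ℚ)+2) ≠ 0 := by positivity
  refine ⟨(1/(2*(j:ℚ)+1)^2) * (1/(2*((n-1-j:ℕ):ℚ)+2)^2) * (p - 2 * (2*j+1)), mul_mem (mul_mem ha hb) ?_, ?_⟩
  · have := int_mem (p := p) (p - 2 * (2*j+1)); push_cast at this; exact this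
  · field_simp
    have : (p:ℚ) = (2*j+1) + (2*((n-1-j:ℕ):ℚ)+2) := by
      rw [hn]; have : n = j + (n-1-j) + 1 := by omega
      rw [this]; push_cast; simp; ring
    rw [this]; ring

lemma Ak_symm {n : ℕ} (hn : p = 2*n+1) (k : ℕ) (hk : k ≤ n) :
    Cg p 1 (Ak k) (Bk n - Bk (n-k)) := by
  have h : Bk n - Bk (n-k) = ∑ j ∈ Finset.range k, 1/(2*((n-1-j:ℕ):ℚ)+2)^2 := by
    have : n = (n-k) + k := by omega
    rw [← Finset.sum_range_reflect]
    unfold Bk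
    conv_lhs => rw [this, Finset.sum_range_add]
    rw [show n - k + k - k = n-k by omega, add_sub_cancel_left]
    apply Finset.sum_congr rfl
    intro j hj
    simp at hj
    rw [show n - 1 - (k-1-j) = n-k+j by omega]
  rw [h]
  exact Cg.sum _ _ _ fun j hj => ab_congr hn j (by simp at hj; omega)

lemma sum_two (f : ℕ → ℚ) (n : ℕ) : ∑ i ∈ Finset.range (2*n), f i
    = ∑ j ∈ Finset.range n, f (2*j) + ∑ j ∈ Finset.range n, f (2*j+1) := by
  induction n with
  | zero => simp
  | succ n ih =>
    rw [show 2*(n+1) = 2*n+1+1 by ring, Finset.sum_range_succ, Finset.sum_range_succ, ih,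
      Finset.sum_range_succ, Finset.sum_range_succ]
    ring

lemma Bn_zero {n : ℕ} (hn : p = 2*n+1) (hp3 : p ≠ 3) : Cg p 1 (Bk n) 0 := by
  -- full sum
  have hH : ∑ i ∈ Finset.range (2*n), 1/((i:ℚ)+1)^2 = Ak n + Bk n := by
    rw [sum_two]
    unfold Ak Bk
    congr 1 <;> (apply Finset.sum_congr rfl; intros; push_cast; ring)
  have hB : 4 * Bk n = ∑ j ∈ Finset.range n, 1/((j:ℚ)+1)^2 := by
    unfold Bk; rw [Finset.mul_sum]
    apply Finset.sum_congr rfl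
    intro j _
    have : (j:ℚ)+1 ≠ 0 := by positivity
    field_simp; norm_num
  have im : ∀ i < 2*n, 1/((i:ℚ)+1)^2 ∈ Ip p := by
    intro i hi
    have := inv_mem_lt (p := p) (k := i+1) (by omega) (by omega)
    push_cast at this
    rw [one_div, ← inv_pow]
    exact pow_mem this 2
  have hsym : Cg p 1 (∑ i ∈ Finset.range (2*n), 1/((i:ℚ)+1)^2) (2 * (4 * Bk n)) := by
    rw [two_mul n, Finset.sum_range_add, ← hB, two_mul]
    apply (Cg.refl _ _).add
    rw [hB, ← Finset.sum_range_reflect]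
    apply Cg.sum
    intro j hj
    simp at hj
    have m1 := im (n + (n-1-j)) (by omega)
    have m2 := im j (by omega)
    have h1 : ((n + (n-1-j) : ℕ):ℚ)+1 ≠ 0 := by positivity
    have h2 : ((j : ℕ):ℚ)+1 ≠ 0 := by positivity
    refine ⟨_, mul_mem (mul_mem m1 m2) (int_mem (2*(j+1)-p)), ?_⟩
    beta_reduce
    have : (p:ℚ) = ((n + (n-1-j) : ℕ):ℚ)+1 + ((j:ℚ)+1) := by
      have : p = (n + (n-1-j)) + 1 + (j+1) := by omega
      exact_mod_cast this
    rw [Int.cast_sub, Int.cast_mul, Int.cast_add, Int.cast_natCast, Int.cast_natCast, Int.cast_one, Int.cast_ofNat]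
    generalize ((n + (n-1-j) : ℕ):ℚ) = u at *
    field_simp
    rw [this]; ring
  rw [hH] at hsym
  have hA := Ak_symm hn n le_rfl
  rw [Nat.sub_self, show Bk 0 = 0 by simp [Bk], sub_zero] at hA
  have h6 : Cg p 1 (6 * Bk n) 0 := by
    have := (hsym.symm.add (hA.sub (Cg.refl _ (Bk n)))).sub (Cg.refl _ (2 * Bk n))
    obtain ⟨c, hc, e⟩ := this
    exact ⟨c, hc, by linear_combination e⟩
  have i6 : (6:ℚ)⁻¹ ∈ Ip p := by
    have := inv_mem_nat (p := p) (k := 2*3) (by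
      intro hd
      rcases (Nat.Prime.dvd_mul hp.out).1 hd with h | h
      · have := (Nat.prime_dvd_prime_iff_eq hp.out Nat.prime_two).1 h; omega
      · have := (Nat.prime_dvd_prime_iff_eq hp.out Nat.prime_three).1 h; omega)
    norm_num at this; simpa using this
  have := h6.mul_left i6
  exact (Cg.of_eq (by ring)).trans (this.trans (Cg.of_eq (by ring)))

lemma antisym {n : ℕ} (hp2 : p ≠ 2) (f : ℕ → ℚ) (h : ∀ k ≤ n, Cg p 1 (f k) (-f (n-k))) :
    Cg p 1 (∑ k ∈ Finset.range (n+1), f k) 0 := by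
  have h1 : Cg p 1 (∑ k ∈ Finset.range (n+1), f k) (-∑ k ∈ Finset.range (n+1), f k) := by
    conv_rhs => rw [← Finset.sum_range_reflect, ← Finset.sum_neg_distrib]
    apply Cg.sum
    intro k hk
    simp at hk
    rw [show n+1-1-k = n-k by omega]
    exact h k (by omega)
  have h2 := (h1.add (Cg.refl _ (∑ k ∈ Finset.range (n+1), f k))).mul_left (two_inv_mem hp2)
  exact (Cg.of_eq (by ring)).trans (h2.trans (Cg.of_eq (by ring)))

lemma S0_mod3 {n : ℕ} (hn : p = 2*n+1) (he : Even n) (hp3 : p ≠ 3) :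
    Cg p 3 (S0 n) (TW (-(p:ℚ)^2/4) n) := by
  have hp2 : p ≠ 2 := by omega
  refine Cg.symm ((S0_core hn).trans ?_)
  have h : Cg p 1 (∑ k ∈ Finset.range (n+1), ck k * (Ak k + Bk k)) 0 := by
    apply antisym hp2
    intro k hk
    have h1 := (Ak_symm hn k hk).trans ((Bn_zero hn hp3).sub (Cg.refl _ _))
    have h2 := (Ak_symm hn (n-k) (by omega)).trans ((Bn_zero hn hp3).sub (Cg.refl _ _))
    rw [show n - (n-k) = k by omega] at h2
    have h3 : Cg p 1 (Ak k + Bk k) (-(Ak (n-k) + Bk (n-k))) := by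
      have := (h1.add h2)
      have := this.sub (Cg.refl _ (Ak (n-k) - Bk k))
      exact (Cg.of_eq (by ring)).trans (this.trans (Cg.of_eq (by ring)))
    have hm : -(Ak (n-k) + Bk (n-k)) ∈ Ip p := neg_mem (add_mem (Ak_mem hn (by omega)) (Bk_mem hn (by omega)))
    exact (Cg.mul (ck_mem hp2 k) hm (ck_symm hn he k hk) h3).trans (Cg.of_eq (by ring))
  have := (Cg.refl _ (S0 n)).sub (h.mul_p 2)
  exact this.trans (Cg.of_eq (by ring))

lemma X0_mod3 {n : ℕ} (hn : p = 2*n+1) (he : Even n) (hp3 : p ≠ 3) :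
    Cg p 3 (X0 n) (SD n) := by
  have hp2 : p ≠ 2 := by omega
  refine Cg.symm ((X0_core hn).trans ?_)
  have h : Cg p 1 (∑ k ∈ Finset.range (n+1), (4*(k:ℚ)+1) * ck k * (Ak k - Bk k)) 0 := by
    apply antisym hp2
    intro k hk
    have h1 := (Ak_symm hn k hk).trans ((Bn_zero hn hp3).sub (Cg.refl _ _))
    have h2 := (Ak_symm hn (n-k) (by omega)).trans ((Bn_zero hn hp3).sub (Cg.refl _ _))
    rw [show n - (n-k) = k by omega] at h2
    have h3 : Cg p 1 (Ak k - Bk k) ((Ak (n-k) - Bk (n-k))) := by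
      have := (h1.sub h2)
      have := this.add (Cg.refl _ (Ak (n-k) - Bk k))
      exact (Cg.of_eq (by ring)).trans (this.trans (Cg.of_eq (by ring)))
    have hm : (Ak (n-k) - Bk (n-k)) ∈ Ip p := (sub_mem (Ak_mem hn (by omega)) (Bk_mem hn (by omega)))
    have h4 : Cg p 1 (4*(k:ℚ)+1) (-(4*((n-k:ℕ):ℚ)+1)) := by
      refine ⟨2, by simp, ?_⟩
      push_cast [hk]; rw [hn]; push_cast; ring
    have h5 : 4*(k:ℚ)+1 ∈ Ip p := by
      have := nat_mem (p := p) (4*k+1)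
      push_cast at this; exact this
    have h6 := Cg.mul h5 (ck_mem hp2 (n-k)) h4 (ck_symm hn he k hk)
    exact (Cg.mul (mul_mem h5 (ck_mem hp2 k)) hm h6 h3).trans (Cg.of_eq (by ring))
  have := (Cg.refl _ (X0 n)).sub (h.mul_p 2)
  exact this.trans (Cg.of_eq (by ring))

/-- `Σ k ck` in terms of `S0` and `X0` -/
lemma S_eq (n : ℕ) : ∑ k ∈ Finset.range (n+1), (k:ℚ) * ck k = (X0 n - S0 n)/4 := by
  unfold X0 S0
  rw [← Finset.sum_sub_distrib, Finset.sum_div]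
  apply Finset.sum_congr rfl; intros; ring
end
end S18

namespace S18
section
variable {p : ℕ} [hp : Fact p.Prime]

lemma tau_aux {a b : ℤ} (h : (a : ZMod p) = b) :
    ((a:ℤ) : ZMod (p^3))^(p^2) = ((b:ℤ) : ZMod (p^3))^(p^2) := by
  have h1 : (p:ℤ) ∣ a - b := by
    rw [← ZMod.intCast_zmod_eq_zero_iff_dvd]  <;> push_cast <;> simp [h]
  have h2 := dvd_sub_pow_of_dvd_sub (R := ℤ) (p := p) h1 2
  have h3 : (((a^(p^2) - b^(p^2) : ℤ)) : ZMod (p^3)) = 0 := by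
    rw [ZMod.intCast_zmod_eq_zero_iff_dvd]
    push_cast; exact h2
  push_cast at h3
  linear_combination h3

/-- Teichmüller lift to `ZMod (p^3)` -/
def tau (p : ℕ) (z : ZMod p) : ZMod (p^3) := ((z.val:ℤ) : ZMod (p^3))^(p^2)

lemma tau_int (k : ℤ) : tau p (k : ZMod p) = ((k:ℤ) : ZMod (p^3))^(p^2) := by
  apply tau_aux
  simp

lemma val_int (z : ZMod p) : (((z.val : ℤ)) : ZMod p) = z := by simp

lemma tau_mul (y z : ZMod p) : tau p (y*z) = tau p y * tau p z := by
  rw [← val_int y, ← val_int z, ← Int.cast_mul, tau_int, tau_int, tau_int, Int.cast_mul, mul_pow]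

lemma tau_one : tau p (1 : ZMod p) = 1 := by
  have := tau_int (p := p) 1
  simpa using this

lemma tau_zero : tau p (0 : ZMod p) = 0 := by
  have := tau_int (p := p) 0
  have h2 := hp.out.ne_zero
  simpa [h2] using this

lemma tau_neg_one (hp2 : p ≠ 2) : tau p (-1 : ZMod p) = -1 := by
  have := tau_int (p := p) (-1)
  have ho : Odd (p^2) := (hp.out.odd_of_ne_two hp2).pow
  simpa [ho.neg_one_pow] using this

lemma tau_pow (z : ZMod p) (k : ℕ) : tau p (z^k) = tau p z ^ k := by
  induction k with
  | zero => simp [tau_one]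
  | succ k ih => rw [pow_succ z, tau_mul, ih, pow_succ (tau p z)]

lemma tau_one_sub (z : ZMod p) : tau p (1-z) = (1 - tau p z)^(p^2) := by
  have h : (1 - z) = ((1 - (z.val:ℤ)^(p^2) : ℤ) : ZMod p) := by
    push_cast
    simp [pow_two, pow_mul, ZMod.pow_card]
  rw [h, tau_int]
  push_cast
  simp [tau]

lemma tau_card {z : ZMod p} (hz : z ≠ 0) : tau p z ^ (p-1) = 1 := by
  rw [← tau_pow, ZMod.pow_card_sub_one_eq_one hz, tau_one]

lemma isUnit_int {k : ℤ} (h : (k : ZMod p) ≠ 0) : IsUnit ((k:ℤ) : ZMod (p^3)) := by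
  rw [Ne, ZMod.intCast_zmod_eq_zero_iff_dvd] at h
  have h1 : IsCoprime ((p:ℤ)^3) k :=
    ((Int.prime_iff_natAbs_prime.2 (by simpa using hp.out)).coprime_iff_not_dvd.2 h).pow_left
  obtain ⟨u, v, huv⟩ := h1
  have h2 := congrArg (Int.cast : ℤ → ZMod (p^3)) huv
  have hp3 : (p:ZMod (p^3))^3 = 0 := by
    have := ZMod.natCast_self (p^3)
    push_cast at this; exact this
  push_cast at h2
  rw [hp3, mul_zero, zero_add] at h2
  exact IsUnit.of_mul_eq_one_right _ h2

lemma tau_sum (g : (ZMod p)ˣ) (hg : ∀ x, x ∈ Subgroup.zpowers g) (e : ℕ) (he : 0 < e) :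
    ∑ z : ZMod p, tau p z ^ e = if p - 1 ∣ e then ((p:ZMod (p^3)) - 1) else 0 := by
  split_ifs with h
  · obtain ⟨q, rfl⟩ := h
    rw [← Finset.add_sum_erase _ _ (Finset.mem_univ (0:ZMod p)), tau_zero, zero_pow he.ne', zero_add]
    rw [Finset.sum_congr rfl (g := fun _ => (1:ZMod (p^3)))]
    · simp [Finset.card_erase_of_mem]
      rw [Nat.cast_sub hp.out.one_lt.le]; simp
    · intro z hz
      simp at hz
      rw [pow_mul, tau_card hz, one_pow]
  · have h1 : ∑ z : ZMod p, tau p z ^ e = tau p g ^ e * ∑ z : ZMod p, tau p z ^ e := by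
      rw [Finset.mul_sum]
      rw [← (Equiv.sum_comp (Units.mulLeft g) (fun z : ZMod p => tau p z ^ e))]
      apply Finset.sum_congr rfl
      intro z _
      rw [← mul_pow, ← tau_mul]; rfl
    have hu : IsUnit (tau p g ^ e - 1) := by
      have : tau p (g:ZMod p) ^ e - 1 = ((((g:ZMod p).val:ℤ)^(p^2*e) - 1 : ℤ) : ZMod (p^3)) := by
        unfold tau; push_cast; rw [pow_mul]
      rw [this]
      apply isUnit_int
      push_cast
      have e1 : (((g:ZMod p).val : ZMod p)) ^ (p^2*e) = (g:ZMod p)^e := by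
        simp [pow_mul, pow_two, ZMod.pow_card]
      rw [e1, sub_ne_zero]
      intro h2
      apply h
      have h3 : g^e = 1 := by ext; simpa using h2
      have h4 := orderOf_dvd_of_pow_eq_one h3
      rwa [orderOf_eq_card_of_forall_mem_zpowers hg, Nat.card_eq_fintype_card, ZMod.card_units] at h4
    have h2 : (tau p g ^ e - 1) * ∑ z : ZMod p, tau p z ^ e = 0 := by linear_combination -h1
    exact (hu.mul_right_eq_zero).1 h2

lemma one_add_pow_nil {R : Type*} [CommRing R] (y : R) (hy : y^3 = 0) (s : ℕ) :
    2 * (1+y)^s = 2 + 2*s*y + s*((s:R)-1)*y^2 := by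
  induction s with
  | zero => simp
  | succ s ih =>
    rw [pow_succ, ← mul_assoc, ih]
    push_cast
    linear_combination s*((s:R)-1) * hy

/-- the polynomial approximation of the quadratic character of a Teichmüller element -/
lemma quad_approx {m : ℕ} (hm : p = 4*m+1) (z : ZMod p) :
    8 * tau p (1-z) ^ (2*m) = (1 - tau p z)^(2*m) *
      (15 - 10 * (1 - tau p z)^(4*m) + 3 * (1 - tau p z)^(8*m)) := by
  have hm0 : 0 < m := by have := hp.out.two_le; omega
  rw [tau_one_sub]
  by_cases hz : 1 - z = 0
  · have : z = 1 := by linear_combination -hz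
    rw [this, tau_one]; simp [hm0.ne', hp.out.ne_zero]
  · set w := 1 - tau p z with hw
    have hwi : ∃ k : ℤ, w = (k : ZMod (p^3)) ∧ (k : ZMod p) = 1 - z := by
      refine ⟨1 - (z.val:ℤ)^(p^2), ?_, ?_⟩
      · rw [hw, tau]; push_cast; rfl
      · push_cast; simp [pow_mul, pow_two, ZMod.pow_card]
    obtain ⟨k, hk1, hk2⟩ := hwi
    have hy : ∃ c : ZMod (p^3), w^(4*m) - 1 = (p:ZMod (p^3)) * c := by
      have h1 : (((k^(4*m) - 1 : ℤ)) : ZMod p) = 0 := by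
        push_cast
        rw [hk2, show 4*m = p-1 by omega, ZMod.pow_card_sub_one_eq_one hz, sub_self]
      rw [ZMod.intCast_zmod_eq_zero_iff_dvd] at h1
      obtain ⟨c, hc⟩ := h1
      refine ⟨(c:ZMod (p^3)), ?_⟩
      rw [hk1]
      exact_mod_cast congrArg (Int.cast : ℤ → ZMod (p^3)) hc
    obtain ⟨c, hc⟩ := hy
    set y := w^(4*m) - 1 with hyd
    have hp3 : (p:ZMod (p^3))^3 = 0 := by
      have := ZMod.natCast_self (p^3)
      push_cast at this; exact this
    have hy3 : y^3 = 0 := by rw [hc, mul_pow, hp3, zero_mul]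
    have hpy : (p:ZMod (p^3))^2 * y = 0 := by rw [hc]; linear_combination c * hp3
    obtain ⟨s, hs⟩ : ∃ s : ℕ, p^2 = 2*s+1 := by
      have ho : Odd (p^2) := (hp.out.odd_of_ne_two (by omega)).pow
      exact ho
    have e1 : (w^(p^2))^(2*m) = w^(2*m) * (1+y)^s := by
      have : 1 + y = w^(4*m) := by rw [hyd]; ring
      rw [this, hs, ← pow_mul, ← pow_mul, ← pow_add]
      congr 1; ring
    have e2 := one_add_pow_nil y hy3 s
    have hs' : (p:ZMod (p^3))^2 = 2*s+1 := by exact_mod_cast congrArg (Nat.cast : ℕ → ZMod (p^3)) hs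
    have e3 : 8 * (1+y)^s = 8 - 4*y + 3*y^2 := by
      have : (s:ZMod (p^3)) * 2 = (p:ZMod (p^3))^2 - 1 := by rw [hs']; ring
      have h4 : 4 * (2*(s:ZMod (p^3))*y) = - 4 * y := by
        linear_combination 4 * y * this + 4 * hpy
      have h5 : 4 * (s*((s:ZMod (p^3))-1)*y^2) = 3 * y^2 := by
        have h6 : (2*(s:ZMod (p^3)))*((2*s:ZMod (p^3))-2) = ((p:ZMod (p^3))^2-1)*((p:ZMod (p^3))^2-3) := by
          rw [show 2 * (s:ZMod (p^3)) = (p:ZMod (p^3))^2-1 by linear_combination this]; ring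
        linear_combination y^2 * h6 + ((p:ZMod (p^3))^2 - 4) * y * hpy
      linear_combination 4 * e2 + h4 + h5
    have e4 : w^(8*m) = (1+y)^2 := by rw [hyd]; ring
    have e5 : w^(4*m) = 1 + y := by rw [hyd]; ring
    rw [e1, e4, e5]
    linear_combination w^(2*m) * e3

lemma filt (m N : ℕ) (hm : 0 < m) (c : ℕ) (hc : c ≤ 2) (hN : N = (4*c+2)*m) :
    (Finset.range (N+1)).filter (fun j => 4*m ∣ 3*m+j) = (Finset.range (c+1)).image (fun i => 4*m*i+m) := by
  ext j
  simp only [Finset.mem_filter, Finset.mem_range, Finset.mem_image]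
  constructor
  · rintro ⟨h1, q, hq⟩
    have hq0 : q ≠ 0 := by rintro rfl; omega
    refine ⟨q-1, ?_, ?_⟩
    · by_contra hcon
      have h2 : c + 2 ≤ q := by omega
      have h3 : 4*m*(c+2) ≤ 4*m*q := Nat.mul_le_mul_left _ h2
      nlinarith
    · obtain ⟨r, rfl⟩ := Nat.exists_eq_succ_of_ne_zero hq0
      simp at hq ⊢; nlinarith
  · rintro ⟨i, hi, rfl⟩
    refine ⟨?_, ⟨i+1, by ring⟩⟩
    have : 4*m*i ≤ 4*m*c := Nat.mul_le_mul_left _ (by omega)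
    nlinarith

lemma binom_sum {m : ℕ} (hm : p = 4*m+1) (g : (ZMod p)ˣ) (hg : ∀ x, x ∈ Subgroup.zpowers g)
    (c : ℕ) (hc : c ≤ 2) (N : ℕ) (hN : N = (4*c+2)*m) :
    ∑ z : ZMod p, tau p z ^ (3*m) * (1 - tau p z)^N
     = ((p:ZMod (p^3)) - 1) * (-1)^m * ∑ i ∈ Finset.range (c+1), (N.choose (4*m*i+m) : ZMod (p^3)) := by
  have hm0 : 0 < m := by have := hp.out.two_le; omega
  have h1 : ∀ z : ZMod p, tau p z ^ (3*m) * (1 - tau p z)^N =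
     ∑ j ∈ Finset.range (N+1), (-1)^j * (N.choose j : ZMod (p^3)) * tau p z ^ (3*m+j) := by
    intro z
    rw [sub_eq_add_neg, add_comm, add_pow, Finset.mul_sum]
    apply Finset.sum_congr rfl
    intro j _
    rw [neg_pow, pow_add]; simp; ring
  simp_rw [h1]
  rw [Finset.sum_comm]
  have h2 : ∀ j ∈ Finset.range (N+1), ∑ z : ZMod p, (-1)^j * (N.choose j : ZMod (p^3)) * tau p z ^ (3*m+j)
      = if 4*m ∣ 3*m+j then (-1)^j * (N.choose j : ZMod (p^3)) * ((p:ZMod (p^3)) - 1) else 0 := by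
    intro j _
    rw [← Finset.mul_sum, tau_sum g hg _ (by omega), show p - 1 = 4*m by omega]
    split_ifs <;> simp
  rw [Finset.sum_congr rfl h2, ← Finset.sum_filter, filt m N hm0 c hc hN, Finset.sum_image, Finset.mul_sum]
  · apply Finset.sum_congr rfl
    intro i _
    have : (-1 : ZMod (p^3))^(4*m*i+m) = (-1)^m := by
      rw [pow_add, show 4*m*i = 2*(2*m*i) by ring, pow_mul]; simp
    rw [this]; ring
  · intro a _ b _ h
    simp at h
    rcases h with h | h <;> omega
end
end S18

namespace S18
section
variable {p : ℕ} [hp : Fact p.Prime]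

lemma I_prim : IsPrimitiveRoot (⟨0,1⟩ : GaussianInt) 4 := by
  rw [IsPrimitiveRoot.iff_orderOf]
  have : orderOf (⟨0,1⟩ : GaussianInt) = 2^(1+1) := by
    apply orderOf_eq_prime_pow <;> decide
  simpa using this

lemma norm_of_char {m : ℕ} (hm : p = 4*m+1) (χ : MulChar (ZMod p) GaussianInt) (hχ : orderOf χ = 4) :
    (jacobiSum χ (χ^2)).norm = p := by
  have hinj : Function.Injective GaussianInt.toComplex := fun a b h => GaussianInt.toComplex_inj.1 h
  have hne : ∀ k : ℕ, ¬ 4 ∣ k → (χ^k).ringHomComp GaussianInt.toComplex ≠ 1 := by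
    intro k hk
    rw [MulChar.ringHomComp_ne_one_iff hinj]
    intro h
    rw [← orderOf_dvd_iff_pow_eq_one, hχ] at h
    exact hk h
  have h := jacobiSum_mul_jacobiSum_inv (F := ZMod p) (F' := ℂ)
    (χ := χ.ringHomComp GaussianInt.toComplex) (φ := (χ^2).ringHomComp GaussianInt.toComplex)
    (by rw [ringChar.eq ℂ 0, ringChar.eq (ZMod p) p]; exact hp.out.ne_zero.symm)
    (by simpa using hne 1 (by norm_num)) (hne 2 (by norm_num)) ?_
  · have h2 : jacobiSum (χ.ringHomComp GaussianInt.toComplex)⁻¹ ((χ^2).ringHomComp GaussianInt.toComplex)⁻¹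
      = star (jacobiSum (χ.ringHomComp GaussianInt.toComplex) ((χ^2).ringHomComp GaussianInt.toComplex)) := by
      rw [← MulChar.star_eq_inv, ← MulChar.star_eq_inv, jacobiSum, jacobiSum, star_sum]
      apply Finset.sum_congr rfl
      intro z _
      rw [star_mul', MulChar.star_apply, MulChar.star_apply]
    rw [h2, jacobiSum_ringHomComp, ZMod.card] at h
    have h3 : GaussianInt.toComplex ((jacobiSum χ (χ^2)).norm : GaussianInt) = GaussianInt.toComplex (p : GaussianInt) := by
      rw [Zsqrtd.norm_eq_mul_conj, map_mul, GaussianInt.toComplex_star, map_natCast]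
      exact h
    have h4 := hinj h3
    have h5 := congrArg Zsqrtd.re h4
    simpa using h5
  · have : χ.ringHomComp GaussianInt.toComplex * (χ^2).ringHomComp GaussianInt.toComplex = (χ^3).ringHomComp GaussianInt.toComplex := by
      ext z
      simp [MulChar.ringHomComp_apply, MulChar.pow_apply']
      ring
    rw [this]
    exact hne 3 (by norm_num)

lemma sq_neg_one (a : GaussianInt) (h : a^2 = -1) : a = ⟨0,1⟩ ∨ a = ⟨0,-1⟩ := by
  have h1 := congrArg Zsqrtd.re h
  have h2 := congrArg Zsqrtd.im h
  simp [pow_two] at h1 h2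
  have h0 : a.re = 0 := by
    have : a.re * a.im = 0 := by linarith [mul_comm a.re a.im]
    rcases mul_eq_zero.1 this with h | h
    · exact h
    · rw [h] at h1; nlinarith
  rw [h0] at h1
  have h3 : (a.im - 1)*(a.im+1) = 0 := by linarith
  rcases mul_eq_zero.1 h3 with h | h
  · left; ext; · exact h0
    · simp; omega
  · right; ext; · exact h0
    · simp; omega

lemma char_g {χ : MulChar (ZMod p) GaussianInt} (hχ : orderOf χ = 4)
    (g : (ZMod p)ˣ) (hg : ∀ x, x ∈ Subgroup.zpowers g) : (χ g)^2 = -1 := by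
  have h4 : χ^4 = 1 := hχ ▸ pow_orderOf_eq_one χ
  have h5 : (χ g)^4 = 1 := by
    rw [← MulChar.pow_apply' χ (by norm_num), h4, MulChar.one_apply_coe]
  have h6 : (χ g)^2 ≠ 1 := by
    intro h
    have : χ^2 = 1 := by
      rw [MulChar.eq_iff hg, MulChar.pow_apply' χ (by norm_num), h, MulChar.one_apply_coe]
    rw [← orderOf_dvd_iff_pow_eq_one, hχ] at this
    norm_num at this
  have h7 : ((χ g)^2 - 1) * ((χ g)^2+1) = 0 := by linear_combination h5
  rcases mul_eq_zero.1 h7 with h | h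
  · exact absurd (by linear_combination h) h6
  · linear_combination h

lemma odd_re {m : ℕ} (hm : p = 4*m+1) (χ : MulChar (ZMod p) GaussianInt) (hχ : orderOf χ = 4)
    (g : (ZMod p)ˣ) (hg : ∀ x, x ∈ Subgroup.zpowers g) :
    Odd (jacobiSum χ (χ^2)).re := by
  have hp2 : p ≠ 2 := by omega
  have hn1 : (-1 : ZMod p) ≠ 1 := by
    haveI : Fact (2 < p) := ⟨by have := hp.out.two_le; omega⟩
    exact ZMod.neg_one_ne_one
  have hpow : ∀ z : ZMod p, z ≠ 0 → ∃ k : ℕ, z = (g:ZMod p)^k := by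
    intro z hz
    have := hg (Units.mk0 z hz)
    rw [← mem_powers_iff_mem_zpowers] at this
    obtain ⟨k, hk⟩ := this
    refine ⟨k, ?_⟩
    have := congrArg Units.val hk
    simpa using this.symm
  have hg2 := char_g hχ g hg
  have hval : ∀ z : ZMod p, z ≠ 0 → (χ z)^2 = 1 ∨ (χ z)^2 = -1 := by
    intro z hz
    obtain ⟨k, rfl⟩ := hpow z hz
    rw [map_pow, ← pow_mul, mul_comm, pow_mul, hg2]
    exact neg_one_pow_eq_or _ k
  have hsq : (χ (-1))^2 = 1 := by rw [← map_pow]; simp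
  -- additive map re mod 2
  let f : GaussianInt →+ ZMod 2 :=
    { toFun := fun a => (a.re : ZMod 2), map_zero' := by simp, map_add' := by intros; simp }
  have hf1 : ∀ a : GaussianInt, f (-a) = f a := by
    intro a; rw [map_neg]; exact ZMod.neg_eq_self_mod_two _
  have hone : f 1 = 1 := by simp [f]
  suffices h : f (jacobiSum χ (χ^2)) = 1 by
    have h2 : ((jacobiSum χ (χ^2)).re : ZMod 2) = 1 := h
    rw [← ZMod.intCast_eq_one_iff_odd]
    exact h2
  unfold jacobiSum
  rw [← Finset.add_sum_erase _ _ (Finset.mem_univ (-1 : ZMod p)), map_add]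
  have ha : f (χ (-1) * (χ^2) (1 - -1)) = 1 := by
    rw [MulChar.pow_apply' _ (by norm_num)]
    have h2 : (1 - -1 : ZMod p) ≠ 0 := by
      intro h; apply hn1; linear_combination -h
    have h3 : χ (-1) = 1 ∨ χ (-1) = -1 := sq_eq_one_iff.1 hsq
    rcases h3 with h | h <;> rcases hval _ h2 with h' | h' <;> rw [h, h'] <;> simp [hf1, hone]
  rw [ha, map_sum]
  have hz : ∑ z ∈ Finset.univ.erase (-1 : ZMod p), f (χ z * (χ^2) (1-z)) = 0 := by
    apply Finset.sum_involution (fun z _ => z⁻¹)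
    · intro z hz
      by_cases h0 : z = 0
      · subst h0; simp [MulChar.map_zero]
      · have e : f (χ z⁻¹ * (χ^2) (1 - z⁻¹)) = f (χ z * (χ^2) (1-z)) := by
          rw [MulChar.pow_apply' _ (by norm_num), MulChar.pow_apply' _ (by norm_num)]
          have h1 : 1 - z⁻¹ = (-1) * ((1 - z) * z⁻¹) := by field_simp; ring
          have h2 : (χ (1 - z⁻¹))^2 = (χ (1-z))^2 * (χ z⁻¹)^2 := by
            rw [h1, map_mul, map_mul, mul_pow, hsq, mul_pow]; ring
          rw [h2]
          have h3 : χ z * χ z⁻¹ = 1 := by rw [← map_mul, mul_inv_cancel₀ h0, map_one]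
          have h4 : (χ z⁻¹)^4 = 1 := by
            rcases hval z⁻¹ (inv_ne_zero h0) with h | h
            · linear_combination ((χ z⁻¹)^2 + 1) * h
            · linear_combination ((χ z⁻¹)^2 - 1) * h
          have h5 : (χ z⁻¹)^3 = χ z := by linear_combination χ z * h4 - (χ z⁻¹)^3 * h3
          congr 1
          linear_combination (χ (1-z))^2 * h5
        rw [e]; exact CharTwo.add_self_eq_zero _
    · intro z hz hne h
      simp at hz
      have hz0 : z ≠ 0 := by rintro rfl; simp [MulChar.map_zero] at hne
      have hz1 : z ≠ 1 := by rintro rfl; simp [MulChar.map_zero] at hne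
      have : z * z = 1 := by nth_rewrite 1 [← h]; exact inv_mul_cancel₀ hz0
      rcases mul_self_eq_one_iff.1 this with h | h
      · exact hz1 h
      · exact hz h
    · intro z hz; simp
    · intro z hz
      simp at hz ⊢
      intro h
      apply hz
      rw [inv_eq_iff_eq_inv] at h
      rw [h]; simp [inv_neg]
  rw [hz, add_zero]

lemma exists_J {m : ℕ} (hm : p = 4*m+1) (g : (ZMod p)ˣ) (hg : ∀ x, x ∈ Subgroup.zpowers g) :
    ∃ a b : ℤ, a^2 + b^2 = p ∧ Odd a ∧ ∃ r : ZMod (p^3), r*r = -1 ∧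
      (a:ZMod (p^3)) + (b:ZMod (p^3)) * r = ∑ z : ZMod p, tau p z ^ (3*m) * tau p (1-z)^(2*m) := by
  obtain ⟨χ, hχ⟩ := MulChar.exists_mulChar_orderOf (ZMod p) (n := 4) (R := GaussianInt)
    (by rw [ZMod.card]; omega) I_prim
  have hm0 : 0 < m := by have := hp.out.two_le; omega
  refine ⟨(jacobiSum χ (χ^2)).re, (jacobiSum χ (χ^2)).im, ?_, odd_re hm χ hχ g hg, ?_⟩
  · have := norm_of_char hm χ hχ
    rw [Zsqrtd.norm_def] at this
    rw [← this]; ring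
  · have hp2 : p ≠ 2 := by omega
    have hg2 := char_g hχ g hg
    -- τ(g)^(2m) = -1
    have ht : tau p g ^ (2*m) = -1 := by
      rw [← tau_pow, ← tau_neg_one hp2]
      congr 1
      have h1 : ((g:ZMod p)^(2*m))^2 = 1 := by
        rw [← pow_mul, show 2*m*2 = p-1 by omega, ZMod.pow_card_sub_one_eq_one g.ne_zero]
      rcases sq_eq_one_iff.1 h1 with h | h
      · exfalso
        have h3 : g^(2*m) = 1 := by ext; simpa using h
        have h4 := orderOf_dvd_of_pow_eq_one h3
        rw [orderOf_eq_card_of_forall_mem_zpowers hg, Nat.card_eq_fintype_card, ZMod.card_units] at h4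
        have := Nat.le_of_dvd (by omega) h4
        omega
      · exact h
    have ht3 : tau p g ^ (3*m) * tau p g ^ (3*m) = -1 := by
      rw [← pow_add, show 3*m+3*m = 2*m*3 by ring, pow_mul, ht]; ring
    obtain ⟨r, hr, hrg⟩ : ∃ r : ZMod (p^3), r * r = -1 ∧ ((χ g).re : ZMod (p^3)) + ((χ g).im:ZMod (p^3)) * r = tau p g ^ (3*m) := by
      rcases sq_neg_one _ hg2 with h | h
      · exact ⟨tau p g ^ (3*m), ht3, by rw [h]; simp⟩
      · exact ⟨-tau p g ^ (3*m), by rw [neg_mul_neg, ht3], by rw [h]; simp⟩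
    refine ⟨r, hr, ?_⟩
    let f := Zsqrtd.lift (R := ZMod (p^3)) (d := -1) ⟨r, by simpa using hr⟩
    have hf : ∀ a : GaussianInt, f a = (a.re : ZMod (p^3)) + (a.im:ZMod (p^3)) * r := by intro a; rfl
    rw [← hf, jacobiSum, map_sum]
    have hfg : f (χ g) = tau p g ^ (3*m) := by rw [hf, hrg]
    have hfz : ∀ z : ZMod p, f (χ z) = tau p z ^ (3*m) := by
      intro z
      by_cases hz : z = 0
      · subst hz; rw [MulChar.map_zero, map_zero, tau_zero, zero_pow (by omega)]
      · have := hg (Units.mk0 z hz)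
        rw [← mem_powers_iff_mem_zpowers] at this
        obtain ⟨k, hk⟩ := this
        have hk := congrArg Units.val hk
        simp at hk
        rw [← hk, map_pow, map_pow, hfg, tau_pow, ← pow_mul, ← pow_mul, mul_comm]
    apply Finset.sum_congr rfl
    intro z _
    rw [map_mul, hfz, MulChar.pow_apply' _ (by norm_num), map_pow, hfz]
    congr 1
    by_cases hz : 1 - z = 0
    · rw [hz, tau_zero, zero_pow (by omega), zero_pow (by omega), zero_pow (by omega)]
    · have := tau_card hz
      rw [show p - 1 = 4*m by omega] at this
      rw [← pow_mul, show 3*m*2 = 4*m+2*m by ring, pow_add, this, one_mul]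
end
end S18

namespace S18
section
variable {p : ℕ} [hp : Fact p.Prime]

lemma two_sq_unique {a b x y : ℤ} (h : a^2+b^2 = p) (ha : Odd a) (hxy : (p:ℤ) = x^2+4*y^2) : a^2 = x^2 := by
  have hpI : Prime (p:ℤ) := Nat.prime_iff_prime_int.1 hp.out
  have hp0 : (0:ℤ) < p := by exact_mod_cast hp.out.pos
  obtain ⟨c, hc⟩ : ∃ c, c = 2*y := ⟨_, rfl⟩
  have hxc : x^2 + c^2 = p := by rw [hc, hxy]; ring
  -- parity
  have hpar : Even c := ⟨y, by rw [hc]; ring⟩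
  have hpodd : p ≠ 2 := by
    rintro rfl
    have : Odd x ∨ Even x := (Int.even_or_odd x).symm
    push_cast at hxy
    rcases this with ⟨k, hk⟩ | ⟨k, hk⟩
    · rw [hk] at hxy
      ring_nf at hxy; omega
    · rw [hk] at hxy
      ring_nf at hxy; omega
  have hoddp : Odd (p:ℤ) := by exact_mod_cast hp.out.odd_of_ne_two hpodd
  have hxo : Odd x := by
    by_contra hx
    rw [Int.not_odd_iff_even] at hx
    have : Even (p:ℤ) := by
      rw [← hxc]; exact (hx.pow_of_ne_zero (by norm_num)).add (hpar.pow_of_ne_zero (by norm_num))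
    exact (Int.not_odd_iff_even.2 this) hoddp
  have key : ∀ b : ℤ, a^2+b^2 = p → (p:ℤ) ∣ a*c - b*x → a^2 = x^2 := by
    intro b h hd
    obtain ⟨k, hk⟩ := hd
    have e : (a*c-b*x)^2 + (a*x+b*c)^2 = (p:ℤ)^2 := by
      calc _ = (a^2+b^2)*(x^2+c^2) := by ring
        _ = _ := by rw [h, hxc]; ring
    rw [hk] at e
    have hk1 : k^2 ≤ 1 := by
      by_contra hcon
      push Not at hcon
      nlinarith [sq_nonneg (a*x+b*c), mul_pos hp0 hp0]
    have hk2 : k = 0 ∨ k^2 = 1 := by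
      by_cases hk0 : k = 0
      · exact Or.inl hk0
      · right
        have : 0 < k^2 := by positivity
        omega
    rcases hk2 with h0 | h1
    · rw [h0, mul_zero] at hk
      have h2 : a^2 * c^2 = b^2*x^2 := by
        have : a*c = b*x := by linarith
        calc a^2*c^2 = (a*c)^2 := by ring
          _ = (b*x)^2 := by rw [this]
          _ = _ := by ring
      have h3 : (p:ℤ) * a^2 = p * x^2 := by
        calc (p:ℤ)*a^2 = (x^2+c^2)*a^2 := by rw [hxc]
          _ = (a^2+b^2)*x^2 := by linear_combination h2
          _ = _ := by rw [h]
      exact mul_left_cancel₀ hp0.ne' h3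
    · exfalso
      have h2 : a*x+b*c = 0 := by
        have : (a*x+b*c)^2 = 0 := by
          linear_combination e - (p:ℤ)^2 * h1
        exact pow_eq_zero_iff (by norm_num) |>.1 this
      have : Odd (a*x+b*c) := (ha.mul hxo).add_even (hpar.mul_left b)
      rw [h2] at this
      simp at this
  have hd : (p:ℤ) ∣ (a*c-b*x)*(a*c+b*x) := by
    refine ⟨c^2 - b^2, ?_⟩
    linear_combination c^2 * h - b^2 * hxc
  rcases hpI.dvd_or_dvd hd with h1 | h1
  · exact key b h h1
  · refine key (-b) (by linarith [neg_sq b]) ?_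
    rw [show a*c - -b*x = a*c+b*x by ring]; exact h1

/-- `8 Q/(1-p)` -/
def TT (m : ℕ) : ℤ := 15*((2*m).choose m) - 20*((6*m).choose m) + 6*((10*m).choose m) + 3*((10*m).choose (5*m))

theorem jacobi_claim {m : ℕ} (hm : p = 4*m+1) {x y : ℤ} (hxy : (p:ℤ) = x^2+4*y^2) :
    ∃ a : ℤ, a^2 = x^2 ∧ (p:ℤ)^3 ∣ ((1-p)*TT m)^2 - 16*a*((1-p)*TT m) + 64*p := by
  obtain ⟨g, hg⟩ := IsCyclic.exists_generator (α := (ZMod p)ˣ)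
  obtain ⟨a, b, hab, hodd, r, hr, hJ⟩ := exists_J hm g hg
  set F := ∑ z : ZMod p, tau p z ^ (3*m) * tau p (1-z)^(2*m) with hF
  have h8 : 8 * F = ((p:ZMod (p^3)) - 1) * (-1)^m * (TT m : ZMod (p^3)) := by
    have h0 := binom_sum hm g hg 0 (by norm_num) (2*m) (by ring)
    have h1 := binom_sum hm g hg 1 (by norm_num) (6*m) (by ring)
    have h2 := binom_sum hm g hg 2 (by norm_num) (10*m) (by ring)
    have e1 : (6*m).choose (4*m*1+m) = (6*m).choose m := by
      rw [← Nat.choose_symm_of_eq_add]; ring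
    have e2 : (10*m).choose (4*m*2+m) = (10*m).choose m := by
      rw [← Nat.choose_symm_of_eq_add]; ring
    simp only [Finset.sum_range_succ, Finset.sum_range_zero, e1, e2] at h0 h1 h2
    have e3 : 4*m*1+m = 5*m := by ring
    have e4 : 4*m*0+m = m := by ring
    simp only [e3, e4] at h0 h1 h2
    have : 8 * F = 15 * (∑ z : ZMod p, tau p z ^ (3*m) * (1 - tau p z)^(2*m))
       - 10 * (∑ z : ZMod p, tau p z ^ (3*m) * (1 - tau p z)^(6*m))
       + 3 * (∑ z : ZMod p, tau p z ^ (3*m) * (1 - tau p z)^(10*m)) := by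
      rw [hF, Finset.mul_sum, Finset.mul_sum, Finset.mul_sum, Finset.mul_sum, ← Finset.sum_sub_distrib, ← Finset.sum_add_distrib]
      apply Finset.sum_congr rfl
      intro z _
      have := quad_approx hm z
      rw [show 6*m = 2*m+4*m by ring, show 10*m = 2*m+8*m by ring, pow_add _ (2*m), pow_add _ (2*m)]
      linear_combination tau p z ^ (3*m) * this
    rw [this, h0, h1, h2]
    unfold TT
    push_cast
    ring
  have hq : F^2 - 2*(a:ZMod (p^3))*F + (p:ZMod (p^3)) = 0 := by
    have hab' : (a:ZMod (p^3))^2 + (b:ZMod (p^3))^2 = (p:ZMod (p^3)) := by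
      exact_mod_cast congrArg (Int.cast : ℤ → ZMod (p^3)) hab
    rw [← hJ]
    linear_combination -hab' + (b:ZMod (p^3))^2 * hr
  have hs : ((-1:ZMod (p^3))^m)^2 = 1 := by rw [← pow_mul, mul_comm, pow_mul]; simp
  refine ⟨-(-1)^m * a, ?_, ?_⟩
  · rw [mul_pow, neg_sq, ← pow_mul, mul_comm m 2, pow_mul]
    simpa using two_sq_unique hab hodd hxy
  · have h3 : (((((1-p)*TT m)^2 - 16*(-(-1)^m * a)*((1-p)*TT m) + 64*p : ℤ)) : ZMod (p^3)) = 0 := by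
      push_cast
      set s : ZMod (p^3) := (-1)^m
      set T : ZMod (p^3) := (TT m : ZMod (p^3))
      set P : ZMod (p^3) := (p : ZMod (p^3))
      linear_combination 64 * hq - (8*F + (P-1)*s*T - 16*(a:ZMod (p^3))) * h8 - ((1-P)*T)^2 * hs
    rw [ZMod.intCast_zmod_eq_zero_iff_dvd] at h3
    push_cast at h3
    exact h3
end
end S18

namespace S18
section
variable {p : ℕ} [hp : Fact p.Prime]

lemma Cg.prod {r : ℕ} (k : ℕ) (f g : ℕ → ℚ) (hf : ∀ j < k, f j ∈ Ip p) (hg : ∀ j < k, g j ∈ Ip p)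
    (h : ∀ j < k, Cg p r (f j) (g j)) :
    Cg p r (∏ j ∈ Finset.range k, f j) (∏ j ∈ Finset.range k, g j) := by
  induction k with
  | zero => simp; exact Cg.refl _ _
  | succ k ih =>
    rw [Finset.prod_range_succ, Finset.prod_range_succ]
    refine Cg.mul ?_ (hg k (by omega)) (ih (fun j hj => hf j (by omega)) (fun j hj => hg j (by omega))
      (fun j hj => h j (by omega))) (h k (by omega))
    exact prod_mem fun j hj => hf j (by simp at hj; omega)

lemma prod_sym_odd (f : ℕ → ℚ) (l : ℕ) :
    ∏ j ∈ Finset.range (2*l+1), f j = f l * ∏ i ∈ Finset.range l, (f (l-1-i) * f (l+1+i)) := by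
  rw [show 2*l+1 = l+(1+l) by ring, Finset.prod_range_add, Finset.prod_range_add, Finset.prod_mul_distrib,
    Finset.prod_range_reflect (fun i => f i) l]
  simp [add_assoc]
  ring

lemma prod_sym_even (f : ℕ → ℚ) (l : ℕ) :
    ∏ j ∈ Finset.range (2*l), f j = ∏ i ∈ Finset.range l, (f (l-1-i) * f (l+i)) := by
  rw [show 2*l = l+l by ring, Finset.prod_range_add, Finset.prod_mul_distrib,
    Finset.prod_range_reflect (fun i => f i) l]

lemma SD_three {l : ℕ} (hl : p = 4*l+3) :
    SD (2*l+1) = (2*(p:ℚ)-1) * ∏ t ∈ Finset.range l, (((p:ℚ)^2-4*(2*(t:ℚ)+1)^2)/((p:ℚ)^2-16*((t:ℚ)+1)^2)) := by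
  have hpQ : (p:ℚ) = 4*l+3 := by rw [hl]; push_cast; ring
  have hp0 : (p:ℚ) ≠ 0 := by rw [hpQ]; positivity
  rw [SD_eval, Finset.prod_div_distrib, Finset.prod_range_succ, prod_sym_even, prod_sym_odd, Finset.prod_div_distrib]
  have e1 : ∏ i ∈ Finset.range l, ((4*((l-1-i:ℕ):ℚ)+5) * (4*((l+i:ℕ):ℚ)+5)) = ∏ t ∈ Finset.range l, ((p:ℚ)^2-4*(2*(t:ℚ)+1)^2) := by
    apply Finset.prod_congr rfl
    intro i hi
    simp at hi
    have : ((l-1-i:ℕ):ℚ) = l-1-i := by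
      rw [Nat.cast_sub (by omega), Nat.cast_sub (by omega)]; simp
    rw [this, hpQ]; push_cast; ring
  have e2 : ∏ i ∈ Finset.range l, ((4*((l-1-i:ℕ):ℚ)+3) * (4*((l+1+i:ℕ):ℚ)+3)) = ∏ t ∈ Finset.range l, ((p:ℚ)^2-16*((t:ℚ)+1)^2) := by
    apply Finset.prod_congr rfl
    intro i hi
    simp at hi
    have : ((l-1-i:ℕ):ℚ) = l-1-i := by
      rw [Nat.cast_sub (by omega), Nat.cast_sub (by omega)]; simp
    rw [this, hpQ]; push_cast; ring
  rw [e1, e2, ← hpQ]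
  rw [show 2*((2*l+1:ℕ):ℚ)+1 = p by rw [hpQ]; push_cast; ring, show 4*((2*l:ℕ):ℚ)+5 = 2*p-1 by rw [hpQ]; push_cast; ring]
  rw [mul_div_assoc', mul_div_mul_left _ _ hp0]
  ring

lemma W_eq (l : ℕ) : ∏ t ∈ Finset.range l, (((2*(t:ℚ)+1)/(2*(t:ℚ)+2))^2) = (l.centralBinom:ℚ)^2/16^l := by
  induction l with
  | zero => simp
  | succ l ih =>
    rw [Finset.prod_range_succ, ih]
    have h := cb_succ l
    have : (l:ℚ)+1 ≠ 0 := by positivity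
    have h3 : ((l+1).centralBinom:ℚ) = 4 * ((2*(l:ℚ)+1)/(2*l+2)) * l.centralBinom := by
      have h3 : 2*(l:ℚ)+2 ≠ 0 := by positivity
      rw [mul_div_assoc', div_mul_eq_mul_div, eq_div_iff h3]
      linear_combination 2 * h
    rw [h3, pow_succ (16:ℚ)]; field_simp; ring

lemma two_pow_fermat (hp2 : p ≠ 2) : ∃ w : ℤ, (2:ℚ)^(p-1) = 1 + p * w := by
  have h2 : (2 : ZMod p) ≠ 0 := by
    intro h
    have : ((2:ℕ):ZMod p) = 0 := by simpa using h
    rw [ZMod.natCast_eq_zero_iff] at this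
    have := Nat.le_of_dvd (by norm_num) this
    have := hp.out.two_le
    omega
  have := ZMod.pow_card_sub_one_eq_one h2
  have h3 : (((2:ℤ)^(p-1) - 1 : ℤ) : ZMod p) = 0 := by push_cast; rw [this, sub_self]
  rw [ZMod.intCast_zmod_eq_zero_iff_dvd] at h3
  obtain ⟨w, hw⟩ := h3
  refine ⟨w, ?_⟩
  have : ((2:ℤ)^(p-1) : ℚ) = 1 + p * w := by exact_mod_cast (by linarith : (2:ℤ)^(p-1) = 1 + p*w)
  simpa using this

lemma X0_three {l : ℕ} (hl : p = 4*l+3) : Cg p 2 (X0 (2*l+1))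
    (-((2*(p:ℚ) + 2 - 2^(p-1)) * (((2*l+1).choose l : ℕ) : ℚ)^2)) := by
  have hp2 : p ≠ 2 := by omega
  have hpQ : (p:ℚ) = 4*l+3 := by rw [hl]; push_cast; ring
  refine (X0_mod2 (p := p) (n := 2*l+1) (by omega)).trans ?_
  rw [SD_three hl]
  have h1 : Cg p 2 (∏ t ∈ Finset.range l, (((p:ℚ)^2-4*(2*(t:ℚ)+1)^2)/((p:ℚ)^2-16*((t:ℚ)+1)^2)))
      (∏ t ∈ Finset.range l, (((2*(t:ℚ)+1)/(2*(t:ℚ)+2))^2)) := by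
    have hD : ∀ t < l, ((p:ℚ)^2-16*((t:ℚ)+1)^2)⁻¹ ∈ Ip p := by
      intro t ht
      have := inv_mem (p := p) (k := (p:ℤ)^2-16*((t:ℤ)+1)^2) ?_
      · push_cast at this; exact this
      · intro hd
        have h1 : (p:ℤ) ∣ (4*((t:ℤ)+1))^2 := by
          have := dvd_sub (Dvd.intro_left (p:ℤ) (by ring) : (p:ℤ) ∣ (p:ℤ)^2) hd
          rwa [show (p:ℤ)^2 - ((p:ℤ)^2-16*((t:ℤ)+1)^2) = (4*((t:ℤ)+1))^2 by ring] at this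
        have h2 := Int.Prime.dvd_pow' hp.out h1
        have h3 : p ∣ 4*(t+1) := by exact_mod_cast h2
        have := Nat.le_of_dvd (by omega) h3
        omega
    have hV : ∀ t < l, (2*(t:ℚ)+2)⁻¹ ∈ Ip p := by
      intro t ht
      have := inv_mem_lt (p := p) (k := 2*t+2) (by omega) (by omega)
      push_cast at this; exact this
    have hN : ∀ t : ℕ, (2*(t:ℚ)+1) ∈ Ip p := by
      intro t
      have := nat_mem (p := p) (2*t+1)
      push_cast at this; exact this
    have h4 : (4:ℚ) ∈ Ip p := by exact_mod_cast nat_mem (p := p) 4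
    apply Cg.prod
    · intro t ht
      rw [div_eq_mul_inv]
      exact mul_mem (sub_mem (pow_mem p_mem _) (mul_mem h4 (pow_mem (hN t) _))) (hD t ht)
    · intro t ht
      rw [div_eq_mul_inv]
      exact pow_mem (mul_mem (hN t) (hV t ht)) _
    · intro t ht
      refine ⟨(1 - ((2*(t:ℚ)+1) * (2*(t:ℚ)+2)⁻¹)^2) * ((p:ℚ)^2-16*((t:ℚ)+1)^2)⁻¹, ?_, ?_⟩
      · exact mul_mem (sub_mem (one_mem _) (pow_mem (mul_mem (hN t) (hV t ht)) _)) (hD t ht)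
      · have hD0 : ((p:ℚ)^2-16*((t:ℚ)+1)^2) ≠ 0 := by
          have htl : (t:ℚ) + 1 ≤ l := by exact_mod_cast ht
          rw [hpQ]
          have : (0:ℚ) ≤ t := by positivity
          nlinarith
        have hv0 : 2*(t:ℚ)+2 ≠ 0 := by positivity
        field_simp
        ring
  have h2p : (2*(p:ℚ)-1) ∈ Ip p := by
    have := int_mem (p := p) (2*p-1)
    push_cast at this; exact this
  refine (h1.mul_left h2p).trans ?_
  rw [W_eq]
  obtain ⟨w, hw⟩ := two_pow_fermat (p := p) hp2
  have h16 : (16:ℚ)^l = 2^(p-1)/4 := by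
    rw [show p - 1 = 4*l+2 by omega, pow_add, pow_mul]; norm_num
  have hch : (((2*l+1).choose l : ℕ) : ℚ) * (p+1) = 2*(p-1) * l.centralBinom := by
    have h1 : (2*l+1).choose l = (2*l+1).choose (l+1) := by
      rw [← Nat.choose_symm_of_eq_add]; ring
    have h2 := Nat.add_one_mul_choose_eq (2*l) l
    have h3 : (((2*l+1).choose l : ℕ) : ℚ) * (l+1) = (2*l+1) * l.centralBinom := by
      rw [Nat.centralBinom]
      rw [h1]; exact_mod_cast h2.symm
    rw [hpQ]; linear_combination 4 * h3
  have hpp : (p:ℚ)+1 ≠ 0 := by positivity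
  have hch' : (((2*l+1).choose l : ℕ) : ℚ) = 2*(p-1) * l.centralBinom * ((p:ℚ)+1)⁻¹ := by
    rw [← hch]; field_simp
  have hq0 : (2:ℚ)^(p-1) ≠ 0 := by positivity
  have hpi : ((p:ℚ)+1)⁻¹ ∈ Ip p := by
    have := inv_mem_nat (p := p) (k := p+1) ?_
    · push_cast at this; exact this
    · intro h
      have := (Nat.dvd_add_right (dvd_refl p)).1 h
      exact hp.out.one_lt.ne' (Nat.dvd_one.1 this)
  rw [hch', h16]
  refine ⟨4*(l.centralBinom:ℚ)^2 * ((2:ℚ)^(p-1))⁻¹ * (((p:ℚ)+1)⁻¹)^2 * (4*p + w*(2-w)*((p:ℚ)-1)^2), ?_, ?_⟩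
  · have h4 : (4:ℚ) ∈ Ip p := by exact_mod_cast nat_mem (p := p) 4
    have h2 : (2:ℚ) ∈ Ip p := by exact_mod_cast nat_mem (p := p) 2
    refine mul_mem (mul_mem (mul_mem (mul_mem h4 (pow_mem (nat_mem _) 2)) (two_pow_inv_mem hp2 _)) (pow_mem hpi 2)) ?_
    exact add_mem (mul_mem h4 p_mem) (mul_mem (mul_mem (int_mem w) (sub_mem h2 (int_mem w))) (pow_mem (sub_mem p_mem (one_mem _)) 2))
  · generalize (2:ℚ)^(p-1) = q at *
    subst hw
    field_simp
    ring
end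
end S18

namespace S18
section
variable {p : ℕ} [hp : Fact p.Prime]

lemma norm_unit {b : ℚ} (hb : b ∈ Ip p) (hbi : b⁻¹ ∈ Ip p) (hb0 : b ≠ 0) : padicNorm p b = 1 := by
  have h1 : padicNorm p b ≤ 1 := hb
  have h2 : padicNorm p b⁻¹ ≤ 1 := hbi
  have h3 : padicNorm p b * padicNorm p b⁻¹ = 1 := by
    rw [← padicNorm.mul, mul_inv_cancel₀ hb0, padicNorm.one]
  have h4 := padicNorm.nonneg (p := p) b
  nlinarith

lemma inv_of_Cg {a b : ℚ} (hb : b ∈ Ip p) (hbi : b⁻¹ ∈ Ip p) (hb0 : b ≠ 0) (h : Cg p 1 a b) :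
    a ≠ 0 ∧ a⁻¹ ∈ Ip p := by
  obtain ⟨c, hc, e⟩ := h
  have h1 := norm_unit hb hbi hb0
  have h2 : padicNorm p ((p:ℚ)*c) < 1 := by
    rw [padicNorm.mul]
    have h3 : padicNorm p (p:ℚ) < 1 := padicNorm.padicNorm_p_lt_one_of_prime
    have h4 : padicNorm p c ≤ 1 := hc
    have := padicNorm.nonneg (p := p) (p:ℚ)
    have := padicNorm.nonneg (p := p) c
    nlinarith
  have ea : a = b + p * c := by linear_combination e
  have h5 : padicNorm p a = 1 := by
    rw [ea, padicNorm.add_eq_max_of_ne (by rw [h1]; exact h2.ne'), h1, max_eq_left h2.le]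
  have ha0 : a ≠ 0 := by rintro rfl; simp at h5
  refine ⟨ha0, ?_⟩
  change padicNorm p a⁻¹ ≤ 1
  have h3 : padicNorm p a * padicNorm p a⁻¹ = 1 := by
    rw [← padicNorm.mul, mul_inv_cancel₀ ha0, padicNorm.one]
  rw [h5, one_mul] at h3
  exact h3.le

/-- truncated exponential -/
def EE (p : ℕ) (a b : ℚ) : ℚ := 1 + p*a + (p:ℚ)^2*((a^2-b)/2)

/-- `u ≡ EE a b` mod `p^3` -/
def Ex (p : ℕ) [Fact p.Prime] (u a b : ℚ) : Prop := a ∈ Ip p ∧ b ∈ Ip p ∧ Cg p 3 u (EE p a b)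

lemma half_mem (hp2 : p ≠ 2) {a : ℚ} (ha : a ∈ Ip p) : a/2 ∈ Ip p := by
  rw [div_eq_mul_inv]; exact mul_mem ha (two_inv_mem hp2)

lemma EE_mem (hp2 : p ≠ 2) {a b : ℚ} (ha : a ∈ Ip p) (hb : b ∈ Ip p) : EE p a b ∈ Ip p :=
  add_mem (add_mem (one_mem _) (mul_mem p_mem ha)) (mul_mem (pow_mem p_mem 2) (half_mem hp2 (sub_mem (pow_mem ha 2) hb)))

lemma Ex.mem (hp2 : p ≠ 2) {u a b : ℚ} (h : Ex p u a b) : u ∈ Ip p := h.2.2.mem (EE_mem hp2 h.1 h.2.1)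

lemma EE_mul (hp2 : p ≠ 2) {a b a' b' : ℚ} (ha : a ∈ Ip p) (hb : b ∈ Ip p) (ha' : a' ∈ Ip p) (hb' : b' ∈ Ip p) :
    Cg p 3 (EE p a b * EE p a' b') (EE p (a+a') (b+b')) := by
  have hc := half_mem hp2 (sub_mem (pow_mem ha 2) hb)
  have hc' := half_mem hp2 (sub_mem (pow_mem ha' 2) hb')
  refine ⟨a * ((a'^2-b')/2) + a' * ((a^2-b)/2) + p * (((a^2-b)/2) * ((a'^2-b')/2)), ?_, ?_⟩
  · exact add_mem (add_mem (mul_mem ha hc') (mul_mem ha' hc)) (mul_mem p_mem (mul_mem hc hc'))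
  · unfold EE; ring

lemma Ex.mul (hp2 : p ≠ 2) {u v a b a' b' : ℚ} (h : Ex p u a b) (h' : Ex p v a' b') : Ex p (u*v) (a+a') (b+b') :=
  ⟨add_mem h.1 h'.1, add_mem h.2.1 h'.2.1,
    (Cg.mul (h.mem hp2) (EE_mem hp2 h'.1 h'.2.1) h.2.2 h'.2.2).trans (EE_mul hp2 h.1 h.2.1 h'.1 h'.2.1)⟩

lemma Ex.one : Ex p 1 0 0 := ⟨zero_mem _, zero_mem _, Cg.of_eq (by simp [EE])⟩

lemma Ex.cancel (hp2 : p ≠ 2) {u v w a b a' b' : ℚ} (h : Ex p u a b) (h' : Ex p v a' b') (hw : w ∈ Ip p)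
    (e : w * v = u) : Ex p w (a-a') (b-b') := by
  refine ⟨sub_mem h.1 h'.1, sub_mem h.2.1 h'.2.1, ?_⟩
  have hn : Ex p (EE p (-a') (-b')) (-a') (-b') := ⟨neg_mem h'.1, neg_mem h'.2.1, Cg.refl _ _⟩
  have h1 := (h.mul hp2 hn).2.2
  have h2 := (h'.mul hp2 hn).2.2
  have h3 := h2.mul_left hw
  rw [← mul_assoc, e] at h3
  have h4 : w * EE p (a' + -a') (b' + -b') = w := by simp [EE]
  rw [h4] at h3
  rw [sub_eq_add_neg, sub_eq_add_neg]
  exact h3.symm.trans h1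

lemma Ex.congr_b (hp2 : p ≠ 2) {u a b b' : ℚ} (h : Ex p u a b) (hb' : b' ∈ Ip p) (hb : Cg p 1 b b') : Ex p u a b' := by
  refine ⟨h.1, hb', h.2.2.trans ?_⟩
  obtain ⟨c, hc, e⟩ := hb
  refine ⟨-(c/2), neg_mem (half_mem hp2 hc), ?_⟩
  unfold EE
  linear_combination -(p:ℚ)^2/2 * e

lemma Ex.prod (hp2 : p ≠ 2) (f : ℕ → ℚ) (k : ℕ) (hf : ∀ j < k, f j ∈ Ip p) :
    Ex p (∏ j ∈ Finset.range k, (1 + p * f j)) (∑ j ∈ Finset.range k, f j) (∑ j ∈ Finset.range k, f j ^2) := by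
  induction k with
  | zero => simpa using Ex.one
  | succ k ih =>
    rw [Finset.prod_range_succ, Finset.sum_range_succ, Finset.sum_range_succ]
    refine (ih (fun j hj => hf j (by omega))).mul hp2 ⟨hf k (by omega), pow_mem (hf k (by omega)) 2, Cg.of_eq ?_⟩
    unfold EE; ring

lemma Ex.eq {u u' a a' b b' : ℚ} (h : Ex p u a b) (h1 : u' = u) (h2 : a' = a) (h3 : b' = b) : Ex p u' a' b' := by
  subst h1 h2 h3; exact h

/-- harmonic numbers -/
def s1 (k : ℕ) : ℚ := ∑ i ∈ Finset.range k, 1/((i:ℚ)+1)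
/-- harmonic numbers of order two -/
def s2 (k : ℕ) : ℚ := ∑ i ∈ Finset.range k, 1/((i:ℚ)+1)^2

lemma iv_mem {i : ℕ} (hi : i + 1 < p) : 1/((i:ℚ)+1) ∈ Ip p := by
  have := inv_mem_lt (p := p) (k := i+1) (by omega) hi
  push_cast at this
  rw [one_div]; exact this

lemma s1_mem {k : ℕ} (hk : k < p) : s1 k ∈ Ip p := sum_mem fun i hi => iv_mem (by simp at hi; omega)
lemma s2_mem {k : ℕ} (hk : k < p) : s2 k ∈ Ip p := sum_mem fun i hi => by
  rw [← one_div_pow]; exact pow_mem (iv_mem (by simp at hi; omega)) 2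

lemma s2_Bk (k : ℕ) : Bk k = s2 k / 4 := by
  unfold Bk s2
  rw [Finset.sum_div]
  apply Finset.sum_congr rfl
  intro i _
  have : (i:ℚ)+1 ≠ 0 := by positivity
  have h : 2*(i:ℚ)+2 ≠ 0 := by positivity
  field_simp; ring

lemma four_mem : (4:ℚ) ∈ Ip p := by exact_mod_cast nat_mem (p := p) 4

lemma s2_zero {m : ℕ} (hm : p = 4*m+1) : Cg p 1 (s2 (2*m)) 0 := by
  have hp3 : p ≠ 3 := by omega
  have h := (Bn_zero (p := p) (n := 2*m) (by omega) hp3).mul_left four_mem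
  rw [s2_Bk] at h
  exact (Cg.of_eq (by ring)).trans (h.trans (Cg.of_eq (by ring)))

/-- `∏ (1 + c p/(i+1))` -/
lemma Ex_s (hp2 : p ≠ 2) (c : ℚ) (hc : c ∈ Ip p) {k : ℕ} (hk : k < p) :
    Ex p (∏ i ∈ Finset.range k, (1 + p * (c * (1/((i:ℚ)+1))))) (c * s1 k) (c^2 * s2 k) := by
  have := Ex.prod hp2 (fun i => c * (1/((i:ℚ)+1))) k (fun j hj => mul_mem hc (iv_mem (by omega)))
  refine this.eq rfl ?_ ?_
  · unfold s1; rw [Finset.mul_sum]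
  · unfold s2; rw [Finset.mul_sum]; apply Finset.sum_congr rfl; intros; rw [mul_pow, one_div_pow]

lemma Ex_s2m {m : ℕ} (hm : p = 4*m+1) (c : ℚ) (hc : c ∈ Ip p) :
    Ex p (∏ i ∈ Finset.range (2*m), (1 + p * (c * (1/((i:ℚ)+1))))) (c * s1 (2*m)) 0 := by
  have hp2 : p ≠ 2 := by omega
  refine (Ex_s hp2 c hc (by omega)).congr_b hp2 (zero_mem _) ?_
  have := (s2_zero hm).mul_left (pow_mem hc 2)
  simpa using this

/-- `∏ (1 + c p/(m+1+i))` -/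
lemma Ex_h {m : ℕ} (hm : p = 4*m+1) (c : ℚ) (hc : c ∈ Ip p) :
    Ex p (∏ i ∈ Finset.range m, (1 + p * (c * (1/((m+i:ℕ)+1))))) (c * (s1 (2*m) - s1 m)) (-(c^2 * s2 m)) := by
  have hp2 : p ≠ 2 := by omega
  have h1 := Ex_s2m hm c hc
  have h2 := Ex_s hp2 c hc (k := m) (by omega)
  refine (Ex.cancel hp2 h1 h2 ?_ ?_).eq rfl (by ring) (by ring)
  · refine prod_mem fun i hi => ?_
    simp at hi
    exact add_mem (one_mem _) (mul_mem p_mem (mul_mem hc (iv_mem (by omega))))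
  · rw [show 2*m = m+m by ring, Finset.prod_range_add, mul_comm]

lemma choose_prod (N k : ℕ) (hk : k ≤ N) : (N.choose k : ℚ) = ∏ i ∈ Finset.range k, (((N:ℚ)-i)/((i:ℚ)+1)) := by
  induction k with
  | zero => simp
  | succ k ih =>
    rw [Finset.prod_range_succ, ← ih (by omega)]
    have h := Nat.choose_succ_right_eq N k
    have h2 : (N.choose (k+1) : ℚ) * (k+1) = N.choose k * ((N:ℚ)-k) := by
      rw [← Nat.cast_sub (by omega : k ≤ N)]; exact_mod_cast h
    have : (k:ℚ)+1 ≠ 0 := by positivity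
    field_simp
    linarith

lemma prod_neg_even (f : ℕ → ℚ) (m : ℕ) : ∏ i ∈ Finset.range (2*m), (-f i) = ∏ i ∈ Finset.range (2*m), f i := by
  rw [Finset.prod_neg]; simp

lemma choose_p {m : ℕ} (hm : p = 4*m+1) :
    ((4*m).choose (2*m) : ℚ) = ∏ i ∈ Finset.range (2*m), (1 + p * ((-1) * (1/((i:ℚ)+1)))) := by
  rw [choose_prod _ _ (by omega), ← prod_neg_even]
  apply Finset.prod_congr rfl
  intro i _
  have : (i:ℚ)+1 ≠ 0 := by positivity
  rw [hm]; push_cast; field_simp; ring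

lemma cb_prod (l : ℕ) : (l.centralBinom : ℚ) = 4^l * ∏ t ∈ Finset.range l, ((2*(t:ℚ)+1)/(2*(t:ℚ)+2)) := by
  induction l with
  | zero => simp
  | succ l ih =>
    have h := cb_succ l
    have h3 : ((l+1).centralBinom:ℚ) = 4 * ((2*(l:ℚ)+1)/(2*l+2)) * l.centralBinom := by
      have h3 : 2*(l:ℚ)+2 ≠ 0 := by positivity
      rw [mul_div_assoc', div_mul_eq_mul_div, eq_div_iff h3]
      linear_combination 2 * h
    rw [Finset.prod_range_succ, h3, ih]; ring

lemma sixteen1 {m : ℕ} (hm : p = 4*m+1) : Ex p (16^m) (-(s1 (2*m)/2)) 0 := by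
  have hp2 : p ≠ 2 := by omega
  have h1 := Ex_s2m hm (-1) (neg_mem (one_mem _))
  have hh : -(1/2:ℚ) ∈ Ip p := neg_mem (by rw [one_div]; exact two_inv_mem hp2)
  have h2 := Ex_s2m hm (-(1/2)) hh
  refine (Ex.cancel (w := (16:ℚ)^m) hp2 h1 h2 (by exact_mod_cast nat_mem (p := p) (16^m)) ?_).eq rfl (by ring) (by ring)
  rw [← choose_p hm, show 4*m = 2*(2*m) by ring, ← Nat.centralBinom_eq_two_mul_choose, cb_prod, pow_mul]
  rw [show (4:ℚ)^2 = 16 by norm_num]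
  congr 1
  rw [← prod_neg_even, Finset.prod_div_distrib (f := fun t : ℕ => 2*(t:ℚ)+1), ← Finset.prod_range_reflect (fun t : ℕ => 2*(t:ℚ)+1), ← Finset.prod_div_distrib]
  apply Finset.prod_congr rfl
  intro i hi
  simp at hi
  have : (i:ℚ)+1 ≠ 0 := by positivity
  have h0 : 2*(i:ℚ)+2 ≠ 0 := by positivity
  have : ((2*m-1-i:ℕ):ℚ) = 2*m-1-i := by
      rw [Nat.cast_sub (by omega), Nat.cast_sub (by omega)]; simp
  rw [this, hm]; push_cast; field_simp; ring

lemma prod_pairs (f : ℕ → ℚ) (m : ℕ) : ∏ i ∈ Finset.range (2*m), f i = ∏ j ∈ Finset.range m, (f (2*j) * f (2*j+1)) := by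
  induction m with
  | zero => simp
  | succ m ih => rw [show 2*(m+1) = 2*m+1+1 by ring, Finset.prod_range_succ, Finset.prod_range_succ, ih, Finset.prod_range_succ]; ring

lemma minus_four {m : ℕ} (hm : p = 4*m+1) : Ex p ((-4)^m) (-(s1 (2*m)) + s1 m/2) (-(s2 m/4)) := by
  have hp2 : p ≠ 2 := by omega
  have h1 := Ex_s2m hm (-1) (neg_mem (one_mem _))
  have hh : -(1/2:ℚ) ∈ Ip p := neg_mem (by rw [one_div]; exact two_inv_mem hp2)
  have h2 := Ex_s hp2 (-(1/2)) hh (k := m) (by omega)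
  refine (Ex.cancel (w := (-4:ℚ)^m) hp2 h1 h2 (pow_mem (neg_mem four_mem) m) ?_).eq rfl (by ring) (by ring)
  have e1 : ∏ i ∈ Finset.range (2*m), (1 + (p:ℚ) * ((-1) * (1/((i:ℚ)+1)))) = (∏ i ∈ Finset.range (2*m), ((p:ℚ)-1-i)) / ∏ i ∈ Finset.range (2*m), ((i:ℚ)+1) := by
    rw [← Finset.prod_div_distrib, ← prod_neg_even]
    apply Finset.prod_congr rfl
    intro i hi
    have : (i:ℚ)+1 ≠ 0 := by positivity
    field_simp; ring
  have e2 : ∏ i ∈ Finset.range (2*m), ((i:ℚ)+1) = (∏ i ∈ Finset.range m, ((i:ℚ)+1)) * ∏ i ∈ Finset.range m, (2*(m:ℚ)-i) := by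
    rw [show 2*m = m+m by ring, Finset.prod_range_add]
    congr 1
    rw [← Finset.prod_range_reflect]
    apply Finset.prod_congr rfl
    intro i hi
    simp at hi
    have : ((m-1-i:ℕ):ℚ) = m-1-i := by
      rw [Nat.cast_sub (by omega), Nat.cast_sub (by omega)]; simp
    push_cast
    rw [this]; ring
  have h0 : ∏ i ∈ Finset.range (2*m), ((i:ℚ)+1) ≠ 0 := Finset.prod_ne_zero_iff.2 fun i _ => by positivity
  rw [e1, prod_pairs, eq_div_iff h0, e2, ← Finset.prod_mul_distrib, ← Finset.card_range m, ← Finset.prod_const, Finset.card_range, ← Finset.prod_mul_distrib,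
    ← Finset.prod_mul_distrib]
  apply Finset.prod_congr rfl
  intro i hi
  have : (i:ℚ)+1 ≠ 0 := by positivity
  rw [hm]; push_cast; field_simp; ring

lemma sixteen {m : ℕ} (hm : p = 4*m+1) : Ex p (16^m) (s1 (2*m) - s1 m) (s2 m/2) := by
  have hp2 : p ≠ 2 := by omega
  have h1 := sixteen1 hm
  have h2 := minus_four hm
  refine (Ex.cancel hp2 (h1.mul hp2 h1) (h2.mul hp2 h2) (by exact_mod_cast nat_mem (p := p) (16^m)) ?_).eq rfl (by ring) (by ring)
  rw [← mul_pow (-4:ℚ)]; norm_num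

lemma S0_one {m : ℕ} (hm : p = 4*m+1) :
    Cg p 3 (S0 (2*m)) ((m.centralBinom:ℚ)^2 * EE p (-(s1 (2*m) - s1 m)) (-(s2 m/4))) := by
  have hp2 : p ≠ 2 := by omega
  have hp3 : p ≠ 3 := by omega
  have hn : p = 2*(2*m)+1 := by omega
  refine (S0_mod3 hn (by simp) hp3).trans ?_
  rw [TW_even _ (by
    intro j h
    have : (0:ℚ) < ((j:ℚ)+1)^2 + (p:ℚ)^2/4 := by positivity
    linarith)]
  have h4i : (4:ℚ)⁻¹ ∈ Ip p := by
    have := two_pow_inv_mem (p := p) hp2 2; rwa [show (2:ℚ)^2 = 4 by norm_num] at this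
  have ua : ∀ j < m, 1/(2*(j:ℚ)+1)^2/4 ∈ Ip p := fun j hj => by
    rw [div_eq_mul_inv _ (4:ℚ)]; exact mul_mem (a_mem hn (by omega)) h4i
  have ub : ∀ j < m, 1/(2*(j:ℚ)+2)^2/4 ∈ Ip p := fun j hj => by
    rw [div_eq_mul_inv _ (4:ℚ)]; exact mul_mem (b_mem hn (by omega)) h4i
  have hA := Ak_mem (p := p) hn (k := m) (by omega)
  have hB := Bk_mem (p := p) hn (k := m) (by omega)
  have hu : Ex p (∏ j ∈ Finset.range m, (1 + (p:ℚ)^2 * (1/(2*(j:ℚ)+1)^2/4))) 0 (-(Ak m/2)) := by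
    refine ⟨zero_mem _, neg_mem (half_mem hp2 hA), (prod_p2 _ m ua).trans (Cg.of_eq ?_)⟩
    rw [← Finset.sum_div]; unfold EE Ak; ring
  have hv : Ex p (∏ j ∈ Finset.range m, (1 + (p:ℚ)^2 * (1/(2*(j:ℚ)+2)^2/4))) 0 (-(Bk m/2)) := by
    refine ⟨zero_mem _, neg_mem (half_mem hp2 hB), (prod_p2 _ m ub).trans (Cg.of_eq ?_)⟩
    rw [← Finset.sum_div]; unfold EE Bk; ring
  set u := ∏ j ∈ Finset.range m, (1 + (p:ℚ)^2 * (1/(2*(j:ℚ)+1)^2/4)) with hud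
  set v := ∏ j ∈ Finset.range m, (1 + (p:ℚ)^2 * (1/(2*(j:ℚ)+2)^2/4)) with hvd
  have hw : ∏ i ∈ Finset.range m, (((2*(i:ℚ)+1)^2-(-(p:ℚ)^2/4))/((2*(i:ℚ)+2)^2-(-(p:ℚ)^2/4)))
      = (m.centralBinom:ℚ)^2 * ((16^m)⁻¹ * (u * v⁻¹)) := by
    rw [← mul_assoc, ← div_eq_mul_inv, ← W_eq, hud, hvd, ← Finset.prod_inv_distrib, ← Finset.prod_mul_distrib, ← Finset.prod_mul_distrib]
    apply Finset.prod_congr rfl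
    intro i _
    have h1 : (2*(i:ℚ)+2)^2-(-(p:ℚ)^2/4) ≠ 0 := by
      have : (0:ℚ) < (2*(i:ℚ)+2)^2 + (p:ℚ)^2/4 := by positivity
      intro h; linarith
    have h2 : 2*(i:ℚ)+1 ≠ 0 := by positivity
    have h3 : 2*(i:ℚ)+2 ≠ 0 := by positivity
    have h4 : 1 + (p:ℚ)^2 * (1/(2*(i:ℚ)+2)^2/4) ≠ 0 := by positivity
    have h5 : (2*(i:ℚ)+2)^2-(-(p:ℚ)^2/4) = (2*(i:ℚ)+2)^2 * (1 + (p:ℚ)^2 * (1/(2*(i:ℚ)+2)^2/4)) := by field_simp; ring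
    have h6 : (2*(i:ℚ)+1)^2-(-(p:ℚ)^2/4) = (2*(i:ℚ)+1)^2 * (1 + (p:ℚ)^2 * (1/(2*(i:ℚ)+1)^2/4)) := by field_simp; ring
    rw [h5, h6, div_pow, ← div_eq_mul_inv, mul_div_mul_comm]
  rw [hw]
  have hv0 : v ≠ 0 := Finset.prod_ne_zero_iff.2 fun i _ => by positivity
  have hvi : v⁻¹ ∈ Ip p := by
    rw [hvd, ← Finset.prod_inv_distrib]
    refine prod_mem fun j hj => ?_
    simp at hj
    refine (inv_of_Cg (b := 1) (one_mem _) (by simp) one_ne_zero ⟨p * (1/(2*(j:ℚ)+2)^2/4), mul_mem p_mem (ub j hj), ?_⟩).2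
    ring
  have h16i : ((16:ℚ)^m)⁻¹ ∈ Ip p := by
    have := two_pow_inv_mem hp2 (4*m); rwa [pow_mul, show (2:ℚ)^4 = 16 by norm_num] at this
  have huv : Ex p (u * v⁻¹) (0-0) (-(Ak m/2) - -(Bk m/2)) :=
    Ex.cancel hp2 hu hv (mul_mem (hu.mem hp2) hvi) (by field_simp)
  have h16 : Ex p ((16^m)⁻¹) (0 - (s1 (2*m) - s1 m)) (0 - s2 m/2) :=
    Ex.cancel hp2 Ex.one (sixteen hm) h16i (by field_simp)
  have hAB : Cg p 1 (Ak m) (-Bk m) := by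
    refine (Ak_symm hn m (by omega)).trans ?_
    rw [show 2*m - m = m by omega]
    exact ((Bn_zero hn hp3).sub (Cg.refl _ (Bk m))).trans (Cg.of_eq (by ring))
  have hfin := h16.mul hp2 huv
  have hK := s2_mem (p := p) (k := m) (by omega)
  have hK4 : s2 m/4 ∈ Ip p := by rw [div_eq_mul_inv]; exact mul_mem hK h4i
  have := (hfin.congr_b hp2 (b' := -(s2 m/4)) (neg_mem hK4) ?_).2.2
  · refine (this.mul_left (pow_mem (nat_mem _) 2)).trans (Cg.of_eq ?_)
    rw [show (0 - (s1 (2 * m) - s1 m) + (0 - 0)) = -(s1 (2 * m) - s1 m) by ring]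
  · have h7 := (hAB.mul_right (two_inv_mem hp2)).neg
    refine ((Cg.refl 1 (-(s2 m/2) + Bk m/2)).add h7).trans (Cg.of_eq ?_) |> (Cg.of_eq ?_).trans
    · ring
    · rw [s2_Bk]; ring
end
end S18

namespace S18
section
variable {p : ℕ} [hp : Fact p.Prime]

lemma choose_asc (N k : ℕ) (hk : k ≤ N) :
    (N.choose k : ℚ) * ∏ i ∈ Finset.range k, ((i:ℚ)+1) = ∏ i ∈ Finset.range k, ((N:ℚ)-k+1+i) := by
  rw [choose_prod N k hk, Finset.prod_div_distrib, div_mul_cancel₀ _ (Finset.prod_ne_zero_iff.2 fun i _ => by positivity),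
    ← Finset.prod_range_reflect]
  apply Finset.prod_congr rfl
  intro i hi
  simp at hi
  have : ((k-1-i:ℕ):ℚ) = k-1-i := by
    rw [Nat.cast_sub (by omega), Nat.cast_sub (by omega)]; simp
  rw [this]; ring

lemma prod_shift (x : ℚ) (m : ℕ) :
    (x+m) * ∏ i ∈ Finset.range m, (x+i) = x * ∏ i ∈ Finset.range m, (x+1+i) := by
  have h1 := Finset.prod_range_succ (fun i : ℕ => x + i) m
  have h2 := Finset.prod_range_succ' (fun i : ℕ => x + i) m
  rw [mul_comm, ← h1, h2, mul_comm]
  simp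
  left
  apply Finset.prod_congr rfl
  intros; ring

lemma fact_asc (n k : ℕ) : ((n+k).factorial : ℚ) = n.factorial * ∏ i ∈ Finset.range k, ((n:ℚ)+1+i) := by
  induction k with
  | zero => simp
  | succ k ih =>
    rw [← add_assoc, Nat.factorial_succ, Finset.prod_range_succ, ← mul_assoc, ← ih]; push_cast; ring

/-- `∏ (1 + c p/(m+1+i))` -/
def Hp (p m : ℕ) (c : ℚ) : ℚ := ∏ i ∈ Finset.range m, (1 + p * (c * (1/((m+i:ℕ)+1))))

lemma cb_Hp (m : ℕ) (c : ℚ) :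
    (m.centralBinom:ℚ) * Hp p m c * ∏ i ∈ Finset.range m, ((i:ℚ)+1) = ∏ i ∈ Finset.range m, (c*p+m+1+i) := by
  have h := choose_asc (2*m) m (by omega)
  rw [← Nat.centralBinom_eq_two_mul_choose] at h
  rw [mul_right_comm, h, Hp, ← Finset.prod_mul_distrib]
  apply Finset.prod_congr rfl
  intro i _
  have : (m:ℚ)+i+1 ≠ 0 := by positivity
  push_cast; field_simp; ring

lemma D_ne (m : ℕ) : ∏ i ∈ Finset.range m, ((i:ℚ)+1) ≠ 0 := Finset.prod_ne_zero_iff.2 fun i _ => by positivity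

lemma b6 {m : ℕ} (hm : p = 4*m+1) :
    ((6*m).choose m : ℚ) * (2*(3*p-1)) = m.centralBinom * (5*p-1) * Hp p m 1 := by
  have hpQ : (p:ℚ) = 4*m+1 := by rw [hm]; push_cast; ring
  apply mul_right_cancel₀ (D_ne m)
  have h1 := choose_asc (6*m) m (by omega)
  have h2 := cb_Hp (p := p) m 1
  have h3 := prod_shift ((p:ℚ)+m) m
  have h4 : ∏ i ∈ Finset.range m, (((6*m:ℕ):ℚ)-m+1+i) = ∏ i ∈ Finset.range m, ((p:ℚ)+m+i) := by
    apply Finset.prod_congr rfl; intros; rw [hpQ]; push_cast; ring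
  rw [h4] at h1
  rw [one_mul] at h2
  rw [← h1, ← h2] at h3
  rw [show 2*(3*(p:ℚ)-1) = 4*(p+m+m) by rw [hpQ]; ring, show (5*(p:ℚ)-1) = 4*(p+m) by rw [hpQ]; ring]
  linear_combination 4 * h3

lemma b10 {m : ℕ} (hm : p = 4*m+1) :
    ((10*m).choose m : ℚ) * (4*(5*p-1)*(5*p-3)) = m.centralBinom * ((9*p-5)*(9*p-1)) * Hp p m 2 := by
  have hpQ : (p:ℚ) = 4*m+1 := by rw [hm]; push_cast; ring
  apply mul_right_cancel₀ (D_ne m)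
  have h1 := choose_asc (10*m) m (by omega)
  have h2 := cb_Hp (p := p) m 2
  have h3 := prod_shift (2*(p:ℚ)+m) m
  have h5 := prod_shift (2*(p:ℚ)+m-1) m
  have h4 : ∏ i ∈ Finset.range m, (((10*m:ℕ):ℚ)-m+1+i) = ∏ i ∈ Finset.range m, (2*(p:ℚ)+m-1+i) := by
    apply Finset.prod_congr rfl; intros; rw [hpQ]; push_cast; ring
  rw [h4] at h1
  rw [show 2*(p:ℚ)+m-1+1 = 2*p+m by ring] at h5
  rw [← h2] at h3
  rw [← h1] at h5
  rw [show 4*(5*(p:ℚ)-1)*(5*p-3) = 16*((2*p+m-1+m)*(2*p+m+m)) by rw [hpQ]; ring,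
    show (9*(p:ℚ)-5)*(9*p-1) = 16*((2*p+m-1)*(2*p+m)) by rw [hpQ]; ring]
  linear_combination 16*(2*(p:ℚ)+m+m)* h5 + 16*(2*(p:ℚ)+m-1)*h3

lemma wol {m : ℕ} (hm : p = 4*m+1) : ∃ w : ℚ, ((2*p).choose p : ℚ) = 2*w ∧ Ex p w 0 0 := by
  have hp2 : p ≠ 2 := by omega
  have hpQ : (p:ℚ) = 4*m+1 := by rw [hm]; push_cast; ring
  refine ⟨∏ i ∈ Finset.range (2*(2*m)), (1 + (p:ℚ)/((i:ℚ)+1)), ?_, zero_mem _, zero_mem _, ?_⟩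
  · apply mul_right_cancel₀ (D_ne p)
    rw [choose_asc (2*p) p (by omega)]
    have e : p = 2*(2*m)+1 := by omega
    conv_lhs => rw [show Finset.range p = Finset.range (2*(2*m)+1) by rw [← e]]
    conv_rhs => rw [show Finset.range p = Finset.range (2*(2*m)+1) by rw [← e]]
    rw [Finset.prod_range_succ, Finset.prod_range_succ]
    have : ∏ i ∈ Finset.range (2*(2*m)), (((2*p:ℕ):ℚ)-p+1+i) = (∏ i ∈ Finset.range (2*(2*m)), (1 + (p:ℚ)/((i:ℚ)+1))) * ∏ i ∈ Finset.range (2*(2*m)), ((i:ℚ)+1) := by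
      rw [← Finset.prod_mul_distrib]
      apply Finset.prod_congr rfl
      intro i _
      have : (i:ℚ)+1 ≠ 0 := by positivity
      push_cast; field_simp; ring
    rw [this, hpQ]; push_cast; rw [hpQ]; ring
  · rw [prod_sym_even]
    have hc : ∀ i ∈ Finset.range (2*m), ((1 + (p:ℚ)/(((2*m-1-i:ℕ):ℚ)+1)) * (1 + (p:ℚ)/(((2*m+i:ℕ):ℚ)+1)))
      = 1 + (p:ℚ)^2 * (2 * (1/(((2*m-1-i:ℕ):ℚ)+1)) * (1/(((2*m+i:ℕ):ℚ)+1))) := by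
      intro i hi
      simp at hi
      have h1 : (((2*m-1-i:ℕ):ℚ)+1) ≠ 0 := by positivity
      have h2 : (((2*m+i:ℕ):ℚ)+1) ≠ 0 := by positivity
      have h3 : (p:ℚ) = (((2*m-1-i:ℕ):ℚ)+1) + (((2*m+i:ℕ):ℚ)+1) := by
        have : p = (2*m-1-i+1) + (2*m+i+1) := by omega
        exact_mod_cast this
      field_simp
      rw [h3]; ring
    rw [Finset.prod_congr rfl hc]
    have h2m : (2:ℚ) ∈ Ip p := by exact_mod_cast nat_mem (p := p) 2
    refine (prod_p2 _ _ ?_).trans ?_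
    · intro j hj
      exact mul_mem (mul_mem h2m (iv_mem (by omega))) (iv_mem (by omega))
    · have h1 : Cg p 1 (∑ i ∈ Finset.range (2*m), (2 * (1/(((2*m-1-i:ℕ):ℚ)+1)) * (1/(((2*m+i:ℕ):ℚ)+1))))
         (-2 * s2 (2*m)) := by
        have : -2 * s2 (2*m) = ∑ i ∈ Finset.range (2*m), -2 * (1/(((2*m-1-i:ℕ):ℚ)+1)^2) := by
          rw [s2, ← Finset.sum_range_reflect, Finset.mul_sum]
        rw [this]
        apply Cg.sum
        intro i hi
        simp at hi
        refine ⟨2 * (1/(((2*m-1-i:ℕ):ℚ)+1))^2 * (1/(((2*m+i:ℕ):ℚ)+1)), mul_mem (mul_mem h2m (pow_mem (iv_mem (by omega)) 2)) (iv_mem (by omega)), ?_⟩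
        have h1 : (((2*m-1-i:ℕ):ℚ)+1) ≠ 0 := by positivity
        have h2 : (((2*m+i:ℕ):ℚ)+1) ≠ 0 := by positivity
        have h3 : (p:ℚ) = (((2*m-1-i:ℕ):ℚ)+1) + (((2*m+i:ℕ):ℚ)+1) := by
          have : p = (2*m-1-i+1) + (2*m+i+1) := by omega
          exact_mod_cast this
        rw [h3]
        field_simp; ring
      have h2 := h1.trans ((s2_zero hm).mul_left (neg_mem h2m))
      have h3 := (Cg.refl 3 1).add (h2.mul_p 2)
      refine h3.trans (Cg.of_eq (by simp [EE]))

lemma b5 {m : ℕ} (hm : p = 4*m+1) : ∃ X : ℚ,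
    ((10*m).choose (5*m) : ℚ) * (2*(5*p-3)) = m.centralBinom * (5*p-1) * X ∧
    Ex p X (2 * (s1 (2*m) - s1 m)) (-(2 * s2 m)) := by
  have hp2 : p ≠ 2 := by omega
  have hpQ : (p:ℚ) = 4*m+1 := by rw [hm]; push_cast; ring
  obtain ⟨w, hw, hwE⟩ := wol hm
  have h2m : (2:ℚ) ∈ Ip p := by exact_mod_cast nat_mem (p := p) 2
  have hu := Ex_s2m hm 2 h2m
  have hv := Ex_s hp2 1 (one_mem (Ip p)) (k := m) (by omega)
  set u := ∏ i ∈ Finset.range (2*m), (1 + (p:ℚ) * (2 * (1/((i:ℚ)+1)))) with hud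
  set v := ∏ i ∈ Finset.range m, (1 + (p:ℚ) * (1 * (1/((i:ℚ)+1)))) with hvd
  have hv1 : Cg p 1 v 1 := by
    refine (hv.2.2.mono (by norm_num)).trans ⟨1 * s1 m + p * (((1*s1 m)^2 - 1^2*s2 m)/2), ?_, by unfold EE; ring⟩
    exact add_mem hv.1 (mul_mem p_mem (half_mem hp2 (sub_mem (pow_mem hv.1 2) hv.2.1)))
  obtain ⟨hv0, hvi⟩ := inv_of_Cg (one_mem _) (by simp) one_ne_zero hv1
  refine ⟨w * (u * (v⁻¹*v⁻¹)), ?_, ?_⟩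
  · have f1 := fact_asc (2*p) (2*m)
    have f2 := fact_asc p m
    have g1 : ∏ i ∈ Finset.range (2*m), (((2*p:ℕ):ℚ)+1+i) = u * (2*m).factorial := by
      have := fact_asc 0 (2*m)
      simp at this
      rw [this, hud, ← Finset.prod_mul_distrib]
      apply Finset.prod_congr rfl
      intro i _
      have : (i:ℚ)+1 ≠ 0 := by positivity
      have : 1+(i:ℚ) ≠ 0 := by positivity
      push_cast; field_simp; ring
    have g2 : ∏ i ∈ Finset.range m, ((p:ℚ)+1+i) = v * m.factorial := by
      have := fact_asc 0 m
      simp at this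
      rw [this, hvd, ← Finset.prod_mul_distrib]
      apply Finset.prod_congr rfl
      intro i _
      have : (i:ℚ)+1 ≠ 0 := by positivity
      have : 1+(i:ℚ) ≠ 0 := by positivity
      push_cast; field_simp; ring
    rw [g1, show 2*p+2*m = 10*m+1+1 by omega, Nat.factorial_succ, Nat.factorial_succ] at f1
    rw [g2, show p+m = 5*m+1 by omega, Nat.factorial_succ] at f2
    have c1 : ((10*m).choose (5*m) : ℚ) * (5*m).factorial * (5*m).factorial = (10*m).factorial := by
      have := Nat.choose_mul_factorial_mul_factorial (n := 10*m) (k := 5*m) (by omega)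
      rw [show 10*m-5*m = 5*m by omega] at this
      exact_mod_cast this
    have c2 : ((2*p).choose p : ℚ) * p.factorial * p.factorial = (2*p).factorial := by
      have := Nat.choose_mul_factorial_mul_factorial (n := 2*p) (k := p) (by omega)
      rw [show 2*p-p = p by omega] at this
      exact_mod_cast this
    have c3 : (m.centralBinom : ℚ) * m.factorial * m.factorial = (2*m).factorial := by
      have := Nat.choose_mul_factorial_mul_factorial (n := 2*m) (k := m) (by omega)
      rw [show 2*m-m = m by omega] at this
      rw [Nat.centralBinom_eq_two_mul_choose]
      exact_mod_cast this
    push_cast at f1 f2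
    rw [← c1, ← c2, ← c3, hw] at f1
    have hF : ((5*m).factorial:ℚ) ≠ 0 := by exact_mod_cast Nat.factorial_ne_zero _
    have hM : (m.factorial:ℚ) ≠ 0 := by exact_mod_cast Nat.factorial_ne_zero _
    have hP : (p.factorial:ℚ) ≠ 0 := by exact_mod_cast Nat.factorial_ne_zero _
    have h51 : 5*(m:ℚ)+1 ≠ 0 := by positivity
    generalize (p.factorial:ℚ) = Pf at *
    generalize ((5*m).factorial:ℚ) = Ff at *
    generalize (m.factorial:ℚ) = Mf at *
    generalize (m.centralBinom:ℚ) = cb at *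
    generalize ((10*m).choose (5*m) : ℚ) = X at *
    rw [show 2*(5*(p:ℚ)-3) = 4*(10*m+1) by rw [hpQ]; ring, show (5*(p:ℚ)-1) = 4*(5*m+1) by rw [hpQ]; ring]
    have hFf : Ff = Pf * v * Mf / (5*m+1) := by field_simp; linear_combination f2
    rw [hFf] at f1
    field_simp at f1 ⊢
    have : (10*(m:ℚ)+1+1) = 2*(5*m+1) := by ring
    first
      | linear_combination f1
      | (apply mul_left_cancel₀ h51; linear_combination f1)
      | (apply mul_left_cancel₀ h51; linear_combination f1/2)
  · have h1 := Ex.cancel (w := u * (v⁻¹*v⁻¹)) hp2 hu (hv.mul hp2 hv) (mul_mem (hu.mem hp2) (mul_mem hvi hvi)) (by field_simp)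
    exact (hwE.mul hp2 h1).eq rfl (by ring) (by ring)

lemma lin_inv_mem {a b : ℤ} (hb : ¬ (p:ℤ) ∣ b) : ((a:ℚ)*p+b) ≠ 0 ∧ ((a:ℚ)*p+b)⁻¹ ∈ Ip p := by
  refine inv_of_Cg (b := (b:ℚ)) (int_mem b) (inv_mem hb) ?_ ⟨a, int_mem a, by ring⟩
  rintro h
  have : b = 0 := by exact_mod_cast h
  exact hb (this ▸ dvd_zero _)

theorem Q_cong {m : ℕ} (hm : p = 4*m+1) :
    Cg p 3 ((1-(p:ℚ)) * TT m) (8 * (m.centralBinom * EE p (-(s1 (2*m) - s1 m)/2) (-(s2 m/8)))) := by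
  have hp2 : p ≠ 2 := by omega
  have hp5 : 5 ≤ p := by have := hp.out.two_le; omega
  have hk1 : ¬ (p:ℤ) ∣ -1 := by
    rw [Int.dvd_neg]; intro h; have := Int.le_of_dvd (by norm_num) h; omega
  have hk3 : ¬ (p:ℤ) ∣ -3 := by
    rw [Int.dvd_neg]; intro h; have := Int.le_of_dvd (by norm_num) h; omega
  obtain ⟨a0, a1⟩ := lin_inv_mem (p := p) (a := 3) hk1
  obtain ⟨b0, b1⟩ := lin_inv_mem (p := p) (a := 5) hk1
  obtain ⟨c0, c1⟩ := lin_inv_mem (p := p) (a := 5) hk3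
  push_cast at a0 a1 b0 b1 c0 c1
  obtain ⟨X3, hX3, eX3⟩ := b5 hm
  have hX1 := b6 hm
  have hX2 := b10 hm
  have eX1 := Ex_h hm 1 (one_mem _)
  have h2m : (2:ℚ) ∈ Ip p := by exact_mod_cast nat_mem (p := p) 2
  have eX2 := Ex_h hm 2 h2m
  rw [← Hp] at eX1 eX2
  generalize hX1d : Hp p m 1 = X1 at *
  generalize hX2d : Hp p m 2 = X2 at *
  set h := s1 (2*m) - s1 m with hh
  set K := s2 m with hK
  have hhm : h ∈ Ip p := sub_mem (s1_mem (by omega)) (s1_mem (by omega))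
  have hKm : K ∈ Ip p := s2_mem (by omega)
  set A := (3*(p:ℚ)+-1) with hA
  set B := (5*(p:ℚ)+-1) with hB
  set C := (5*(p:ℚ)+-3) with hC
  have i2 : (2:ℚ)⁻¹ ∈ Ip p := two_inv_mem hp2
  have n : ∀ k : ℤ, (k:ℚ) ∈ Ip p := int_mem
  have hT : (1-(p:ℚ)) * TT m = m.centralBinom * ((1-(p:ℚ)) * (15 - 10 * (B * A⁻¹) * X1
      + 3 * (2⁻¹ * ((9*p-5)*(9*p-1)) * (B⁻¹*C⁻¹)) * X2 + 3 * (2⁻¹ * B * C⁻¹) * X3)) := by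
    have e1 : ((6*m).choose m : ℚ) = m.centralBinom * (2⁻¹ * (B * A⁻¹)) * X1 := by
      have : ((6*m).choose m : ℚ) * (2*A) = m.centralBinom * B * X1 := by rw [hA, hB]; linear_combination hX1
      field_simp; linear_combination this
    have e2 : ((10*m).choose m : ℚ) = m.centralBinom * (4⁻¹ * ((9*p-5)*(9*p-1)) * (B⁻¹*C⁻¹)) * X2 := by
      have : ((10*m).choose m : ℚ) * (4*B*C) = m.centralBinom * ((9*p-5)*(9*p-1)) * X2 := by rw [hC, hB]; linear_combination hX2
      field_simp; linear_combination this
    have e3 : ((10*m).choose (5*m) : ℚ) = m.centralBinom * (2⁻¹ * B * C⁻¹) * X3 := by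
      have : ((10*m).choose (5*m) : ℚ) * (2*C) = m.centralBinom * B * X3 := by rw [hC, hB]; linear_combination hX3
      field_simp; linear_combination this
    unfold TT
    push_cast
    rw [e1, e2, e3, ← Nat.centralBinom_eq_two_mul_choose]; ring
  rw [hT, show ∀ x y : ℚ, 8 * (x*y) = x * (8*y) by intros; ring]
  apply Cg.mul_left (nat_mem _)
  have hBm : B ∈ Ip p := add_mem (mul_mem (by exact_mod_cast n 5) p_mem) (by exact_mod_cast n (-1))
  have h95 : (9*(p:ℚ)-5)*(9*p-1) ∈ Ip p := mul_mem (sub_mem (mul_mem (by exact_mod_cast n 9) p_mem) (by exact_mod_cast n 5)) (sub_mem (mul_mem (by exact_mod_cast n 9) p_mem) (one_mem _))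
  have h3m : (3:ℚ) ∈ Ip p := by exact_mod_cast n 3
  have k1 := eX1.2.2.mul_left (mul_mem (by exact_mod_cast n 10 : (10:ℚ) ∈ Ip p) (mul_mem hBm a1))
  have k2 := eX2.2.2.mul_left (mul_mem h3m (mul_mem (mul_mem i2 h95) (mul_mem b1 c1)))
  have k3 := eX3.2.2.mul_left (mul_mem h3m (mul_mem (mul_mem i2 hBm) c1))
  have k4 := ((((Cg.refl 3 (15:ℚ)).sub k1).add k2).add k3).mul_left (sub_mem (one_mem _) (p_mem (p := p)))
  refine k4.trans ?_
  refine ⟨(2⁻¹ * (A⁻¹ * (B⁻¹ * C⁻¹))) * (((448:ℤ):ℚ)*(p:ℚ)^0*h^0*K^0 + ((77:ℤ):ℚ)*(p:ℚ)^0*h^0*K^1 + ((240:ℤ):ℚ)*(p:ℚ)^0*h^1*K^0 + ((90:ℤ):ℚ)*(p:ℚ)^0*h^2*K^0 + ((-704:ℤ):ℚ)*(p:ℚ)^1*h^0*K^0 + ((-391:ℤ):ℚ)*(p:ℚ)^1*h^0*K^1 + ((-704:ℤ):ℚ)*(p:ℚ)^1*h^1*K^0 + ((-510:ℤ):ℚ)*(p:ℚ)^1*h^2*K^0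 + ((731:ℤ):ℚ)*(p:ℚ)^2*h^0*K^1 + ((592:ℤ):ℚ)*(p:ℚ)^2*h^1*K^0 + ((1046:ℤ):ℚ)*(p:ℚ)^2*h^2*K^0 + ((-433:ℤ):ℚ)*(p:ℚ)^3*h^0*K^1 + ((-658:ℤ):ℚ)*(p:ℚ)^3*h^2*K^0), ?_, ?_⟩
  · refine mul_mem (mul_mem i2 (mul_mem a1 (mul_mem b1 c1))) ?_
    have hn : ∀ (c : ℤ) (i j k : ℕ), (c:ℚ)*(p:ℚ)^i*h^j*K^k ∈ Ip p := fun c i j k =>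
      mul_mem (mul_mem (mul_mem (int_mem c) (pow_mem p_mem i)) (pow_mem hhm j)) (pow_mem hKm k)
    repeat' apply add_mem
    all_goals exact hn _ _ _ _
  · unfold EE
    clear k1 k2 k3 k4
    field_simp
    rw [hA, hB, hC]
    push_cast
    ring
end
end S18

namespace S18
section
variable {p : ℕ} [hp : Fact p.Prime]

lemma SD_one {m : ℕ} (hm : p = 4*m+1) (hm0 : 0 < m) :
    SD (2*m) = (p:ℚ)^2 * ∏ i ∈ Finset.range m, (((p:ℚ)^2-16*((i:ℚ)+1)^2)/((p:ℚ)^2-4*(2*(i:ℚ)+1)^2)) := by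
  obtain ⟨k, rfl⟩ : ∃ k, m = k+1 := ⟨m-1, by omega⟩
  have hpQ : (p:ℚ) = 4*(k:ℚ)+5 := by rw [hm]; push_cast; ring
  rw [SD_eval, Finset.prod_div_distrib, Finset.prod_div_distrib, prod_sym_even (fun j : ℕ => 4*(j:ℚ)+3)]
  have e1 : ∏ j ∈ Finset.range (2*(k+1)), (4*(j:ℚ)+5) = p * ∏ i ∈ Finset.range (k+1), -((p:ℚ)^2-16*((i:ℚ)+1)^2) * (-1) := by
    rw [show 2*(k+1) = 2*k+1+1 by ring, Finset.prod_range_succ, prod_sym_odd (fun j : ℕ => 4*(j:ℚ)+5),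
      Finset.prod_range_succ]
    have : ∏ i ∈ Finset.range k, ((4*((k-1-i:ℕ):ℚ)+5)*(4*((k+1+i:ℕ):ℚ)+5)) = ∏ i ∈ Finset.range k, -((p:ℚ)^2-16*((i:ℚ)+1)^2) * (-1) := by
      apply Finset.prod_congr rfl
      intro i hi
      simp at hi
      have : ((k-1-i:ℕ):ℚ) = k-1-i := by
        rw [Nat.cast_sub (by omega), Nat.cast_sub (by omega)]; simp
      rw [this, hpQ]; push_cast; ring
    rw [this, hpQ]; push_cast; ring
  have e2 : ∏ i ∈ Finset.range (k+1), ((4*((k+1-1-i:ℕ):ℚ)+3)*(4*((k+1+i:ℕ):ℚ)+3)) = ∏ i ∈ Finset.range (k+1), ((p:ℚ)^2-4*(2*(i:ℚ)+1)^2) := by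
    apply Finset.prod_congr rfl
    intro i hi
    simp at hi
    have : ((k+1-1-i:ℕ):ℚ) = k-i := by
      rw [Nat.add_sub_cancel, Nat.cast_sub (by omega)]
    rw [this, hpQ]; push_cast; ring
  rw [e1, e2]
  have : 2*((2*(k+1):ℕ):ℚ)+1 = p := by rw [hpQ]; push_cast; ring
  rw [this]
  simp only [mul_neg, mul_one, neg_neg]
  ring

lemma cb_unit {m : ℕ} (hm : p = 4*m+1) : (m.centralBinom:ℚ)⁻¹ ∈ Ip p := by
  apply inv_mem_nat
  intro h
  have h2 : p ∣ (2*m).factorial := by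
    rw [← Nat.choose_mul_factorial_mul_factorial (n := 2*m) (k := m) (by omega)]
    exact ((h.mul_right _).mul_right _)
  have := (hp.out.dvd_factorial).1 h2
  omega

lemma SD_one_mod {m : ℕ} (hm : p = 4*m+1) (hm0 : 0 < m) :
    Cg p 3 (SD (2*m)) ((p:ℚ)^2 * ((m.centralBinom:ℚ)^2)⁻¹) := by
  rw [SD_one hm hm0]
  have hp2 : p ≠ 2 := by omega
  have hpQ : (p:ℚ) = 4*(m:ℚ)+1 := by rw [hm]; push_cast; ring
  have hC0 : (m.centralBinom:ℚ) ≠ 0 := by exact_mod_cast m.centralBinom_ne_zero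
  have hCi := cb_unit hm
  refine Cg.mul_p (r := 1) 2 ?_
  have h1 : Cg p 1 (∏ i ∈ Finset.range m, (((p:ℚ)^2-16*((i:ℚ)+1)^2)/((p:ℚ)^2-4*(2*(i:ℚ)+1)^2)))
      (∏ i ∈ Finset.range m, ((2*(i:ℚ)+2)/(2*(i:ℚ)+1))^2) := by
    have hV : ∀ t < m, (2*(t:ℚ)+1)⁻¹ ∈ Ip p := by
      intro t ht
      have := inv_mem_lt (p := p) (k := 2*t+1) (by omega) (by omega)
      push_cast at this; exact this
    have hN : ∀ t : ℕ, (2*(t:ℚ)+2) ∈ Ip p := by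
      intro t
      have := nat_mem (p := p) (2*t+2)
      push_cast at this; exact this
    have hN1 : ∀ t : ℕ, ((t:ℚ)+1) ∈ Ip p := by
      intro t
      have := nat_mem (p := p) (t+1)
      push_cast at this; exact this
    have h16 : (16:ℚ) ∈ Ip p := by exact_mod_cast nat_mem (p := p) 16
    have hD : ∀ t < m, ((p:ℚ)^2-4*(2*(t:ℚ)+1)^2)⁻¹ ∈ Ip p := by
      intro t ht
      have := inv_mem (p := p) (k := (p:ℤ)^2-4*(2*(t:ℤ)+1)^2) ?_
      · push_cast at this; exact this
      · intro h
        have h1 : (p:ℤ) ∣ (2*(2*(t:ℤ)+1))^2 := by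
          have := dvd_sub (dvd_pow_self (p:ℤ) two_ne_zero) h
          rwa [show (p:ℤ)^2 - ((p:ℤ)^2-4*(2*(t:ℤ)+1)^2) = (2*(2*(t:ℤ)+1))^2 by ring] at this
        have h2 := Int.Prime.dvd_pow' hp.out h1
        have h3 : p ∣ 2*(2*t+1) := by exact_mod_cast h2
        have := Nat.le_of_dvd (by omega) h3
        omega
    apply Cg.prod
    · intro t ht
      rw [div_eq_mul_inv]
      exact mul_mem (sub_mem (pow_mem p_mem _) (mul_mem h16 (pow_mem (hN1 t) _))) (hD t ht)
    · intro t ht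
      rw [div_eq_mul_inv]
      exact pow_mem (mul_mem (hN t) (hV t ht)) _
    · intro t ht
      refine ⟨p * ((1 - ((2*(t:ℚ)+2) * (2*(t:ℚ)+1)⁻¹)^2) * ((p:ℚ)^2-4*(2*(t:ℚ)+1)^2)⁻¹), ?_, ?_⟩
      · exact mul_mem p_mem (mul_mem (sub_mem (one_mem _) (pow_mem (mul_mem (hN t) (hV t ht)) _)) (hD t ht))
      · have hD0 : ((p:ℚ)^2-4*(2*(t:ℚ)+1)^2) ≠ 0 := by
          have htl : (t:ℚ) + 1 ≤ m := by exact_mod_cast ht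
          rw [hpQ]
          have : (0:ℚ) ≤ t := by positivity
          nlinarith
        have hv0 : 2*(t:ℚ)+1 ≠ 0 := by positivity
        generalize hd : ((p:ℚ)^2-4*(2*(t:ℚ)+1)^2) = D at *
        field_simp
        rw [← hd]
        ring
  refine h1.trans ?_
  obtain ⟨w, hw⟩ := two_pow_fermat (p := p) hp2
  have h16 : (16:ℚ)^m = 2^(p-1) := by
    rw [show p - 1 = 4*m by omega, pow_mul]; norm_num
  have e : ∏ i ∈ Finset.range m, ((2*(i:ℚ)+2)/(2*(i:ℚ)+1))^2 = (1+p*w) * ((m.centralBinom:ℚ)^2)⁻¹ := by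
    have := W_eq m
    rw [← inv_inj, ← Finset.prod_inv_distrib]
    simp only [← inv_pow, inv_div]
    simp only [inv_pow] at *
    rw [this, h16, hw, mul_inv, inv_inv]; ring
  rw [e]
  exact ⟨w * ((m.centralBinom:ℚ)^2)⁻¹, mul_mem (int_mem w) (by rw [← inv_pow]; exact pow_mem hCi 2), by ring⟩

lemma two_mem : (2:ℚ) ∈ Ip p := by exact_mod_cast nat_mem (p := p) 2

lemma main_one {m : ℕ} (hm : p = 4*m+1) (hm0 : 0 < m) {x y : ℤ} (hxy : (p:ℤ) = x^2+4*y^2) :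
    Cg p 3 ((S0 (2*m) - X0 (2*m))/2) (2*(x:ℚ)^2 - p - (p:ℚ)^2/(4*(x:ℚ)^2)) := by
  have hp2 : p ≠ 2 := by omega
  have hp3 : p ≠ 3 := by omega
  have hX := (X0_mod3 (p := p) (n := 2*m) (by omega) ⟨m, by ring⟩ hp3).trans (SD_one_mod hm hm0)
  have hS := S0_one hm
  have hQ0 := Q_cong hm
  obtain ⟨a, ha, hdvd⟩ := jacobi_claim hm hxy
  have haQ : (a:ℚ)^2 = (x:ℚ)^2 := by exact_mod_cast ha
  set C : ℚ := (m.centralBinom : ℚ) with hCdef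
  have hC0 : C ≠ 0 := by rw [hCdef]; exact_mod_cast m.centralBinom_ne_zero
  have hCi : C⁻¹ ∈ Ip p := cb_unit hm
  have hCm : C ∈ Ip p := nat_mem _
  have h8 : (8:ℚ)⁻¹ ∈ Ip p := by
    have := two_pow_inv_mem (p := p) hp2 3
    norm_num at this; convert this using 1; norm_num
  have h1m : s1 (2*m) ∈ Ip p := s1_mem (by omega)
  have h1m' : s1 m ∈ Ip p := s1_mem (by omega)
  have h2m : s2 m ∈ Ip p := s2_mem (by omega)
  set h := s1 (2*m) - s1 m with hh
  have hhm : h ∈ Ip p := sub_mem h1m h1m'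
  have hA : -h/2 ∈ Ip p := half_mem hp2 (neg_mem hhm)
  have hB : -(s2 m/8) ∈ Ip p := neg_mem (by rw [div_eq_mul_inv]; exact mul_mem h2m h8)
  set G := EE p (-h/2) (-(s2 m/8)) with hG
  have hGm : G ∈ Ip p := EE_mem hp2 hA hB
  set Q : ℚ := (1-(p:ℚ)) * TT m * 8⁻¹ with hQ
  have hQm : Q ∈ Ip p := mul_mem (mul_mem (sub_mem (one_mem _) p_mem) (int_mem _)) h8
  have hQC : Cg p 3 Q (C*G) := by
    have := hQ0.mul_right h8
    rwa [show 8 * (C*G) * 8⁻¹ = C*G by ring] at this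
  have hG1 : Cg p 1 G 1 := by
    refine ⟨-h/2 + p*(((-h/2)^2 - -(s2 m/8))/2), add_mem hA (mul_mem p_mem (half_mem hp2 (sub_mem (pow_mem hA 2) hB))), ?_⟩
    rw [hG]; unfold EE; ring
  have hQ1 : Cg p 1 Q C := by
    have := (hQC.mono (s := 1) (by norm_num)).trans (hG1.mul_left hCm)
    rwa [mul_one] at this
  obtain ⟨hQ0', hQi⟩ := inv_of_Cg hCm hCi hC0 hQ1
  have hQ2S : Cg p 3 (Q^2) (S0 (2*m)) := by
    have e1 : Cg p 3 (Q^2) ((C*G)*(C*G)) := by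
      rw [sq]; exact Cg.mul hQm (mul_mem hCm hGm) hQC hQC
    refine e1.trans (Cg.trans ?_ hS.symm)
    have := (EE_mul hp2 hA hB hA hB).mul_left (pow_mem hCm 2)
    rw [show -h/2 + -h/2 = -h by ring, show -(s2 m/8) + -(s2 m/8) = -(s2 m/4) by ring] at this
    rwa [show C*G*(C*G) = C^2*(G*G) by ring]
  -- Jacobi
  have hJ : Cg p 3 (Q^2 - 2*a*Q + p) 0 := by
    have := Cg_of_dvd (p := p) (u := ((1-p)*TT m)^2 - 16*a*((1-p)*TT m) + 64*p) (v := 0) (by simpa using hdvd)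
    have := this.mul_right (pow_mem h8 2)
    push_cast at this
    rw [zero_mul] at this
    refine Cg.trans (Cg.of_eq ?_) this
    rw [hQ]; ring
  have h2a : Cg p 1 (2*(a:ℚ)) Q := by
    have := (hJ.mono (s := 1) (by norm_num))
    obtain ⟨c, hc, e⟩ := this
    refine ⟨(1 - c)*Q⁻¹, mul_mem (sub_mem (one_mem _) hc) hQi, ?_⟩
    field_simp
    linear_combination -e
  obtain ⟨ha0, hai⟩ := inv_of_Cg hQm hQi hQ0' h2a
  have h2am : 2*(a:ℚ) ∈ Ip p := mul_mem two_mem (int_mem a)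
  have hx4 : 4*(x:ℚ)^2 = (2*(a:ℚ))^2 := by rw [← haQ]; ring
  have hsq1 : Cg p 1 ((2*(a:ℚ))^2) (Q^2) := by
    rw [sq, sq]; exact Cg.mul h2am hQm h2a h2a
  have hinv : ∀ {u v : ℚ}, u ≠ 0 → v ≠ 0 → u⁻¹ ∈ Ip p → v⁻¹ ∈ Ip p → Cg p 1 (u^2) (v^2) →
      Cg p 3 ((p:ℚ)^2 * (u^2)⁻¹) ((p:ℚ)^2 * (v^2)⁻¹) := by
    intro u v hu hv hui hvi huv
    refine Cg.mul_p (r := 1) 2 (Cg.inv ?_ ?_ (pow_ne_zero _ hu) (pow_ne_zero _ hv) huv)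
    · rw [← inv_pow]; exact pow_mem hui 2
    · rw [← inv_pow]; exact pow_mem hvi 2
  have hsqC : Cg p 1 ((2*(a:ℚ))^2) (C^2) := by
    refine hsq1.trans ?_
    rw [sq, sq]; exact Cg.mul hQm hCm hQ1 hQ1
  have iC := hinv ha0 hC0 hai hCi hsqC
  have iQ := hinv ha0 hQ0' hai hQi hsq1
  have hX' : Cg p 3 (X0 (2*m)) ((p:ℚ)^2 * ((2*(a:ℚ))^2)⁻¹) := hX.trans iC.symm
  have hS' : Cg p 3 (S0 (2*m)) ((2*(a:ℚ))^2 - 2*p - (p:ℚ)^2 * ((2*(a:ℚ))^2)⁻¹) := by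
    refine hQ2S.symm.trans (Cg.trans ?_ ((Cg.refl 3 _).sub iQ.symm))
    obtain ⟨c, hc, e⟩ := hJ
    refine ⟨c * (Q^2+2*a*Q+p) * (Q⁻¹)^2, mul_mem (mul_mem hc ?_) (pow_mem hQi 2), ?_⟩
    · exact add_mem (add_mem (pow_mem hQm 2) (mul_mem h2am hQm)) p_mem
    · field_simp
      linear_combination (Q^2+2*a*Q+p)*e
  have := (hS'.sub hX').mul_right (two_inv_mem hp2)
  rw [← div_eq_mul_inv] at this
  refine this.trans (Cg.of_eq ?_)
  rw [show 2*(x:ℚ)^2 = (2*(a:ℚ))^2/2 by rw [← hx4]; ring, hx4]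
  ring

lemma fin_one (c d : ℚ) (hc : d ∈ Ip p) (hcd : c = -2*d) {m : ℕ} (hm : p = 4*m+1) (hm0 : 0 < m) {x y : ℤ}
    (hxy : (p:ℤ) = x^2+4*y^2) {T : ℚ} (hT : Cg p 3 T (c * ∑ k ∈ Finset.range ((p-1)/2+1), (k:ℚ)*ck k)) :
    Cg p 3 T (d * (2*(x:ℚ)^2 - p - (p:ℚ)^2/(4*(x:ℚ)^2))) := by
  refine hT.trans (Cg.trans (Cg.of_eq ?_) ((main_one hm hm0 hxy).mul_left hc))
  rw [show (p-1)/2 = 2*m by omega, S_eq, hcd]; ring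

lemma fin_three (c d : ℚ) (hc : d ∈ Ip p) (hcd : c = -2*d) {l : ℕ} (hl : p = 4*l+3)
    {T : ℚ} (hT : Cg p 3 T (c * ∑ k ∈ Finset.range ((p-1)/2+1), (k:ℚ)*ck k)) :
    Cg p 2 T (d/2 * ((2*(p:ℚ)+2-2^(p-1)) * (((2*l+1).choose l:ℕ):ℚ)^2)) := by
  have hp2 : p ≠ 2 := by omega
  have h := (S0_mod2 (p := p) (l := l) (by omega)).sub (X0_three hl)
  refine (hT.mono (by norm_num)).trans (Cg.trans (Cg.of_eq ?_) ((h.mul_left (half_mem hp2 hc)).trans (Cg.of_eq ?_)))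
  · rw [show (p-1)/2 = 2*l+1 by omega, S_eq, hcd]; ring
  · ring
end
end S18

theorem statement18 (p : ℕ) (hp : p.Prime) (hp2 : p ≠ 2) :
    (∀ x y : ℤ, p % 4 = 1 → (p : ℤ) = x^2 + 4*y^2 →
      ratCongr p 3
        (∑ n ∈ Finset.range p, (n:ℚ)^2 * seqV n / 32^n)
        (2*(x:ℚ)^2 - (p:ℚ) - (p:ℚ)^2/(4*(x:ℚ)^2)) ∧
      ratCongr p 3
        (∑ n ∈ Finset.range p, (n:ℚ)^3 * seqV n / 32^n)
        (6*(x:ℚ)^2 - 3*(p:ℚ) - 3*(p:ℚ)^2/(4*(x:ℚ)^2))) ∧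
    (p % 4 = 3 →
      ratCongr p 2
        (∑ n ∈ Finset.range p, (n:ℚ)^2 * seqV n / 32^n)
        (1/2*R1 p) ∧
      ratCongr p 2
        (∑ n ∈ Finset.range p, (n:ℚ)^3 * seqV n / 32^n)
        (3/2*R1 p)) := by
  haveI : Fact p.Prime := ⟨hp⟩
  have T2 := S18.reduction (p := p) hp2 2 (-2) S18.moment2
  have T3 := S18.reduction (p := p) hp2 3 (-6) S18.moment3
  have m3 : (3:ℚ) ∈ S18.Ip p := by exact_mod_cast S18.nat_mem (p := p) 3
  unfold ratCongr seqV R1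
  refine ⟨fun x y h1 hxy => ?_, fun h3 => ?_⟩
  · have hm : p = 4*(p/4)+1 := by omega
    have hm0 : 0 < p/4 := by have := hp.two_le; omega
    refine ⟨S18.num_dvd_of_Cg ?_, S18.num_dvd_of_Cg ?_⟩
    · refine (S18.fin_one (-2) 1 (one_mem _) (by norm_num) hm hm0 hxy T2).trans (S18.Cg.of_eq ?_)
      ring
    · refine (S18.fin_one (-6) 3 m3 (by norm_num) hm hm0 hxy T3).trans (S18.Cg.of_eq ?_)
      ring
  · have hl : p = 4*(p/4)+3 := by omega
    have e : (p-1)/2 = 2*(p/4)+1 := by omega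
    rw [e]
    refine ⟨S18.num_dvd_of_Cg ?_, S18.num_dvd_of_Cg ?_⟩
    · rw [e] at T2
      exact S18.fin_three (-2) 1 (one_mem _) (by norm_num) hl (by rw [e]; exact T2)
    · rw [e] at T3
      exact S18.fin_three (-6) 3 m3 (by norm_num) hl (by rw [e]; exact T3)
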